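/- (The initial time blow-up is hyperbolic away from the support of the initial measure.) Let T > 0 and let u : ℂ × (0,T) → (0,∞) be a smooth positive solution of the logarithmic fast diffusion equation ∂u/∂t = Δ log u such that for every t ∈ (0,T) the conformal metric u(·,t)|dz|² is complete on ℂ, and such that u starts weakly from a non-zero Radon measure μ on ℂ with no atoms. Then on the open set Ω := ℂ \ supp(μ), the initial time blow-up û(z) := lim_{t ↘ 0} u(z,t)/(2t) exists at every point, is finite and strictly positive, defines a smooth function on Ω, and satisfies Δ log û = 2û on Ω; that is, the conformal metric û|dz|² on Ω has constant Gaussian curvature −1. -/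

import Mathlib

open Set MeasureTheory Filter Metric

/-- The Euclidean Laplacian of `f : ℂ → ℝ` at `z`, i.e. `∂²f/∂x² + ∂²f/∂y²`. -/
noncomputable def lap (f : ℂ → ℝ) (z : ℂ) : ℝ :=
  iteratedFDeriv ℝ 2 f z ![1, 1] + iteratedFDeriv ℝ 2 f z ![Complex.I, Complex.I]

/-- The time-timeSlice of a spacetime `M ⊆ ℂ × ℝ` at time `t`. -/
def timeSlice (M : Set (ℂ × ℝ)) (t : ℝ) : Set ℂ := {z | (z, t) ∈ M}

/-- The conformal distance on `Ω` induced by a conformal factor `v`: the infimum of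
`v`-lengths of `C¹` paths in `Ω` joining `x` to `y`. -/
noncomputable def confDist (v : ℂ → ℝ) (Ω : Set ℂ) (x y : ℂ) : ℝ :=
  sInf {L : ℝ | ∃ γ : ℝ → ℂ, ContDiffOn ℝ 1 γ (Icc 0 1) ∧
    (∀ s ∈ Icc (0:ℝ) 1, γ s ∈ Ω) ∧ γ 0 = x ∧ γ 1 = y ∧
    L = ∫ s in (0:ℝ)..1, Real.sqrt (v (γ s)) * ‖derivWithin γ (Icc 0 1) s‖}

/-- The conformal ball of centre `p` and radius `ρ` in `Ω` for the metric `v|dz|²`. -/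
def confBall (v : ℂ → ℝ) (Ω : Set ℂ) (p : ℂ) (ρ : ℝ) : Set ℂ :=
  {z ∈ connectedComponentIn Ω p | confDist v Ω p z < ρ}

/-- The conformal metric `v|dz|²` is complete on `Ω`: every connected component of `Ω` is a
complete metric space with respect to the induced distance `confDist v Ω`. -/
def ConfComplete (v : ℂ → ℝ) (Ω : Set ℂ) : Prop :=
  ∀ x₀ ∈ Ω, ∀ x : ℕ → ℂ, (∀ n, x n ∈ connectedComponentIn Ω x₀) →
    (∀ ε : ℝ, 0 < ε → ∃ N : ℕ, ∀ m ≥ N, ∀ n ≥ N, confDist v Ω (x m) (x n) < ε) →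
    ∃ l ∈ connectedComponentIn Ω x₀,
      Tendsto (fun n => confDist v Ω (x n) l) atTop (nhds 0)

/-- A conformal Ricci flow spacetime in the ambient space `ℂ × (0,T)`:
`M` is a connected open subset of `ℂ × (0,T)` with non-empty time-slices, and `u` is a smooth
positive conformal factor on `M` solving the logarithmic fast diffusion equation
`∂u/∂t = Δ log u`. -/
structure ConfRFS (T : ℝ) (M : Set (ℂ × ℝ)) (u : ℂ → ℝ → ℝ) : Prop where
  sub : M ⊆ {p : ℂ × ℝ | p.2 ∈ Ioo 0 T}
  opn : IsOpen M
  conn : IsConnected M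
  nonempty : ∀ t ∈ Ioo (0:ℝ) T, (timeSlice M t).Nonempty
  pos : ∀ p ∈ M, 0 < u p.1 p.2
  smooth : ContDiffOn ℝ (⊤ : ℕ∞) (fun p : ℂ × ℝ => u p.1 p.2) M
  lfde : ∀ p ∈ M, deriv (u p.1) p.2 = lap (fun z => Real.log (u z p.2)) p.1

/-- A conformal Ricci flow spacetime is complete if the metric `u(·,t)|dz|²` is complete on the
timeSlice `M_t` for every `t ∈ (0,T)`. -/
def ConfRFSComplete (T : ℝ) (M : Set (ℂ × ℝ)) (u : ℂ → ℝ → ℝ) : Prop :=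
  ∀ t ∈ Ioo (0:ℝ) T, ConfComplete (fun z => u z t) (timeSlice M t)

/-- There is a time-preserving path in `M` from time `s` to the point `(z,t)`. -/
def TimePreservingFrom (M : Set (ℂ × ℝ)) (s : ℝ) (z : ℂ) (t : ℝ) : Prop :=
  ∃ γ : ℝ → ℂ, ContinuousOn γ (Icc s t) ∧ (∀ r ∈ Icc s t, (γ r, r) ∈ M) ∧ γ t = z

/-- The hindsight function of a spacetime `M`. -/
noncomputable def hindsight (M : Set (ℂ × ℝ)) (z : ℂ) (t : ℝ) : ℝ :=
  sInf {s : ℝ | 0 < s ∧ s ≤ t ∧ TimePreservingFrom M s z t}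

/-- A spacetime is initially determined if its hindsight function vanishes identically. -/
def InitiallyDetermined (M : Set (ℂ × ℝ)) : Prop :=
  ∀ p ∈ M, hindsight M p.1 p.2 = 0

/-- A spacetime in `ℂ × (0,T)` is expanding if worldlines persist until the final time. -/
def Expanding (T : ℝ) (M : Set (ℂ × ℝ)) : Prop :=
  ∀ (z : ℂ) (t t' : ℝ), (z, t) ∈ M → t ≤ t' → t' < T → (z, t') ∈ M

/-- An expanding spacetime is continuous if each timeSlice is the interior of the intersection of
all later slices. -/
def ContinuousSpacetime (T : ℝ) (M : Set (ℂ × ℝ)) : Prop :=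
  ∀ s ∈ Ioo (0:ℝ) T, timeSlice M s = interior (⋂ t ∈ Ioo s T, timeSlice M t)

/-- The vanishing time of the point `(z,t)`: the supremum of the connected component containing
`t` of the set of times at which `z` belongs to the spacetime. -/
noncomputable def vanishTime (M : Set (ℂ × ℝ)) (z : ℂ) (t : ℝ) : ℝ :=
  sSup (connectedComponentIn {r : ℝ | (z, r) ∈ M} t)

/-- The (closed) support of a measure on `ℂ`: the points all of whose open neighbourhoods have
positive measure. -/
def measSupport (μ : Measure ℂ) : Set ℂ :=
  {x | ∀ U : Set ℂ, IsOpen U → x ∈ U → μ U ≠ 0}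

/-- The `v`-length of the restriction of `γ` to `[a,b]`. -/
noncomputable def pathLen (v : ℂ → ℝ) (γ : ℝ → ℂ) (a b : ℝ) : ℝ :=
  ∫ s in a..b, Real.sqrt (v (γ s)) * ‖deriv γ s‖

theorem continuous_pathLen_integrand {v : ℂ → ℝ} (hv : Continuous v) {γ : ℝ → ℂ}
    (hγ : ContDiff ℝ 1 γ) : Continuous fun s => Real.sqrt (v (γ s)) * ‖deriv γ s‖ :=
  ((hv.comp hγ.continuous).sqrt).mul (hγ.continuous_deriv le_rfl).norm

theorem pathLen_nonneg (v : ℂ → ℝ) (γ : ℝ → ℂ) {a b : ℝ} (hab : a ≤ b) : 0 ≤ pathLen v γ a b :=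
  intervalIntegral.integral_nonneg hab fun _ _ => by positivity

theorem confDist_bddBelow (v : ℂ → ℝ) (x y : ℂ) :
    BddBelow {L : ℝ | ∃ γ : ℝ → ℂ, ContDiffOn ℝ 1 γ (Icc 0 1) ∧
    (∀ s ∈ Icc (0:ℝ) 1, γ s ∈ (univ : Set ℂ)) ∧ γ 0 = x ∧ γ 1 = y ∧
    L = ∫ s in (0:ℝ)..1, Real.sqrt (v (γ s)) * ‖derivWithin γ (Icc 0 1) s‖} := by
  refine ⟨0, ?_⟩
  rintro L ⟨γ, -, -, -, -, rfl⟩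
  exact intervalIntegral.integral_nonneg zero_le_one fun _ _ => by positivity

theorem confDist_le_pathLen_zero_one {v : ℂ → ℝ} {γ : ℝ → ℂ} (hγ : ContDiff ℝ 1 γ) :
    confDist v univ (γ 0) (γ 1) ≤ pathLen v γ 0 1 := by
  refine csInf_le (confDist_bddBelow v _ _) ⟨γ, hγ.contDiffOn, fun _ _ => mem_univ _, rfl, rfl, ?_⟩
  refine intervalIntegral.integral_congr fun s hs => ?_
  rw [uIcc_of_le zero_le_one] at hs
  rw [(hγ.differentiable one_ne_zero s).derivWithin (uniqueDiffOn_Icc zero_lt_one s hs)]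

theorem confDist_le_pathLen {v : ℂ → ℝ} {γ : ℝ → ℂ} (hγ : ContDiff ℝ 1 γ) {a b : ℝ}
    (hab : a ≤ b) : confDist v univ (γ a) (γ b) ≤ pathLen v γ a b := by
  have h := confDist_le_pathLen_zero_one (v := v) (γ := fun s => γ ((b - a) * s + a))
    (hγ.comp (by fun_prop))
  have e : pathLen v (fun s => γ ((b - a) * s + a)) 0 1 = pathLen v γ a b := by
    unfold pathLen
    have hd : ∀ s, deriv (fun s => γ ((b - a) * s + a)) s =
        (b - a) • deriv γ ((b - a) * s + a) := by
      intro s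
      have h1 : HasDerivAt (fun s : ℝ => (b - a) * s + a) (b - a) s := by
        simpa using ((hasDerivAt_id s).const_mul (b - a)).add_const a
      exact ((hγ.differentiable one_ne_zero _).hasDerivAt.scomp s h1).deriv
    simp_rw [hd, norm_smul, Real.norm_eq_abs, abs_of_nonneg (sub_nonneg.2 hab)]
    have := intervalIntegral.mul_integral_comp_mul_add (a := 0) (b := 1)
      (f := fun s => Real.sqrt (v (γ s)) * ‖deriv γ s‖) (b - a) a
    rw [show (b - a) * 0 + a = a by ring, show (b - a) * 1 + a = b by ring] at this
    rw [← this, ← intervalIntegral.integral_const_mul]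
    congr 1; ext s; ring
  rw [e] at h
  simpa using h

theorem confDist_nonneg (v : ℂ → ℝ) (x y : ℂ) : 0 ≤ confDist v univ x y := by
  refine Real.sInf_nonneg ?_
  rintro L ⟨γ, -, -, -, -, rfl⟩
  exact intervalIntegral.integral_nonneg zero_le_one fun _ _ => by positivity

theorem confDist_le_of_segment {v : ℂ → ℝ} (hv : Continuous v) {x y : ℂ} {C : ℝ}
    (h : ∀ z ∈ segment ℝ x y, Real.sqrt (v z) ≤ C) : confDist v univ x y ≤ C * ‖y - x‖ := by
  have hγ : ContDiff ℝ 1 (fun s : ℝ => x + s • (y - x)) := by fun_prop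
  have h1 := confDist_le_pathLen_zero_one (v := v) hγ
  simp only [zero_smul, add_zero, one_smul, add_sub_cancel] at h1
  refine h1.trans ?_
  unfold pathLen
  have hd : ∀ s, deriv (fun s : ℝ => x + s • (y - x)) s = y - x := by
    intro s
    simpa using (((hasDerivAt_id s).smul_const (y - x)).const_add x).deriv
  calc _ ≤ ∫ s in (0:ℝ)..1, C * ‖y - x‖ := by
        refine intervalIntegral.integral_mono_on zero_le_one ?_ (by simp) ?_
        · exact (continuous_pathLen_integrand hv hγ).intervalIntegrable _ _
        · intro s hs
          rw [hd]
          refine mul_le_mul_of_nonneg_right (h _ ?_) (norm_nonneg _)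
          rw [segment_eq_image']
          exact ⟨s, hs, rfl⟩
    _ = _ := by simp

/-- Paths almost realising the conformal distance can be taken `C¹` on all of `ℝ` and constant
outside `[0,1]`. -/
theorem exists_path_of_confDist_lt {v : ℂ → ℝ} (hv : Continuous v) {x y : ℂ} {c : ℝ}
    (h : confDist v univ x y < c) :
    ∃ γ : ℝ → ℂ, ContDiff ℝ 1 γ ∧ (∀ s ≤ 0, γ s = x) ∧ (∀ s, 1 ≤ s → γ s = y) ∧
      pathLen v γ 0 1 < c := by
  have hne : {L : ℝ | ∃ γ : ℝ → ℂ, ContDiffOn ℝ 1 γ (Icc 0 1) ∧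
      (∀ s ∈ Icc (0:ℝ) 1, γ s ∈ (univ : Set ℂ)) ∧ γ 0 = x ∧ γ 1 = y ∧
      L = ∫ s in (0:ℝ)..1, Real.sqrt (v (γ s)) * ‖derivWithin γ (Icc 0 1) s‖}.Nonempty :=
    ⟨_, fun s => x + s • (y - x), by fun_prop, fun _ _ => mem_univ _, by simp, by simp, rfl⟩
  obtain ⟨L, ⟨γ, hγ, -, h0, h1, rfl⟩, hL⟩ := exists_lt_of_csInf_lt hne h
  have hm : ∀ s, Real.smoothTransition s ∈ Icc (0:ℝ) 1 := fun s =>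
    ⟨Real.smoothTransition.nonneg s, Real.smoothTransition.le_one s⟩
  have hσ : ContDiff ℝ 1 Real.smoothTransition := Real.smoothTransition.contDiff
  refine ⟨γ ∘ Real.smoothTransition, ?_, ?_, ?_, ?_⟩
  · exact contDiffOn_univ.1 (hγ.comp hσ.contDiffOn fun s _ => hm s)
  · intro s hs; simp [Real.smoothTransition.zero_of_nonpos hs, h0]
  · intro s hs; simp [Real.smoothTransition.one_of_one_le hs, h1]
  · refine lt_of_eq_of_lt ?_ hL
    have hd : ∀ s, HasDerivAt (γ ∘ Real.smoothTransition)
        (deriv Real.smoothTransition s •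
          derivWithin γ (Icc 0 1) (Real.smoothTransition s)) s := by
      intro s
      have h2 := ((hγ.differentiableOn one_ne_zero) _ (hm s)).hasDerivWithinAt
      have h3 := (hσ.differentiable one_ne_zero s).hasDerivAt
      have := h2.scomp s (h3.hasDerivWithinAt (s := univ)) fun s _ => hm s
      simpa using this
    have hpos : ∀ s, 0 ≤ deriv Real.smoothTransition s := fun s =>
      Real.smoothTransition.monotone.deriv_nonneg
    have key := intervalIntegral.integral_comp_mul_deriv' (a := 0) (b := 1)
      (f := Real.smoothTransition) (f' := deriv Real.smoothTransition)
      (g := fun s => Real.sqrt (v (γ s)) * ‖derivWithin γ (Icc 0 1) s‖)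
      (fun s _ => (hσ.differentiable one_ne_zero s).hasDerivAt)
      (hσ.continuous_deriv le_rfl).continuousOn
    have hgc : ContinuousOn (fun s => Real.sqrt (v (γ s)) * ‖derivWithin γ (Icc 0 1) s‖)
        (Icc 0 1) := by
      refine ContinuousOn.mul ?_ ?_
      · exact (Real.continuous_sqrt.comp hv).comp_continuousOn hγ.continuousOn
      · exact (hγ.continuousOn_derivWithin (uniqueDiffOn_Icc zero_lt_one) le_rfl).norm
    have himg : Real.smoothTransition '' uIcc 0 1 ⊆ Icc 0 1 := by
      rintro _ ⟨s, -, rfl⟩; exact hm s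
    have key' := key (hgc.mono himg)
    rw [Real.smoothTransition.zero, Real.smoothTransition.one] at key'
    rw [← key']
    unfold pathLen
    congr 1; ext s
    rw [(hd s).deriv, norm_smul, Real.norm_eq_abs, abs_of_nonneg (hpos s)]
    simp only [Function.comp]
    ring

theorem confDist_triangle {v : ℂ → ℝ} (hv : Continuous v) (x y z : ℂ) :
    confDist v univ x z ≤ confDist v univ x y + confDist v univ y z := by
  refine le_of_forall_pos_lt_add fun ε hε => ?_
  obtain ⟨γ, hγ, h0, h1, hl⟩ := exists_path_of_confDist_lt hv
    (show confDist v univ x y < confDist v univ x y + ε / 2 by linarith)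
  obtain ⟨η, hη, k0, k1, kl⟩ := exists_path_of_confDist_lt hv
    (show confDist v univ y z < confDist v univ y z + ε / 2 by linarith)
  set ξ : ℝ → ℂ := fun s => γ s + η (s - 1) - y with hξ
  have hξc : ContDiff ℝ 1 ξ := (hγ.add (hη.comp (by fun_prop))).sub contDiff_const
  have key := confDist_le_pathLen (v := v) hξc (a := 0) (b := 2) (by norm_num)
  have e0 : ξ 0 = x := by simp [hξ, h0 0 le_rfl, k0 (-1) (by norm_num)]
  have e2 : ξ 2 = z := by
    simp only [hξ]; rw [h1 2 (by norm_num), k1 (2 - 1) (by norm_num)]; ring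
  rw [e0, e2] at key
  have hi : ∀ a b, IntervalIntegrable (fun s => Real.sqrt (v (ξ s)) * ‖deriv ξ s‖) volume a b :=
    fun a b => (continuous_pathLen_integrand hv hξc).intervalIntegrable _ _
  have hsplit : pathLen v ξ 0 2 = pathLen v ξ 0 1 + pathLen v ξ 1 2 :=
    (intervalIntegral.integral_add_adjacent_intervals (hi 0 1) (hi 1 2)).symm
  have hA : pathLen v ξ 0 1 = pathLen v γ 0 1 := by
    unfold pathLen
    refine intervalIntegral.integral_congr_ae_restrict ?_
    rw [uIoc_of_le zero_le_one, ← restrict_Ioo_eq_restrict_Ioc]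
    refine (ae_restrict_iff' measurableSet_Ioo).2 (Eventually.of_forall fun s hs => ?_)
    have he : ξ =ᶠ[nhds s] γ := by
      filter_upwards [Iio_mem_nhds hs.2] with r hr
      simp [hξ, k0 (r - 1) (by simpa using hr.le)]
    simp only
    rw [he.deriv_eq, he.eq_of_nhds]
  have hB : pathLen v ξ 1 2 = pathLen v η 0 1 := by
    have : pathLen v ξ 1 2 =
        ∫ s in (1:ℝ)..2, (fun r => Real.sqrt (v (η r)) * ‖deriv η r‖) (s - 1) := by
      unfold pathLen
      refine intervalIntegral.integral_congr_ae_restrict ?_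
      rw [uIoc_of_le one_le_two, ← restrict_Ioo_eq_restrict_Ioc]
      refine (ae_restrict_iff' measurableSet_Ioo).2 (Eventually.of_forall fun s hs => ?_)
      have he : ξ =ᶠ[nhds s] fun r => η (r - 1) := by
        filter_upwards [Ioi_mem_nhds hs.1] with r hr
        simp [hξ, h1 r (le_of_lt hr)]
      simp only
      rw [he.deriv_eq, he.eq_of_nhds, deriv_comp_sub_const]
    rw [this, intervalIntegral.integral_comp_sub_right
        (fun r => Real.sqrt (v (η r)) * ‖deriv η r‖) 1]
    norm_num [pathLen]
  rw [hsplit, hA, hB] at key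
  linarith

theorem confDist_comm_le {v : ℂ → ℝ} (hv : Continuous v) (x y : ℂ) :
    confDist v univ y x ≤ confDist v univ x y := by
  refine le_of_forall_pos_lt_add fun ε hε => ?_
  obtain ⟨γ, hγ, h0, h1, hl⟩ := exists_path_of_confDist_lt hv
    (show confDist v univ x y < confDist v univ x y + ε by linarith)
  have key := confDist_le_pathLen (v := v) (γ := fun s => γ (-s)) (hγ.comp contDiff_neg)
    (a := -1) (b := 0) (by norm_num)
  have e : pathLen v (fun s => γ (-s)) (-1) 0 = pathLen v γ 0 1 := by
    unfold pathLen
    simp_rw [deriv_comp_neg, norm_neg]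
    rw [intervalIntegral.integral_comp_neg (fun s => Real.sqrt (v (γ s)) * ‖deriv γ s‖)]
    simp
  rw [e] at key
  simp only [neg_neg, neg_zero, h0 0 le_rfl, h1 1 le_rfl] at key
  linarith

theorem le_confDist_of_le_norm {v : ℂ → ℝ} (hv : Continuous v) {x y : ℂ} {m ρ : ℝ} (hm : 0 ≤ m)
    (h : ∀ z ∈ closedBall x ρ, m ≤ Real.sqrt (v z)) (hy : ρ ≤ ‖y - x‖) :
    m * ρ ≤ confDist v univ x y := by
  by_contra! hlt
  obtain ⟨γ, hγ, h0, h1, hl⟩ := exists_path_of_confDist_lt hv hlt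
  have hK : IsCompact {s : ℝ | s ∈ Icc 0 1 ∧ ρ ≤ ‖γ s - x‖} := by
    refine isCompact_Icc.inter_right ?_
    exact isClosed_le continuous_const (hγ.continuous.sub continuous_const).norm
  obtain ⟨τ, ⟨hτ, hτρ⟩, hmin⟩ := hK.exists_isLeast
      ⟨1, ⟨zero_le_one, le_rfl⟩, by rw [h1 1 le_rfl]; exact hy⟩
  have hin : ∀ s ∈ Ico 0 τ, γ s ∈ closedBall x ρ := by
    intro s hs
    by_contra hc
    rw [mem_closedBall, dist_eq_norm, not_le] at hc
    exact absurd (hmin ⟨⟨hs.1, hs.2.le.trans hτ.2⟩, hc.le⟩) (not_le.2 hs.2)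
  have hi : ∀ a b, IntervalIntegrable (fun s => Real.sqrt (v (γ s)) * ‖deriv γ s‖) volume a b :=
    fun a b => (continuous_pathLen_integrand hv hγ).intervalIntegrable _ _
  have hsplit : pathLen v γ 0 τ + pathLen v γ τ 1 = pathLen v γ 0 1 :=
    intervalIntegral.integral_add_adjacent_intervals (hi 0 τ) (hi τ 1)
  have h2 := pathLen_nonneg v γ hτ.2
  have hdc := hγ.continuous_deriv le_rfl
  have h3 : m * ‖γ τ - γ 0‖ ≤ pathLen v γ 0 τ := by
    have h4 : ∫ s in (0:ℝ)..τ, deriv γ s = γ τ - γ 0 :=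
      intervalIntegral.integral_deriv_eq_sub (fun s _ => hγ.differentiable one_ne_zero s)
        (hdc.intervalIntegrable _ _)
    rw [← h4]
    calc m * ‖∫ s in (0:ℝ)..τ, deriv γ s‖ ≤ m * ∫ s in (0:ℝ)..τ, ‖deriv γ s‖ :=
          mul_le_mul_of_nonneg_left (intervalIntegral.norm_integral_le_integral_norm hτ.1) hm
      _ = ∫ s in (0:ℝ)..τ, m * ‖deriv γ s‖ := by rw [intervalIntegral.integral_const_mul]
      _ ≤ _ := by
        refine intervalIntegral.integral_mono_on_of_le_Ioo hτ.1
          ((continuous_const.mul hdc.norm).intervalIntegrable _ _) (hi _ _) fun s hs => ?_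
        exact mul_le_mul_of_nonneg_right (h _ (hin s ⟨hs.1.le, hs.2⟩)) (norm_nonneg _)
  rw [h0 0 le_rfl] at h3
  have := mul_le_mul_of_nonneg_left hτρ hm
  linarith

theorem exists_confDist_half {v : ℂ → ℝ} (hv : Continuous v) {x y : ℂ} {c : ℝ}
    (h : confDist v univ x y < c) :
    ∃ z, confDist v univ x z < c / 2 ∧ confDist v univ z y < c / 2 := by
  obtain ⟨γ, hγ, h0, h1, hl⟩ := exists_path_of_confDist_lt hv h
  have hic := continuous_pathLen_integrand hv hγ
  have hi : ∀ a b, IntervalIntegrable (fun s => Real.sqrt (v (γ s)) * ‖deriv γ s‖) volume a b :=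
    fun a b => hic.intervalIntegrable _ _
  have hc : Continuous fun s => pathLen v γ 0 s :=
    intervalIntegral.continuous_primitive hi 0
  have hn := pathLen_nonneg v γ zero_le_one
  obtain ⟨s, hs, he⟩ := intermediate_value_Icc zero_le_one hc.continuousOn
    (show pathLen v γ 0 1 / 2 ∈ Icc (pathLen v γ 0 0) (pathLen v γ 0 1) by
      simp only [pathLen, intervalIntegral.integral_same]
      exact ⟨by positivity, by unfold pathLen at hn; linarith⟩)
  have hsplit : pathLen v γ 0 s + pathLen v γ s 1 = pathLen v γ 0 1 :=
    intervalIntegral.integral_add_adjacent_intervals (hi 0 s) (hi s 1)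
  have k1 := confDist_le_pathLen (v := v) hγ hs.1
  have k2 := confDist_le_pathLen (v := v) hγ hs.2
  rw [h0 0 le_rfl] at k1
  rw [h1 1 le_rfl] at k2
  simp only at he
  exact ⟨γ s, by linarith, by linarith⟩

theorem exists_confDist_lt {v : ℂ → ℝ} (hv : Continuous v) (x : ℂ) {ε : ℝ} (hε : 0 < ε) :
    ∃ δ > 0, ∀ y, ‖y - x‖ < δ → confDist v univ x y < ε := by
  obtain ⟨C, hC⟩ := (isCompact_closedBall x 1).bddAbove_image
    (f := fun z => Real.sqrt (v z)) hv.sqrt.continuousOn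
  have hC0 : 0 ≤ C := (Real.sqrt_nonneg _).trans (hC ⟨x, mem_closedBall_self zero_le_one, rfl⟩)
  refine ⟨min 1 (ε / (C + 1)), by positivity, fun y hy => ?_⟩
  have hseg : ∀ z ∈ segment ℝ x y, Real.sqrt (v z) ≤ C := fun z hz =>
    hC ⟨z, (convex_closedBall x 1).segment_subset (mem_closedBall_self zero_le_one)
      (by rw [mem_closedBall, dist_eq_norm]; exact (hy.trans_le (min_le_left _ _)).le) hz, rfl⟩
  have h1 := confDist_le_of_segment hv hseg
  have h2 : ‖y - x‖ < ε / (C + 1) := hy.trans_le (min_le_right _ _)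
  rw [lt_div_iff₀ (by positivity)] at h2
  nlinarith [norm_nonneg (y - x)]

theorem confDist_self {v : ℂ → ℝ} (hv : Continuous v) (x : ℂ) : confDist v univ x x = 0 := by
  refine le_antisymm ?_ (confDist_nonneg _ _ _)
  refine le_of_forall_pos_lt_add fun ε hε => ?_
  obtain ⟨δ, hδ, h⟩ := exists_confDist_lt hv x hε
  simpa using h x (by simpa)

theorem exists_unbounded_smaller_ball {v : ℂ → ℝ} (hv : Continuous v) {x : ℂ} {ρ : ℝ} (hρ : 0 < ρ)
    (h : ∀ r : ℝ, ∃ z, confDist v univ x z < ρ ∧ r < ‖z‖) :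
    ∃ y, confDist v univ x y ≤ ρ ∧ ∀ r : ℝ, ∃ z, confDist v univ y z < 2 / 3 * ρ ∧ r < ‖z‖ := by
  choose z hz hzn using fun n : ℕ => h n
  choose y hxy hyz using fun n => exists_confDist_half hv (hz n)
  by_cases hb : ∃ r, ∀ n, ‖y n‖ ≤ r
  · obtain ⟨r, hr⟩ := hb
    obtain ⟨l, -, φ, hφ, hl⟩ := (isCompact_closedBall (0 : ℂ) r).tendsto_subseq
      (x := y) fun n => by simpa using hr n
    obtain ⟨δ, hδ, hd⟩ := exists_confDist_lt hv l (ε := ρ / 6) (by positivity)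
    have hev : ∀ᶠ n in atTop, ‖y (φ n) - l‖ < δ := by
      have := Metric.tendsto_nhds.1 hl δ hδ
      simpa [dist_eq_norm] using this
    refine ⟨l, ?_, fun r => ?_⟩
    · obtain ⟨n, hn⟩ := hev.exists
      have h1 := hd _ hn
      have h2 := confDist_comm_le hv l (y (φ n))
      have h3 := confDist_triangle hv x (y (φ n)) l
      have := hxy (φ n)
      linarith
    · obtain ⟨n, hn, hnr⟩ := (hev.and ((tendsto_natCast_atTop_atTop (R := ℝ)).comp
        hφ.tendsto_atTop |>.eventually_ge_atTop r)).exists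
      refine ⟨z (φ n), ?_, lt_of_le_of_lt hnr (hzn _)⟩
      have h1 := hd _ hn
      have h3 := confDist_triangle hv l (y (φ n)) (z (φ n))
      have := hyz (φ n)
      linarith
  · push Not at hb
    refine ⟨x, by rw [confDist_self hv]; exact hρ.le, fun r => ?_⟩
    obtain ⟨n, hn⟩ := hb r
    exact ⟨y n, by linarith [hxy n], hn⟩

/-- In a complete conformal metric on the plane, bounded sets are Euclidean bounded. -/
theorem ConfComplete.exists_norm_le {v : ℂ → ℝ} (hv : Continuous v) (hpos : ∀ z, 0 < v z)
    (hc : ConfComplete v univ) (x : ℂ) (ρ : ℝ) :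
    ∃ r : ℝ, ∀ z, confDist v univ x z < ρ → ‖z‖ ≤ r := by
  by_contra! hcon
  have hρ : 0 < ρ := by
    obtain ⟨z, hz, -⟩ := hcon 0
    exact (confDist_nonneg _ _ _).trans_lt hz
  let P : ℕ → ℂ → Prop := fun k y =>
    ∀ r : ℝ, ∃ z, confDist v univ y z < (2 / 3) ^ k * ρ ∧ r < ‖z‖
  have step : ∀ k y, P k y → ∃ y', confDist v univ y y' ≤ (2 / 3) ^ k * ρ ∧ P (k + 1) y' := by
    intro k y hy
    obtain ⟨y', h1, h2⟩ := exists_unbounded_smaller_ball hv (by positivity) hy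
    refine ⟨y', h1, fun r => ?_⟩
    obtain ⟨z, hz, hzr⟩ := h2 r
    exact ⟨z, by rw [pow_succ]; linarith, hzr⟩
  let Y : ∀ k, {y // P k y} := fun k => Nat.rec (motive := fun k => {y // P k y})
    ⟨x, fun r => by simpa using hcon r⟩
    (fun k y => ⟨(step k y.1 y.2).choose, (step k y.1 y.2).choose_spec.2⟩) k
  let y : ℕ → ℂ := fun k => (Y k).1
  have hyP : ∀ k, P k (y k) := fun k => (Y k).2
  have hyd : ∀ k, confDist v univ (y k) (y (k + 1)) ≤ (2 / 3) ^ k * ρ := fun k =>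
    (step k (Y k).1 (Y k).2).choose_spec.1
  have hyd2 : ∀ n k, confDist v univ (y n) (y (n + k)) ≤
      3 * ρ * (2 / 3) ^ n * (1 - (2 / 3) ^ k) := by
    intro n k
    induction k with
    | zero => simp [confDist_self hv]
    | succ k ih =>
      have h1 := confDist_triangle hv (y n) (y (n + k)) (y (n + (k + 1)))
      have h2 := hyd (n + k)
      rw [← add_assoc] at h1 ⊢
      rw [pow_add] at h2
      rw [pow_succ]
      nlinarith
  have hyd3 : ∀ n m, n ≤ m → confDist v univ (y n) (y m) ≤ 3 * ρ * (2 / 3) ^ n := by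
    intro n m hnm
    obtain ⟨k, rfl⟩ := Nat.exists_eq_add_of_le hnm
    refine (hyd2 n k).trans ?_
    have : (0:ℝ) ≤ (2 / 3) ^ k := by positivity
    have : 0 ≤ 3 * ρ * (2 / 3) ^ n := by positivity
    nlinarith
  have hlim : ∀ c : ℝ, Tendsto (fun n : ℕ => c * (2 / 3 : ℝ) ^ n) atTop (nhds 0) := by
    intro c
    simpa using (tendsto_pow_atTop_nhds_zero_of_lt_one (r := (2 / 3 : ℝ)) (by norm_num)
      (by norm_num)).const_mul c
  have hcomp : connectedComponentIn (univ : Set ℂ) x = univ := by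
    rw [connectedComponentIn_univ, PreconnectedSpace.connectedComponent_eq_univ]
  obtain ⟨l, -, hl⟩ := hc x (mem_univ _) y (fun n => by rw [hcomp]; exact mem_univ _) (by
    intro ε hε
    obtain ⟨N, hN⟩ := eventually_atTop.1 ((hlim (3 * ρ)).eventually (gt_mem_nhds hε))
    refine ⟨N, fun m hm n hn => ?_⟩
    rcases le_total m n with hmn | hmn
    · exact (hyd3 _ _ hmn).trans_lt (hN m hm)
    · exact ((confDist_comm_le hv _ _).trans (hyd3 _ _ hmn)).trans_lt (hN n hn))
  obtain ⟨z₁, -, hmin⟩ := (isCompact_closedBall l 1).exists_isMinOn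
    ⟨l, mem_closedBall_self zero_le_one⟩ (f := fun z => Real.sqrt (v z)) hv.sqrt.continuousOn
  set m := Real.sqrt (v z₁)
  have hm : 0 < m := Real.sqrt_pos.2 (hpos _)
  obtain ⟨n, hn1, hn2⟩ := ((hl.eventually (gt_mem_nhds (half_pos hm))).and
    ((hlim ρ).eventually (gt_mem_nhds (half_pos hm)))).exists
  obtain ⟨z, hz, hzr⟩ := hyP n (‖l‖ + 1)
  have h1 := confDist_triangle hv l (y n) z
  have h2 := confDist_comm_le hv (y n) l
  have h3 := le_confDist_of_le_norm (v := v) hv (x := l) (y := z) (m := m) (ρ := 1) hm.le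
    (fun w hw => hmin hw) (by
      have := norm_sub_norm_le z l
      linarith)
  linarith [mul_comm ρ ((2 / 3 : ℝ) ^ n)]

/-- The energy of the discrete path `z 0, …, z N` with respect to `v|dz|²`. -/
noncomputable def chainEnergy (N : ℕ) (v : ℂ → ℝ) (z : ℕ → ℂ) : ℝ :=
  N * ∑ i ∈ Finset.range N, v (z i) * ‖z (i + 1) - z i‖ ^ 2

theorem step_le_chainEnergy {N : ℕ} {v : ℂ → ℝ} (hv : ∀ z, 0 ≤ v z) (z : ℕ → ℂ) {i : ℕ}
    (hi : i < N) : N * (v (z i) * ‖z (i + 1) - z i‖ ^ 2) ≤ chainEnergy N v z := by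
  refine mul_le_mul_of_nonneg_left ?_ (Nat.cast_nonneg _)
  exact Finset.single_le_sum (f := fun i => v (z i) * ‖z (i + 1) - z i‖ ^ 2)
    (fun j _ => mul_nonneg (hv _) (sq_nonneg _)) (Finset.mem_range.2 hi)

theorem sum_length_le_sqrt_chainEnergy {N : ℕ} {v : ℂ → ℝ} (hv : ∀ z, 0 ≤ v z) (z : ℕ → ℂ) {k : ℕ}
    (hk : k ≤ N) : ∑ i ∈ Finset.range k, Real.sqrt (v (z i)) * ‖z (i + 1) - z i‖ ≤
      Real.sqrt (chainEnergy N v z) := by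
  refine Real.le_sqrt_of_sq_le ?_
  calc _ ≤ (∑ i ∈ Finset.range N, Real.sqrt (v (z i)) * ‖z (i + 1) - z i‖) ^ 2 := by
        refine pow_le_pow_left₀ (Finset.sum_nonneg fun _ _ => by positivity) ?_ 2
        exact Finset.sum_le_sum_of_subset_of_nonneg
          (by simpa using hk) fun _ _ _ => by positivity
    _ ≤ (Finset.range N).card * ∑ i ∈ Finset.range N,
          (Real.sqrt (v (z i)) * ‖z (i + 1) - z i‖) ^ 2 := sq_sum_le_card_mul_sum_sq
    _ = _ := by
      simp only [Finset.card_range, chainEnergy, mul_pow]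
      congr 2; ext i
      rw [Real.sq_sqrt (hv _)]

section
variable {T : ℝ} {u : ℂ → ℝ → ℝ}

theorem continuous_slice (hu : ContinuousOn (fun p : ℂ × ℝ => u p.1 p.2) (univ ×ˢ Ioo 0 T)) {t : ℝ}
    (ht : t ∈ Ioo 0 T) : Continuous fun z => u z t :=
  hu.comp_continuous (f := fun z => (z, t)) (by fun_prop) fun z => ⟨mem_univ _, ht⟩

theorem chain_bounded_near (hu : ContinuousOn (fun p : ℂ × ℝ => u p.1 p.2) (univ ×ˢ Ioo 0 T))
    (hpos : ∀ z, ∀ t ∈ Ioo 0 T, 0 < u z t)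
    (hcomplete : ∀ t ∈ Ioo (0:ℝ) T, ConfComplete (fun z => u z t) univ) (R : ℝ) {t₀ : ℝ}
    (ht₀ : t₀ ∈ Ioo 0 T) :
    ∃ δ > 0, ∃ r : ℝ, ∃ N₀ : ℕ, ∀ N ≥ N₀, ∀ t ∈ Ioo 0 T, |t - t₀| < δ → ∀ z : ℕ → ℂ, z 0 = 0 →
      chainEnergy N (fun w => u w t) z ≤ R → ∀ i ≤ N, ‖z i‖ ≤ r := by
  set v : ℂ → ℝ := fun z => u z t₀
  have hv : Continuous v := continuous_slice hu ht₀
  obtain ⟨r, hr⟩ := (hcomplete t₀ ht₀).exists_norm_le hv (fun z => hpos z t₀ ht₀) 0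
    (2 * Real.sqrt R + 1)
  have hr0 : 0 ≤ r := (norm_nonneg (0:ℂ)).trans
    (hr 0 (by rw [confDist_self hv]; positivity))
  obtain ⟨η, hη, hηI⟩ := Metric.isOpen_iff.1 isOpen_Ioo t₀ ht₀
  have hηI' : closedBall t₀ (η / 2) ⊆ Ioo 0 T :=
    (closedBall_subset_ball (by linarith)).trans hηI
  set K : Set (ℂ × ℝ) := closedBall 0 (r + 1) ×ˢ closedBall t₀ (η / 2)
  have hK : IsCompact K := (isCompact_closedBall _ _).prod (isCompact_closedBall _ _)
  have hKs : K ⊆ univ ×ˢ Ioo 0 T := prod_mono (subset_univ _) hηI'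
  set U : ℂ × ℝ → ℝ := fun p => Real.sqrt (u p.1 p.2)
  have hU : ContinuousOn U K := (hu.mono hKs).sqrt
  obtain ⟨p₀, hp₀, hmin⟩ := hK.exists_isMinOn
    ⟨(0, t₀), by simpa using by linarith, mem_closedBall_self (by linarith)⟩ hU
  set m := U p₀
  have hm : 0 < m := Real.sqrt_pos.2 (hpos _ _ (hKs hp₀).2)
  obtain ⟨δ, hδ, hUδ⟩ := Metric.uniformContinuousOn_iff.1
    (hK.uniformContinuousOn_of_continuous hU) m hm
  set δ' := min (δ / 2) 1
  have hδ' : 0 < δ' := by positivity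
  obtain ⟨N₀, hN₀⟩ := exists_nat_gt (|R| / (m ^ 2 * δ' ^ 2))
  refine ⟨min (δ / 2) (η / 2), by positivity, r, N₀, fun N hN t ht htd z hz0 hE => ?_⟩
  have htK : t ∈ closedBall t₀ (η / 2) := by
    rw [mem_closedBall, Real.dist_eq]; exact (htd.trans_le (min_le_right _ _)).le
  have hN' : |R| / (m ^ 2 * δ' ^ 2) < N := hN₀.trans_le (by exact_mod_cast hN)
  have hNpos : (0:ℝ) < N := lt_of_le_of_lt (by positivity) hN'
  have hpt : ∀ z, 0 ≤ u z t := fun z => (hpos z t ht).le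
  have hstep : ∀ i < N, ‖z i‖ ≤ r → ‖z (i + 1) - z i‖ ≤ δ' ∧
      confDist v univ (z i) (z (i + 1)) ≤ 2 * (Real.sqrt (u (z i) t) * ‖z (i + 1) - z i‖) := by
    intro i hi hzi
    have hKi : (z i, t) ∈ K := ⟨by simpa using by linarith, htK⟩
    have h1 : ‖z (i + 1) - z i‖ ≤ δ' := by
      have h2 := (step_le_chainEnergy hpt z hi).trans (hE.trans (le_abs_self R))
      have h3 : m ≤ Real.sqrt (u (z i) t) := hmin hKi
      have h4 : m ^ 2 ≤ u (z i) t := by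
        rw [← Real.sq_sqrt (hpt (z i))]; exact pow_le_pow_left₀ hm.le h3 2
      rw [div_lt_iff₀ (by positivity)] at hN'
      by_contra! hlt
      have h5 : δ' ^ 2 < ‖z (i + 1) - z i‖ ^ 2 := pow_lt_pow_left₀ hlt hδ'.le two_ne_zero
      have h6 : m ^ 2 * δ' ^ 2 ≤ u (z i) t * ‖z (i + 1) - z i‖ ^ 2 :=
        mul_le_mul h4 h5.le (by positivity) (hpt _)
      have := mul_le_mul_of_nonneg_left h6 hNpos.le
      linarith
    refine ⟨h1, ?_⟩
    rw [← mul_assoc]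
    refine confDist_le_of_segment hv fun y hy => ?_
    have hyd : ‖y - z i‖ ≤ ‖z (i + 1) - z i‖ := by
      rw [segment_eq_image'] at hy
      obtain ⟨θ, hθ, rfl⟩ := hy
      simp only [add_sub_cancel_left, norm_smul, Real.norm_eq_abs, abs_of_nonneg hθ.1]
      exact mul_le_of_le_one_left (norm_nonneg _) hθ.2
    have hyK : (y, t₀) ∈ K := by
      refine ⟨?_, mem_closedBall_self (by linarith)⟩
      have := norm_le_norm_add_norm_sub' y (z i)
      have h7 : δ' ≤ 1 := min_le_right _ _
      rw [mem_closedBall, dist_zero_right]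
      linarith
    have hd : dist (y, t₀) (z i, t) < δ := by
      rw [Prod.dist_eq]
      refine max_lt ?_ ?_
      · rw [dist_eq_norm]
        have h7 : δ' ≤ δ / 2 := min_le_left _ _
        simp only
        linarith
      · rw [dist_comm, Real.dist_eq]
        have := htd.trans_le (min_le_left _ _)
        simp only
        linarith
    have h8 := hUδ _ hyK _ hKi hd
    rw [Real.dist_eq] at h8
    have h9 : m ≤ U (z i, t) := hmin hKi
    have h10 := (le_abs_self _).trans h8.le
    simp only [U] at h9 h10
    simp only [v]
    linarith
  have main : ∀ k, k ≤ N → (∀ i ≤ k, ‖z i‖ ≤ r) ∧ confDist v univ 0 (z k) ≤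
      2 * ∑ i ∈ Finset.range k, Real.sqrt (u (z i) t) * ‖z (i + 1) - z i‖ := by
    intro k
    induction k with
    | zero =>
      intro _
      refine ⟨fun i hi => ?_, ?_⟩
      · rw [Nat.le_zero.1 hi, hz0]; simpa using hr0
      · simp [hz0, confDist_self hv]
    | succ k ih =>
      intro hk
      obtain ⟨ih1, ih2⟩ := ih (by omega)
      obtain ⟨-, h2⟩ := hstep k (by omega) (ih1 k le_rfl)
      have h3 := confDist_triangle hv 0 (z k) (z (k + 1))
      have h4 : confDist v univ 0 (z (k + 1)) ≤
          2 * ∑ i ∈ Finset.range (k + 1), Real.sqrt (u (z i) t) * ‖z (i + 1) - z i‖ := by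
        rw [Finset.sum_range_succ]; linarith
      refine ⟨fun i hi => ?_, h4⟩
      rcases Nat.lt_or_ge i (k + 1) with h | h
      · exact ih1 i (by omega)
      · rw [show i = k + 1 by omega]
        have h5 := sum_length_le_sqrt_chainEnergy hpt z hk
        have h6 := Real.sqrt_le_sqrt hE
        exact hr _ (by linarith)
  exact (main N le_rfl).1

theorem chain_bounded (hu : ContinuousOn (fun p : ℂ × ℝ => u p.1 p.2) (univ ×ˢ Ioo 0 T))
    (hpos : ∀ z, ∀ t ∈ Ioo 0 T, 0 < u z t)
    (hcomplete : ∀ t ∈ Ioo (0:ℝ) T, ConfComplete (fun z => u z t) univ) (R : ℝ) {t₁ t₂ : ℝ}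
    (h₁ : 0 < t₁) (h₂ : t₂ < T) :
    ∃ r : ℝ, ∃ N₀ : ℕ, ∀ N ≥ N₀, ∀ t ∈ Icc t₁ t₂, ∀ z : ℕ → ℂ, z 0 = 0 →
      chainEnergy N (fun w => u w t) z ≤ R → ∀ i ≤ N, ‖z i‖ ≤ r := by
  refine isCompact_Icc.induction_on (s := Icc t₁ t₂) (p := fun S => ∃ r : ℝ, ∃ N₀ : ℕ, ∀ N ≥ N₀,
    ∀ t ∈ S, ∀ z : ℕ → ℂ, z 0 = 0 →
      chainEnergy N (fun w => u w t) z ≤ R → ∀ i ≤ N, ‖z i‖ ≤ r) ?_ ?_ ?_ ?_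
  · exact ⟨0, 0, fun _ _ _ h => absurd h (notMem_empty _)⟩
  · rintro s t hst ⟨r, N₀, h⟩
    exact ⟨r, N₀, fun N hN t ht => h N hN t (hst ht)⟩
  · rintro s t ⟨r, N₀, h⟩ ⟨r', N₀', h'⟩
    refine ⟨max r r', max N₀ N₀', fun N hN τ hτ z hz hE i hi => ?_⟩
    rcases hτ with hτ | hτ
    · exact (h N (le_of_max_le_left hN) τ hτ z hz hE i hi).trans (le_max_left _ _)
    · exact (h' N (le_of_max_le_right hN) τ hτ z hz hE i hi).trans (le_max_right _ _)
  · intro t₀ ht₀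
    have hI : t₀ ∈ Ioo 0 T := ⟨h₁.trans_le ht₀.1, ht₀.2.trans_lt h₂⟩
    obtain ⟨δ, hδ, r, N₀, h⟩ := chain_bounded_near hu hpos hcomplete R hI
    refine ⟨ball t₀ δ ∩ Icc t₁ t₂, Filter.inter_mem (mem_nhdsWithin_of_mem_nhds ?_)
        self_mem_nhdsWithin, r, N₀, fun N hN t ht => ?_⟩
    · exact ball_mem_nhds _ hδ
    · exact h N hN t ⟨h₁.trans_le ht.2.1, ht.2.2.trans_lt h₂⟩ (by simpa [Real.dist_eq] using ht.1)

end

/-- `φ` is twice differentiable at `0` with first and second derivatives `a` and `b` there. -/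
def HasJet (φ : ℝ → ℝ) (a b : ℝ) : Prop :=
  ∃ φ' : ℝ → ℝ, (∀ᶠ s in nhds 0, HasDerivAt φ (φ' s) s) ∧ φ' 0 = a ∧ HasDerivAt φ' b 0

namespace HasJet
variable {φ ψ : ℝ → ℝ} {a b c d : ℝ}

theorem const (k : ℝ) : HasJet (fun _ => k) 0 0 :=
  ⟨fun _ => 0, Eventually.of_forall fun s => hasDerivAt_const s k, rfl, hasDerivAt_const 0 0⟩

theorem add (h : HasJet φ a b) (k : HasJet ψ c d) :
    HasJet (fun s => φ s + ψ s) (a + c) (b + d) := by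
  obtain ⟨φ', h1, rfl, h3⟩ := h
  obtain ⟨ψ', k1, rfl, k3⟩ := k
  exact ⟨fun s => φ' s + ψ' s, by filter_upwards [h1, k1] with s hs ks using hs.add ks, rfl,
    h3.add k3⟩

theorem mul (h : HasJet φ a b) (k : HasJet ψ c d) :
    HasJet (fun s => φ s * ψ s) (a * ψ 0 + φ 0 * c) (b * ψ 0 + 2 * (a * c) + φ 0 * d) := by
  obtain ⟨φ', h1, rfl, h3⟩ := h
  obtain ⟨ψ', k1, rfl, k3⟩ := k
  refine ⟨fun s => φ' s * ψ s + φ s * ψ' s,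
    by filter_upwards [h1, k1] with s hs ks using hs.mul ks, rfl, ?_⟩
  exact ((h3.mul k1.self_of_nhds).add (h1.self_of_nhds.mul k3)).congr_deriv (by ring)

theorem const_mul (k : ℝ) (h : HasJet φ a b) : HasJet (fun s => k * φ s) (k * a) (k * b) := by
  simpa using (const k).mul h

theorem sub (h : HasJet φ a b) (k : HasJet ψ c d) :
    HasJet (fun s => φ s - ψ s) (a - c) (b - d) := by
  simpa [sub_eq_add_neg] using h.add (k.const_mul (-1))

theorem sum {ι : Type*} (S : Finset ι) {F : ι → ℝ → ℝ} {A B : ι → ℝ}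
    (h : ∀ i ∈ S, HasJet (F i) (A i) (B i)) :
    HasJet (fun s => ∑ i ∈ S, F i s) (∑ i ∈ S, A i) (∑ i ∈ S, B i) := by
  classical
  induction S using Finset.induction_on with
  | empty => simpa using const 0
  | insert i S hi ih =>
    simp only [Finset.sum_insert hi]
    exact (h i (Finset.mem_insert_self _ _)).add
      (ih fun j hj => h j (Finset.mem_insert_of_mem hj))

theorem comp {f f' : ℝ → ℝ} {f₂ : ℝ} (hf : ∀ᶠ x in nhds (φ 0), HasDerivAt f (f' x) x)
    (hf' : HasDerivAt f' f₂ (φ 0)) (h : HasJet φ a b) :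
    HasJet (fun s => f (φ s)) (f' (φ 0) * a) (f₂ * a ^ 2 + f' (φ 0) * b) := by
  obtain ⟨φ', h1, rfl, h3⟩ := h
  have h0 := h1.self_of_nhds
  refine ⟨fun s => f' (φ s) * φ' s, ?_, rfl, ?_⟩
  · filter_upwards [h1, h0.continuousAt.eventually hf] with s hs ks using ks.comp s hs
  · exact ((HasDerivAt.comp (0:ℝ) hf' h0).mul h3).congr_deriv (by simp only [Function.comp]; ring)

theorem unique (h : HasJet φ a b) (k : HasJet φ c d) : a = c ∧ b = d := by
  obtain ⟨φ', h1, rfl, h3⟩ := h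
  obtain ⟨ψ', k1, rfl, k3⟩ := k
  refine ⟨h1.self_of_nhds.unique k1.self_of_nhds, ?_⟩
  refine h3.unique (k3.congr_of_eventuallyEq ?_)
  filter_upwards [h1, k1] with s hs ks using hs.unique ks

theorem nonpos_of_isLocalMax (h : HasJet φ a b) (hm : IsLocalMax φ 0) : b ≤ 0 := by
  obtain ⟨φ', h1, rfl, h3⟩ := h
  by_contra! hb
  have e : deriv φ =ᶠ[nhds 0] φ' := by filter_upwards [h1] with s hs using hs.deriv
  have h4 : deriv (deriv φ) 0 = b := by rw [e.deriv_eq]; exact h3.deriv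
  have h0 : deriv φ 0 = 0 := hm.deriv_eq_zero
  have hmin := isLocalMin_of_deriv_deriv_pos (by rw [h4]; exact hb) h0
    h1.self_of_nhds.continuousAt
  have hc : φ =ᶠ[nhds 0] fun _ => φ 0 := by
    filter_upwards [hm, hmin] with s hs ks using le_antisymm hs ks
  have e2 : φ' =ᶠ[nhds 0] fun _ => 0 := by
    filter_upwards [hc.eventuallyEq_nhds, h1] with s hs ks
    rw [← ks.deriv, hs.deriv_eq, deriv_const]
  have := h3.unique ((hasDerivAt_const (0:ℝ) (0:ℝ)).congr_of_eventuallyEq e2)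
  linarith

/-- The jet of a `C²` function along a line. -/
theorem line {F : ℂ → ℝ} (hF : ContDiff ℝ 2 F) (z V : ℂ) :
    HasJet (fun s : ℝ => F (z + s * V)) (fderiv ℝ F z V) (iteratedFDeriv ℝ 2 F z ![V, V]) := by
  have hl : ∀ s : ℝ, HasDerivAt (fun s : ℝ => z + (s : ℂ) * V) V s := fun s => by
    simpa using ((Complex.ofRealCLM.hasDerivAt (x := s)).mul_const V).const_add z
  have hF1 : ContDiff ℝ 1 (fderiv ℝ F) := hF.fderiv_right (by norm_num)
  refine ⟨fun s => fderiv ℝ F (z + s * V) V, Eventually.of_forall fun s => ?_, by simp, ?_⟩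
  · exact ((hF.differentiable two_ne_zero _).hasFDerivAt).comp_hasDerivAt s (hl s)
  · have h1 := ((hF1.differentiable one_ne_zero (z + (0:ℝ) * V)).hasFDerivAt).comp_hasDerivAt
      (0:ℝ) (hl 0)
    have h2 := h1.clm_apply (hasDerivAt_const (0:ℝ) V)
    exact h2.congr_deriv (by rw [iteratedFDeriv_two_apply]; simp)

end HasJet

theorem iteratedFDeriv_two_add_rotate {F : ℂ → ℝ} (hF : ContDiff ℝ 2 F) (z V : ℂ) :
    iteratedFDeriv ℝ 2 F z ![V, V] + iteratedFDeriv ℝ 2 F z ![Complex.I * V, Complex.I * V] =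
      ‖V‖ ^ 2 * lap F z := by
  have hs : ∀ a b, fderiv ℝ (fderiv ℝ F) z a b = fderiv ℝ (fderiv ℝ F) z b a :=
    fun a b => (hF.contDiffAt.isSymmSndFDerivAt (by simp)) a b
  have hV : V = V.re • (1:ℂ) + V.im • Complex.I := by
    apply Complex.ext <;> simp
  have hIV : Complex.I * V = (-V.im) • (1:ℂ) + V.re • Complex.I := by
    apply Complex.ext <;> simp
  simp only [lap, iteratedFDeriv_two_apply, Matrix.cons_val_zero, Matrix.cons_val_one]
  rw [hIV, ← Complex.normSq_eq_norm_sq, Complex.normSq_apply]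
  generalize V.im = y at *
  generalize V.re = x at *
  rw [hV]
  simp only [map_add, map_smul, _root_.add_apply, _root_.smul_apply,
    smul_eq_mul]
  rw [hs Complex.I 1]
  ring

/-- The gradient of `F : ℂ → ℝ` as a complex number. -/
noncomputable def cgrad (F : ℂ → ℝ) (z : ℂ) : ℂ := ⟨fderiv ℝ F z 1, fderiv ℝ F z Complex.I⟩

theorem fderiv_eq_cgrad (F : ℂ → ℝ) (z V : ℂ) :
    fderiv ℝ F z V = (starRingEnd ℂ (cgrad F z) * V).re := by
  have h : fderiv ℝ F z (V.re • (1:ℂ) + V.im • Complex.I) = (starRingEnd ℂ (cgrad F z) * V).re := by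
    simp only [map_add, map_smul, smul_eq_mul, cgrad, Complex.mul_re, Complex.conj_re,
      Complex.conj_im]
    ring
  rwa [show V.re • (1:ℂ) + V.im • Complex.I = V by apply Complex.ext <;> simp] at h

theorem hasJet_norm_sq (w W : ℂ) : HasJet (fun s : ℝ => ‖w + s * W‖ ^ 2)
    (2 * (starRingEnd ℂ w * W).re) (2 * ‖W‖ ^ 2) := by
  have e : ∀ s : ℝ, ‖w + s * W‖ ^ 2 = ‖w‖ ^ 2 + s * (2 * (starRingEnd ℂ w * W).re)
      + s * (s * ‖W‖ ^ 2) := by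
    intro s
    simp only [← Complex.normSq_eq_norm_sq, Complex.normSq_apply, Complex.add_re, Complex.add_im,
      Complex.mul_re, Complex.mul_im, Complex.ofReal_re, Complex.ofReal_im, Complex.conj_re,
      Complex.conj_im]
    ring
  simp_rw [e]
  have hid : HasJet (fun s : ℝ => s) 1 0 :=
    ⟨fun _ => 1, Eventually.of_forall hasDerivAt_id, rfl, hasDerivAt_const _ _⟩
  have := ((HasJet.const (‖w‖ ^ 2)).add (hid.mul (HasJet.const (2 * (starRingEnd ℂ w * W).re)))).add
    (hid.mul (hid.mul (HasJet.const (‖W‖ ^ 2))))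
  convert this using 1 <;> simp

theorem hasJet_exp_line {p : ℂ → ℝ} (hp : ContDiff ℝ 2 p) (z V : ℂ) :
    HasJet (fun s : ℝ => Real.exp (p (z + s * V))) (Real.exp (p z) * fderiv ℝ p z V)
      (Real.exp (p z) * (fderiv ℝ p z V ^ 2 + iteratedFDeriv ℝ 2 p z ![V, V])) := by
  have := HasJet.comp (f := Real.exp) (f' := Real.exp) (f₂ := Real.exp (p (z + (0:ℝ) * V)))
    (Eventually.of_forall Real.hasDerivAt_exp) (Real.hasDerivAt_exp _) (HasJet.line hp z V)
  convert this using 1 <;> simp [mul_add]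

/-- The chain `z` moved by `s` in the direction `V`. -/
def moveChain (z V : ℕ → ℂ) (s : ℝ) : ℕ → ℂ := fun i => z i + s * V i

theorem hasJet_step {p : ℂ → ℝ} (hp : ContDiff ℝ 2 p) (z w V W : ℂ) :
    HasJet (fun s : ℝ => Real.exp (p (z + s * V)) * ‖w + s * W‖ ^ 2)
      (Real.exp (p z) * (starRingEnd ℂ w * (2 * W + starRingEnd ℂ (cgrad p z) * V * w)).re)
      (Real.exp (p z) * (‖w‖ ^ 2 * iteratedFDeriv ℝ 2 p z ![V, V]
        + ‖w‖ ^ 2 * (starRingEnd ℂ (cgrad p z) * V).re ^ 2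
        + 4 * ((starRingEnd ℂ (cgrad p z) * V).re * (starRingEnd ℂ w * W).re) + 2 * ‖W‖ ^ 2)) := by
  have := (hasJet_exp_line hp z V).mul (hasJet_norm_sq w W)
  convert this using 1
  · rw [fderiv_eq_cgrad]
    simp only [Complex.ofReal_zero, zero_mul, add_zero]
    simp only [← Complex.normSq_eq_norm_sq, Complex.normSq_apply, Complex.add_re, Complex.add_im,
      Complex.mul_re, Complex.mul_im, Complex.conj_re,
      Complex.conj_im, Complex.re_ofNat, Complex.im_ofNat, zero_mul, add_zero]
    ring
  · rw [fderiv_eq_cgrad]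
    simp only [Complex.ofReal_zero, zero_mul, add_zero]
    ring

theorem step_second_add_rotate {p : ℂ → ℝ} (hp : ContDiff ℝ 2 p) (z w V W : ℂ) :
    (‖w‖ ^ 2 * iteratedFDeriv ℝ 2 p z ![V, V]
        + ‖w‖ ^ 2 * (starRingEnd ℂ (cgrad p z) * V).re ^ 2
        + 4 * ((starRingEnd ℂ (cgrad p z) * V).re * (starRingEnd ℂ w * W).re) + 2 * ‖W‖ ^ 2)
    + (‖w‖ ^ 2 * iteratedFDeriv ℝ 2 p z ![Complex.I * V, Complex.I * V]
        + ‖w‖ ^ 2 * (starRingEnd ℂ (cgrad p z) * (Complex.I * V)).re ^ 2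
        + 4 * ((starRingEnd ℂ (cgrad p z) * (Complex.I * V)).re *
          (starRingEnd ℂ w * (Complex.I * W)).re) + 2 * ‖Complex.I * W‖ ^ 2)
    = ‖V‖ ^ 2 * ‖w‖ ^ 2 * lap p z + ‖2 * W + starRingEnd ℂ (cgrad p z) * V * w‖ ^ 2 := by
  have h := congrArg (fun x => ‖w‖ ^ 2 * x) (iteratedFDeriv_two_add_rotate hp z V)
  beta_reduce at h
  rw [mul_add] at h
  have h2 : ‖w‖ ^ 2 * (starRingEnd ℂ (cgrad p z) * V).re ^ 2
        + 4 * ((starRingEnd ℂ (cgrad p z) * V).re * (starRingEnd ℂ w * W).re) + 2 * ‖W‖ ^ 2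
        + (‖w‖ ^ 2 * (starRingEnd ℂ (cgrad p z) * (Complex.I * V)).re ^ 2
        + 4 * ((starRingEnd ℂ (cgrad p z) * (Complex.I * V)).re *
          (starRingEnd ℂ w * (Complex.I * W)).re) + 2 * ‖Complex.I * W‖ ^ 2)
      = ‖2 * W + starRingEnd ℂ (cgrad p z) * V * w‖ ^ 2 := by
    simp only [← Complex.normSq_eq_norm_sq, Complex.normSq_apply, Complex.add_re, Complex.add_im,
      Complex.mul_re, Complex.mul_im, Complex.conj_re,
      Complex.conj_im, Complex.re_ofNat, Complex.im_ofNat, zero_mul, add_zero, Complex.I_re,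
      Complex.I_im]
    ring
  linarith

theorem energy_variation {p : ℂ → ℝ} (hp : ContDiff ℝ 2 p) (N : ℕ) (z P : ℕ → ℂ) (f : ℕ → ℝ)
    (hP : ∀ i, P (i + 1) = P i * (1 - starRingEnd ℂ (cgrad p (z i)) * (z (i + 1) - z i) / 2)) :
    ∃ a₁ a₂ b₁ b₂ : ℝ,
      HasJet (fun s => chainEnergy N (fun x => Real.exp (p x)) (moveChain z (fun i => f i * P i) s))
        a₁ b₁ ∧
      HasJet (fun s => chainEnergy N (fun x => Real.exp (p x))
        (moveChain z (fun i => Complex.I * (f i * P i)) s)) a₂ b₂ ∧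
      b₁ + b₂ = N * ∑ i ∈ Finset.range N, Real.exp (p (z i)) *
        (f i ^ 2 * ‖P i‖ ^ 2 * ‖z (i + 1) - z i‖ ^ 2 * lap p (z i)
          + 4 * ((f (i + 1) - f i) ^ 2 * ‖P (i + 1)‖ ^ 2)) ∧
      a₁ ^ 2 + a₂ ^ 2 ≤ 4 * chainEnergy N (fun x => Real.exp (p x)) z *
        (N * ∑ i ∈ Finset.range N, Real.exp (p (z i)) *
          ((f (i + 1) - f i) ^ 2 * ‖P (i + 1)‖ ^ 2)) := by
  set w : ℕ → ℂ := fun i => z (i + 1) - z i with hw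
  set V : ℕ → ℂ := fun i => f i * P i with hV
  set W : ℕ → ℂ := fun i => V (i + 1) - V i with hW
  set Q : ℕ → ℂ := fun i => 2 * W i + starRingEnd ℂ (cgrad p (z i)) * V i * w i with hQ
  have hQe : ∀ i, Q i = 2 * ((f (i + 1) - f i : ℝ) : ℂ) * P (i + 1) := by
    intro i
    simp only [hQ, hW, hV, hw]
    rw [hP i]
    push_cast
    ring
  have hQn : ∀ i, ‖Q i‖ ^ 2 = 4 * ((f (i + 1) - f i) ^ 2 * ‖P (i + 1)‖ ^ 2) := by
    intro i
    rw [hQe, norm_mul, norm_mul, Complex.norm_real, mul_pow, mul_pow, Real.norm_eq_abs, sq_abs]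
    norm_num
    ring
  have J : ∀ c : ℂ, HasJet (fun s => chainEnergy N (fun x => Real.exp (p x))
      (moveChain z (fun i => c * V i) s)) _ _ := fun c =>
    (HasJet.sum (Finset.range N) fun i _ => hasJet_step hp (z i) (w i) (c * V i)
      (c * W i)).const_mul
      (N : ℝ) |> fun h => by
        convert h using 1
        funext s
        simp only [chainEnergy, moveChain, hw, hW]
        congr 1
        refine Finset.sum_congr rfl fun i _ => ?_
        congr 3
        ring
  have J1 := J 1
  have J2 := J Complex.I
  simp only [one_mul] at J1
  refine ⟨_, _, _, _, J1, J2, ?_, ?_⟩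
  · rw [← mul_add, ← Finset.sum_add_distrib]
    congr 1
    refine Finset.sum_congr rfl fun i _ => ?_
    rw [← mul_add, step_second_add_rotate hp, ← hQn]
    congr 2
    simp only [hV, norm_mul, Complex.norm_real, mul_pow, Real.norm_eq_abs, sq_abs, hw]
  · set S : ℂ := ∑ i ∈ Finset.range N,
      (Real.exp (p (z i)) : ℂ) * (starRingEnd ℂ (w i) * Q i) with hS
    have e1 : ∑ i ∈ Finset.range N, Real.exp (p (z i)) * (starRingEnd ℂ (w i) *
        (2 * W i + starRingEnd ℂ (cgrad p (z i)) * V i * w i)).re = S.re := by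
      rw [hS, Complex.re_sum]
      exact Finset.sum_congr rfl fun i _ => by rw [Complex.re_ofReal_mul]
    have e2 : ∑ i ∈ Finset.range N, Real.exp (p (z i)) * (starRingEnd ℂ (w i) *
        (2 * (Complex.I * W i) + starRingEnd ℂ (cgrad p (z i)) * (Complex.I * V i) * w i)).re
          = -S.im := by
      rw [hS, Complex.im_sum, ← Finset.sum_neg_distrib]
      refine Finset.sum_congr rfl fun i _ => ?_
      rw [Complex.im_ofReal_mul, show starRingEnd ℂ (w i) *
        (2 * (Complex.I * W i) + starRingEnd ℂ (cgrad p (z i)) * (Complex.I * V i) * w i)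
        = Complex.I * (starRingEnd ℂ (w i) * Q i) by simp only [hQ]; ring, Complex.I_mul_re]
      ring
    rw [e1, e2]
    have hSn : (S.re) ^ 2 + (S.im) ^ 2 = ‖S‖ ^ 2 := by
      rw [← Complex.normSq_eq_norm_sq, Complex.normSq_apply]; ring
    have hS2 : ‖S‖ ≤ ∑ i ∈ Finset.range N, (Real.sqrt (Real.exp (p (z i))) * ‖w i‖) *
        (Real.sqrt (Real.exp (p (z i))) * ‖Q i‖) := by
      refine (norm_sum_le _ _).trans_eq (Finset.sum_congr rfl fun i _ => ?_)
      rw [norm_mul, norm_mul, RCLike.norm_conj, Complex.norm_real, Real.norm_eq_abs,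
        abs_of_pos (Real.exp_pos _)]
      linear_combination (-‖w i‖ * ‖Q i‖) * Real.mul_self_sqrt (Real.exp_pos (p (z i))).le
    have hcs := Finset.sum_mul_sq_le_sq_mul_sq (Finset.range N)
      (fun i => Real.sqrt (Real.exp (p (z i))) * ‖w i‖)
      (fun i => Real.sqrt (Real.exp (p (z i))) * ‖Q i‖)
    simp only [mul_pow, Real.sq_sqrt (Real.exp_pos _).le, hQn] at hcs
    have h3 := (pow_le_pow_left₀ (norm_nonneg S) hS2 2).trans hcs
    calc (↑N * S.re) ^ 2 + (↑N * -S.im) ^ 2 = (N:ℝ) ^ 2 * ‖S‖ ^ 2 := by rw [← hSn]; ring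
      _ ≤ (N:ℝ) ^ 2 * _ := mul_le_mul_of_nonneg_left h3 (by positivity)
      _ = _ := by
        have : ∑ i ∈ Finset.range N, Real.exp (p (z i)) *
            (4 * ((f (i + 1) - f i) ^ 2 * ‖P (i + 1)‖ ^ 2)) = 4 * ∑ i ∈ Finset.range N,
            Real.exp (p (z i)) * ((f (i + 1) - f i) ^ 2 * ‖P (i + 1)‖ ^ 2) := by
          rw [Finset.mul_sum]; exact Finset.sum_congr rfl fun i _ => by ring
        rw [this]
        simp only [chainEnergy, hw]
        ring

/-- The directional derivative of a function on spacetime. -/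
noncomputable def dirDeriv (ξ : ℂ × ℝ) (F : ℂ × ℝ → ℝ) (x : ℂ × ℝ) : ℝ := fderiv ℝ F x ξ

section
variable {T : ℝ} {F : ℂ × ℝ → ℝ}

theorem isOpen_spacetime (T : ℝ) : IsOpen ((univ : Set ℂ) ×ˢ Ioo 0 T) := isOpen_univ.prod isOpen_Ioo

theorem contDiffAt_spacetime (hF : ContDiffOn ℝ (⊤ : ℕ∞) F (univ ×ˢ Ioo 0 T)) {z : ℂ} {t : ℝ}
    (ht : t ∈ Ioo 0 T) : ContDiffAt ℝ (⊤ : ℕ∞) F (z, t) :=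
  hF.contDiffAt ((isOpen_spacetime T).mem_nhds ⟨mem_univ _, ht⟩)

theorem contDiffOn_dirDeriv (hF : ContDiffOn ℝ (⊤ : ℕ∞) F (univ ×ˢ Ioo 0 T)) (ξ : ℂ × ℝ) :
    ContDiffOn ℝ (⊤ : ℕ∞) (dirDeriv ξ F) (univ ×ˢ Ioo 0 T) :=
  (hF.fderiv_of_isOpen (isOpen_spacetime T) (by simp)).clm_apply contDiffOn_const

theorem dirDeriv_comm (hF : ContDiffOn ℝ (⊤ : ℕ∞) F (univ ×ˢ Ioo 0 T)) (ξ η : ℂ × ℝ) :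
    EqOn (dirDeriv ξ (dirDeriv η F)) (dirDeriv η (dirDeriv ξ F)) (univ ×ˢ Ioo 0 T) := by
  rintro ⟨z, t⟩ ⟨-, ht⟩
  have h := contDiffAt_spacetime hF (z := z) ht
  have h1 : DifferentiableAt ℝ (fderiv ℝ F) (z, t) :=
    (h.fderiv_right (m := 1) (by norm_cast)).differentiableAt one_ne_zero
  have hs := h.isSymmSndFDerivAt (by simpa using WithTop.coe_le_coe.2 (le_top : (2 : ℕ∞) ≤ ⊤)) ξ η
  unfold dirDeriv
  rw [fderiv_clm_apply h1 (differentiableAt_const _),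
      fderiv_clm_apply h1 (differentiableAt_const _)]
  simpa using hs

theorem dirDeriv_congr {G : ℂ × ℝ → ℝ} (h : EqOn F G (univ ×ˢ Ioo 0 T)) (ξ : ℂ × ℝ) :
    EqOn (dirDeriv ξ F) (dirDeriv ξ G) (univ ×ˢ Ioo 0 T) := by
  intro x hx
  unfold dirDeriv
  rw [(h.eventuallyEq_of_mem ((isOpen_spacetime T).mem_nhds hx)).fderiv_eq]

theorem contDiff_spacetime_slice (hF : ContDiffOn ℝ (⊤ : ℕ∞) F (univ ×ˢ Ioo 0 T)) {t : ℝ}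
    (ht : t ∈ Ioo 0 T) : ContDiff ℝ (⊤ : ℕ∞) fun z => F (z, t) :=
  contDiffOn_univ.1 (hF.comp (f := fun z : ℂ => (z, t)) (by fun_prop) fun z _ => ⟨mem_univ _, ht⟩)

theorem fderiv_slice (hF : ContDiffOn ℝ (⊤ : ℕ∞) F (univ ×ˢ Ioo 0 T)) {t : ℝ}
    (ht : t ∈ Ioo 0 T) (z V : ℂ) :
    fderiv ℝ (fun z => F (z, t)) z V = dirDeriv (V, 0) F (z, t) := by
  have h := ((contDiffAt_spacetime hF (z := z) ht).differentiableAt (by simp)).hasFDerivAt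
  have h2 : HasFDerivAt (fun z : ℂ => (z, t)) (ContinuousLinearMap.inl ℝ ℂ ℝ) z :=
    hasFDerivAt_prodMk_left z t
  have h3 : HasFDerivAt (fun z => F (z, t)) _ z := HasFDerivAt.comp z h h2
  rw [h3.fderiv]
  simp [dirDeriv]

theorem hasDerivAt_slice (hF : ContDiffOn ℝ (⊤ : ℕ∞) F (univ ×ˢ Ioo 0 T)) {t : ℝ}
    (ht : t ∈ Ioo 0 T) (z : ℂ) :
    HasDerivAt (fun s => F (z, s)) (dirDeriv (0, 1) F (z, t)) t := by
  have h := ((contDiffAt_spacetime hF (z := z) ht).differentiableAt (by simp)).hasFDerivAt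
  exact h.comp_hasDerivAt t ((hasDerivAt_const t z).prodMk (hasDerivAt_id t))

theorem iteratedFDeriv_slice (hF : ContDiffOn ℝ (⊤ : ℕ∞) F (univ ×ˢ Ioo 0 T)) {t : ℝ}
    (ht : t ∈ Ioo 0 T) (z V : ℂ) :
    iteratedFDeriv ℝ 2 (fun z => F (z, t)) z ![V, V] =
      dirDeriv (V, 0) (dirDeriv (V, 0) F) (z, t) := by
  rw [iteratedFDeriv_two_apply, ← fderiv_slice (contDiffOn_dirDeriv hF _) ht]
  have h1 : Differentiable ℝ (fderiv ℝ fun z => F (z, t)) :=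
    ((contDiff_spacetime_slice hF ht).fderiv_right (m := 1) (by norm_cast)).differentiable
      one_ne_zero
  have h2 : (fun z => dirDeriv (V, 0) F (z, t)) = fun z => fderiv ℝ (fun z => F (z, t)) z V := by
    funext w; rw [fderiv_slice hF ht]
  rw [h2, fderiv_clm_apply (h1 z) (differentiableAt_const _)]
  simp

theorem lap_slice (hF : ContDiffOn ℝ (⊤ : ℕ∞) F (univ ×ˢ Ioo 0 T)) {t : ℝ}
    (ht : t ∈ Ioo 0 T) (z : ℂ) : lap (fun z => F (z, t)) z =
      dirDeriv (1, 0) (dirDeriv (1, 0) F) (z, t) +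
      dirDeriv (Complex.I, 0) (dirDeriv (Complex.I, 0) F) (z, t) := by
  rw [lap, iteratedFDeriv_slice hF ht, iteratedFDeriv_slice hF ht]

theorem hasDerivAt_lap_slice (hF : ContDiffOn ℝ (⊤ : ℕ∞) F (univ ×ˢ Ioo 0 T)) {t : ℝ}
    (ht : t ∈ Ioo 0 T) (z : ℂ) :
    HasDerivAt (fun s => lap (fun z => F (z, s)) z)
      (lap (fun z => dirDeriv (0, 1) F (z, t)) z) t := by
  have key : ∀ V : ℂ, HasDerivAt (fun s => dirDeriv (V, 0) (dirDeriv (V, 0) F) (z, s))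
      (dirDeriv (V, 0) (dirDeriv (V, 0) (dirDeriv (0, 1) F)) (z, t)) t := by
    intro V
    have h := hasDerivAt_slice (contDiffOn_dirDeriv (contDiffOn_dirDeriv hF (V, 0)) (V, 0)) ht z
    rw [dirDeriv_comm (contDiffOn_dirDeriv hF (V, 0)) (0, 1) (V, 0) ⟨mem_univ z, ht⟩,
      dirDeriv_congr (dirDeriv_comm hF (0, 1) (V, 0)) (V, 0) ⟨mem_univ z, ht⟩] at h
    exact h
  rw [lap_slice (contDiffOn_dirDeriv hF _) ht]
  refine ((key 1).add (key Complex.I)).congr_of_eventuallyEq ?_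
  filter_upwards [isOpen_Ioo.mem_nhds ht] with s hs
  exact lap_slice hF hs z

end

section
variable {T : ℝ} {u : ℂ → ℝ → ℝ}

/-- The logarithm of the conformal factor, as a function on spacetime. -/
noncomputable def logFactor (u : ℂ → ℝ → ℝ) (x : ℂ × ℝ) : ℝ := Real.log (u x.1 x.2)

/-- The logarithmic time derivative of the conformal factor. -/
noncomputable def logSpeed (u : ℂ → ℝ → ℝ) : ℂ × ℝ → ℝ := dirDeriv (0, 1) (logFactor u)

theorem contDiffOn_logFactor (hpos : ∀ z, ∀ t ∈ Ioo 0 T, 0 < u z t)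
    (hsmooth : ContDiffOn ℝ (⊤ : ℕ∞) (fun p : ℂ × ℝ => u p.1 p.2) (univ ×ˢ Ioo 0 T)) :
    ContDiffOn ℝ (⊤ : ℕ∞) (logFactor u) (univ ×ˢ Ioo 0 T) :=
  hsmooth.log fun x hx => (hpos x.1 x.2 hx.2).ne'

theorem contDiffOn_logSpeed (hpos : ∀ z, ∀ t ∈ Ioo 0 T, 0 < u z t)
    (hsmooth : ContDiffOn ℝ (⊤ : ℕ∞) (fun p : ℂ × ℝ => u p.1 p.2) (univ ×ˢ Ioo 0 T)) :
    ContDiffOn ℝ (⊤ : ℕ∞) (logSpeed u) (univ ×ˢ Ioo 0 T) :=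
  contDiffOn_dirDeriv (contDiffOn_logFactor hpos hsmooth) _

theorem hasDerivAt_factor (hpos : ∀ z, ∀ t ∈ Ioo 0 T, 0 < u z t)
    (hsmooth : ContDiffOn ℝ (⊤ : ℕ∞) (fun p : ℂ × ℝ => u p.1 p.2) (univ ×ˢ Ioo 0 T))
    {t : ℝ} (ht : t ∈ Ioo 0 T) (z : ℂ) :
    HasDerivAt (u z) (u z t * logSpeed u (z, t)) t := by
  have h := (hasDerivAt_slice (contDiffOn_logFactor hpos hsmooth) ht z).exp
  simp only [logFactor, Real.exp_log (hpos z t ht)] at h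
  refine h.congr_of_eventuallyEq ?_
  filter_upwards [isOpen_Ioo.mem_nhds ht] with s hs
  exact (Real.exp_log (hpos z s hs)).symm

theorem lap_logFactor (hpos : ∀ z, ∀ t ∈ Ioo 0 T, 0 < u z t)
    (hsmooth : ContDiffOn ℝ (⊤ : ℕ∞) (fun p : ℂ × ℝ => u p.1 p.2) (univ ×ˢ Ioo 0 T))
    (hlfde : ∀ z, ∀ t ∈ Ioo 0 T, deriv (u z) t = lap (fun w => Real.log (u w t)) z)
    {t : ℝ} (ht : t ∈ Ioo 0 T) (z : ℂ) :
    lap (fun w => logFactor u (w, t)) z = u z t * logSpeed u (z, t) := by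
  rw [← (hasDerivAt_factor hpos hsmooth ht z).deriv, hlfde z t ht]
  rfl

theorem hasDerivAt_logSpeed (hpos : ∀ z, ∀ t ∈ Ioo 0 T, 0 < u z t)
    (hsmooth : ContDiffOn ℝ (⊤ : ℕ∞) (fun p : ℂ × ℝ => u p.1 p.2) (univ ×ˢ Ioo 0 T))
    (hlfde : ∀ z, ∀ t ∈ Ioo 0 T, deriv (u z) t = lap (fun w => Real.log (u w t)) z)
    {t : ℝ} (ht : t ∈ Ioo 0 T) (z : ℂ) :
    ∃ q' : ℝ, HasDerivAt (fun s => logSpeed u (z, s)) q' t ∧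
      u z t * q' = lap (fun w => logSpeed u (w, t)) z - u z t * logSpeed u (z, t) ^ 2 := by
  have h1 := hasDerivAt_slice (contDiffOn_logSpeed hpos hsmooth) ht z
  refine ⟨_, h1, ?_⟩
  have h2 := (hasDerivAt_factor hpos hsmooth ht z).mul h1
  have h3 := hasDerivAt_lap_slice (contDiffOn_logFactor hpos hsmooth) ht z
  have h4 := h3.unique (h2.congr_of_eventuallyEq (by
    filter_upwards [isOpen_Ioo.mem_nhds ht] with s hs
    exact lap_logFactor hpos hsmooth hlfde hs z))
  rw [show logSpeed u = dirDeriv (0, 1) (logFactor u) from rfl] at *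
  rw [h4]
  ring

end

theorem exists_taylor_bound {T : ℝ} {F : ℂ × ℝ → ℝ}
    (hF : ContDiffOn ℝ (⊤ : ℕ∞) F (univ ×ˢ Ioo 0 T)) {t₁ t₂ : ℝ} (h₁ : 0 < t₁) (h₂ : t₂ < T)
    (r : ℝ) : ∃ A : ℝ, 1 ≤ A ∧ ∀ t ∈ Icc t₁ t₂, ∀ z ∈ closedBall (0:ℂ) r,
      ‖cgrad (fun x => F (x, t)) z‖ ≤ A ∧ ∀ z' ∈ closedBall (0:ℂ) r,
      |F (z', t) - F (z, t) - (starRingEnd ℂ (cgrad (fun x => F (x, t)) z) * (z' - z)).re| ≤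
        A * ‖z' - z‖ ^ 2 := by
  have hI : Icc t₁ t₂ ⊆ Ioo 0 T := fun t ht => ⟨h₁.trans_le ht.1, ht.2.trans_lt h₂⟩
  set K : Set (ℂ × ℝ) := closedBall 0 r ×ˢ Icc t₁ t₂
  have hK : IsCompact K := (isCompact_closedBall _ _).prod isCompact_Icc
  have hKc : Convex ℝ K := (convex_closedBall _ _).prod (convex_Icc _ _)
  have hKs : K ⊆ univ ×ˢ Ioo 0 T := prod_mono (subset_univ _) hI
  have hF1 : ContDiffOn ℝ (⊤ : ℕ∞) (fderiv ℝ F) (univ ×ˢ Ioo 0 T) :=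
    hF.fderiv_of_isOpen (isOpen_spacetime T) (by simp)
  have hF2 : ContDiffOn ℝ (⊤ : ℕ∞) (fderiv ℝ (fderiv ℝ F)) (univ ×ˢ Ioo 0 T) :=
    hF1.fderiv_of_isOpen (isOpen_spacetime T) (by simp)
  obtain ⟨A₁, hA₁⟩ := hK.exists_bound_of_continuousOn (hF1.continuousOn.mono hKs)
  obtain ⟨A₂, hA₂⟩ := hK.exists_bound_of_continuousOn
    (E := ℂ × ℝ →L[ℝ] ℂ × ℝ →L[ℝ] ℝ) (hF2.continuousOn.mono hKs)
  have hA₁' : ∀ x ∈ K, ‖fderiv ℝ F x‖ ≤ |A₁| := fun x hx =>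
    (hA₁ x hx).trans (le_abs_self _)
  have hA₂' : ∀ x ∈ K, ‖fderiv ℝ (fderiv ℝ F) x‖ ≤ |A₂| := fun x hx =>
    (hA₂ x hx).trans (le_abs_self _)
  refine ⟨1 + 2 * |A₁| + |A₂|, by linarith [abs_nonneg A₁, abs_nonneg A₂],
      fun t ht z hz => ⟨?_, ?_⟩⟩
  · have hb : ∀ V : ℂ, ‖V‖ = 1 → |fderiv ℝ (fun x => F (x, t)) z V| ≤ |A₁| := by
      intro V hV
      rw [fderiv_slice hF (hI ht)]
      have := (fderiv ℝ F (z, t)).le_opNorm (V, 0)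
      have hn : ‖((V, 0) : ℂ × ℝ)‖ = 1 := by simp [Prod.norm_def, hV]
      rw [hn, mul_one] at this
      exact this.trans (hA₁' _ ⟨hz, ht⟩)
    have h := Complex.norm_le_abs_re_add_abs_im (cgrad (fun x => F (x, t)) z)
    have h1 := hb 1 (by simp)
    have h2 := hb Complex.I (by simp)
    simp only [cgrad] at h ⊢
    linarith [abs_nonneg A₂]
  · intro z' hz'
    rw [← fderiv_eq_cgrad, fderiv_slice hF (hI ht)]
    have hdiff : ∀ x ∈ K, DifferentiableAt ℝ F x := fun x hx =>
      (contDiffAt_spacetime hF (hKs hx).2).differentiableAt (by simp)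
    have hdiff1 : ∀ x ∈ K, DifferentiableAt ℝ (fderiv ℝ F) x := fun x hx =>
      (hF1.contDiffAt ((isOpen_spacetime T).mem_nhds (hKs hx))).differentiableAt (by simp)
    have hxK : ((z, t) : ℂ × ℝ) ∈ K := ⟨hz, ht⟩
    have hyK : ((z', t) : ℂ × ℝ) ∈ K := ⟨hz', ht⟩
    have hseg := hKc.segment_subset hxK hyK
    have hn : ‖((z', t) : ℂ × ℝ) - (z, t)‖ = ‖z' - z‖ := by simp [Prod.norm_def]
    have hC : ∀ x ∈ segment ℝ ((z, t) : ℂ × ℝ) (z', t),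
        ‖fderiv ℝ F x - fderiv ℝ F (z, t)‖ ≤ |A₂| * ‖z' - z‖ := by
      intro x hx
      have h1 := hKc.norm_image_sub_le_of_norm_fderiv_le hdiff1 hA₂' hxK (hseg hx)
      refine h1.trans (mul_le_mul_of_nonneg_left ?_ (abs_nonneg _))
      rw [← hn]
      rw [segment_eq_image'] at hx
      obtain ⟨θ, hθ, rfl⟩ := hx
      rw [add_sub_cancel_left, norm_smul, Real.norm_eq_abs, abs_of_nonneg hθ.1]
      exact mul_le_of_le_one_left (norm_nonneg _) hθ.2
    have h2 := (convex_segment ((z, t) : ℂ × ℝ) (z', t)).norm_image_sub_le_of_norm_fderiv_le'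
      (fun x hx => hdiff x (hseg hx)) hC (left_mem_segment ℝ _ _) (right_mem_segment ℝ _ _)
    rw [hn, Real.norm_eq_abs] at h2
    have h3 : fderiv ℝ F (z, t) ((z', t) - (z, t)) = dirDeriv (z' - z, 0) F (z, t) := by
      simp [dirDeriv]
    rw [h3] at h2
    refine h2.trans ?_
    nlinarith [sq_nonneg ‖z' - z‖, abs_nonneg A₁, abs_nonneg A₂,
        mul_nonneg (abs_nonneg A₁) (sq_nonneg ‖z' - z‖)]

theorem abs_step_ratio_sub_one_le {g w : ℂ} {d A : ℝ} (hA : 1 ≤ A) (hg : ‖g‖ ≤ A)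
    (hd : |d - (starRingEnd ℂ g * w).re| ≤ A * ‖w‖ ^ 2) (hw : A * ‖w‖ ≤ 1 / 4) :
    |‖1 - starRingEnd ℂ g * w / 2‖ ^ 2 * Real.exp d - 1| ≤ 10 * (A * ‖w‖) ^ 2 ∧ |d| ≤ 1 / 2 := by
  set ω := A * ‖w‖ with hω
  have hω0 : 0 ≤ ω := by positivity
  set x := (starRingEnd ℂ g * w).re with hx
  have hxn : |x| ≤ ω := by
    refine (Complex.abs_re_le_norm _).trans ?_
    rw [norm_mul, RCLike.norm_conj]
    exact mul_le_mul_of_nonneg_right hg (norm_nonneg _)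
  set y := ‖starRingEnd ℂ g * w‖ ^ 2 / 4 with hy
  have hy0 : 0 ≤ y := by positivity
  have hy1 : y ≤ ω ^ 2 := by
    have : ‖starRingEnd ℂ g * w‖ ≤ ω := by
      rw [norm_mul, RCLike.norm_conj]
      exact mul_le_mul_of_nonneg_right hg (norm_nonneg _)
    have := pow_le_pow_left₀ (norm_nonneg _) this 2
    rw [hy]; nlinarith
  have e : ‖1 - starRingEnd ℂ g * w / 2‖ ^ 2 = 1 - x + y := by
    rw [hx, hy, ← Complex.normSq_eq_norm_sq, ← Complex.normSq_eq_norm_sq]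
    generalize starRingEnd ℂ g * w = a
    rw [Complex.normSq_apply, Complex.normSq_apply]
    simp
    ring
  rw [e]
  have hd1 : |d - x| ≤ ω ^ 2 := by
    refine hd.trans ?_
    rw [hω, mul_pow]
    refine mul_le_mul_of_nonneg_right ?_ (sq_nonneg _)
    nlinarith
  have hd2 : |d| ≤ 5 / 4 * ω := by
    have := abs_add_le (d - x) x
    rw [sub_add_cancel] at this
    nlinarith
  have he := Real.abs_exp_sub_one_sub_id_le (x := d) (by linarith)
  have hdd : d ^ 2 ≤ 25 / 16 * ω ^ 2 := by
    rw [← sq_abs]; nlinarith [abs_nonneg d]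
  set E := Real.exp d - 1 - d with hE
  have e2 : Real.exp d = 1 + d + E := by rw [hE]; ring
  refine ⟨?_, by linarith⟩
  rw [e2]
  have e3 : (1 - x + y) * (1 + d + E) - 1 = (d - x) + (y + E + (y - x) * (d + E)) := by ring
  rw [e3]
  have k1 : |E| ≤ 25 / 16 * ω ^ 2 := he.trans hdd
  have k2 : |y - x| ≤ 5 / 4 * ω := by
    have := abs_sub y x
    rw [abs_of_nonneg hy0] at this
    nlinarith
  have k3 : |d + E| ≤ 2 * ω := by
    have := abs_add_le d E
    nlinarith
  have k4 : |(y - x) * (d + E)| ≤ 5 / 4 * ω * (2 * ω) := by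
    rw [abs_mul]; exact mul_le_mul k2 k3 (abs_nonneg _) (by positivity)
  have k5 := abs_add_le (d - x) (y + E + (y - x) * (d + E))
  have k6 := abs_add_le (y + E) ((y - x) * (d + E))
  have k7 := abs_add_le y E
  rw [abs_of_nonneg hy0] at k7
  nlinarith [sq_nonneg ω]

/-- Transport factors along the chain `z`. -/
noncomputable def chainTransport (p : ℂ → ℝ) (z : ℕ → ℂ) (k : ℕ) : ℂ :=
  ∏ i ∈ Finset.range k, (1 - starRingEnd ℂ (cgrad p (z i)) * (z (i + 1) - z i) / 2)

theorem chainTransport_succ (p : ℂ → ℝ) (z : ℕ → ℂ) (i : ℕ) : chainTransport p z (i + 1) =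
    chainTransport p z i * (1 - starRingEnd ℂ (cgrad p (z i)) * (z (i + 1) - z i) / 2) :=
  Finset.prod_range_succ _ _

theorem chainTransport_weights {p : ℂ → ℝ} {z : ℕ → ℂ} {N : ℕ} {A ε : ℝ} (hA : 1 ≤ A)
    (hg : ∀ i < N, ‖cgrad p (z i)‖ ≤ A)
    (hd : ∀ i < N, |p (z (i + 1)) - p (z i) -
      (starRingEnd ℂ (cgrad p (z i)) * (z (i + 1) - z i)).re| ≤ A * ‖z (i + 1) - z i‖ ^ 2)
    (hε : 40 * A ^ 2 * ε ≤ 1) (hz : ∑ i ∈ Finset.range N, ‖z (i + 1) - z i‖ ^ 2 ≤ ε) :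
    0 < Real.exp (p (z N)) * ‖chainTransport p z N‖ ^ 2 ∧
    (∀ i ≤ N, |Real.exp (p (z i)) * ‖chainTransport p z i‖ ^ 2 -
        Real.exp (p (z N)) * ‖chainTransport p z N‖ ^ 2| ≤
      40 * A ^ 2 * ε * (Real.exp (p (z N)) * ‖chainTransport p z N‖ ^ 2)) ∧
    ∀ i < N, Real.exp (p (z i)) * ‖chainTransport p z (i + 1)‖ ^ 2 ≤
      2 * (Real.exp (p (z (i + 1))) * ‖chainTransport p z (i + 1)‖ ^ 2) := by
  set n : ℕ → ℝ := fun i => Real.exp (p (z i)) * ‖chainTransport p z i‖ ^ 2 with hn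
  set ρ : ℕ → ℝ := fun i => ‖1 - starRingEnd ℂ (cgrad p (z i)) * (z (i + 1) - z i) / 2‖ ^ 2 *
    Real.exp (p (z (i + 1)) - p (z i)) with hρ
  have hε0 : 0 ≤ ε := (Finset.sum_nonneg fun _ _ => sq_nonneg _).trans hz
  have hstep : ∀ i < N, A * ‖z (i + 1) - z i‖ ≤ 1 / 4 := by
    intro i hi
    have h1 : ‖z (i + 1) - z i‖ ^ 2 ≤ ε := (Finset.single_le_sum
      (f := fun i => ‖z (i + 1) - z i‖ ^ 2) (fun _ _ => sq_nonneg _)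
      (Finset.mem_range.2 hi)).trans hz
    have h2 : (A * ‖z (i + 1) - z i‖) ^ 2 ≤ (1 / 4) ^ 2 := by
      rw [mul_pow]
      have := mul_le_mul_of_nonneg_left h1 (sq_nonneg A)
      linarith
    exact le_of_sq_le_sq h2 (by norm_num)
  have hr : ∀ i < N, |ρ i - 1| ≤ 10 * (A * ‖z (i + 1) - z i‖) ^ 2 ∧
      |p (z (i + 1)) - p (z i)| ≤ 1 / 2 :=
    fun i hi => abs_step_ratio_sub_one_le hA (hg i hi) (hd i hi) (hstep i hi)
  have hnρ : ∀ i, n (i + 1) = n i * ρ i := by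
    intro i
    simp only [hn, hρ, chainTransport_succ, norm_mul, mul_pow]
    rw [Real.exp_sub]
    have := Real.exp_pos (p (z i))
    field_simp
  have hprod : ∀ k i, n (i + k) = n i * ∏ j ∈ Finset.range k, ρ (i + j) := by
    intro k i
    induction k with
    | zero => simp
    | succ k ih => rw [Finset.prod_range_succ, ← add_assoc, hnρ, ih]; ring
  have hπ : ∀ k i, i + k ≤ N → |∏ j ∈ Finset.range k, ρ (i + j) - 1| ≤ 20 * A ^ 2 * ε := by
    intro k i hik
    have h1 := Finset.norm_prod_one_add_sub_one_le (Finset.range k) fun j => ρ (i + j) - 1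
    simp only [add_sub_cancel, Real.norm_eq_abs] at h1
    have h2 : ∑ j ∈ Finset.range k, |ρ (i + j) - 1| ≤ 10 * A ^ 2 * ε := by
      calc _ ≤ ∑ j ∈ Finset.range k, 10 * A ^ 2 * ‖z (i + j + 1) - z (i + j)‖ ^ 2 := by
            refine Finset.sum_le_sum fun j hj => ?_
            refine (hr (i + j) (by have := Finset.mem_range.1 hj; omega)).1.trans_eq ?_
            ring
        _ = 10 * A ^ 2 * ∑ j ∈ Finset.range k, ‖z (i + j + 1) - z (i + j)‖ ^ 2 := by
            rw [Finset.mul_sum]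
        _ ≤ _ := by
            refine mul_le_mul_of_nonneg_left (le_trans ?_ hz) (by positivity)
            rw [← Finset.sum_image (s := Finset.range k) (g := fun j => i + j)
              (f := fun j => ‖z (j + 1) - z j‖ ^ 2) (by intro a _ b _ h; simpa using h)]
            refine Finset.sum_le_sum_of_subset_of_nonneg ?_ fun _ _ _ => sq_nonneg _
            intro j hj
            simp only [Finset.mem_image, Finset.mem_range] at hj ⊢
            omega
    have h3 : 0 ≤ ∑ j ∈ Finset.range k, |ρ (i + j) - 1| := Finset.sum_nonneg fun _ _ => abs_nonneg _
    have h4 := Real.abs_exp_sub_one_le (x := ∑ j ∈ Finset.range k, |ρ (i + j) - 1|)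
      (by rw [abs_of_nonneg h3]; linarith)
    rw [abs_of_nonneg h3] at h4
    have h5 := le_abs_self (Real.exp (∑ j ∈ Finset.range k, |ρ (i + j) - 1|) - 1)
    linarith
  have hn0 : ∀ i, 0 ≤ n i := fun i => by positivity
  have hmain : ∀ i ≤ N, ∃ π : ℝ, n N = n i * π ∧ |π - 1| ≤ 20 * A ^ 2 * ε := by
    intro i hi
    obtain ⟨k, hk⟩ := Nat.exists_eq_add_of_le hi
    exact ⟨_, by rw [hk, hprod], hπ k i hk.ge⟩
  refine ⟨?_, fun i hi => ?_, fun i hi => ?_⟩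
  · obtain ⟨π, h1, h2⟩ := hmain 0 (Nat.zero_le _)
    have h3 : 0 < n 0 := by simp [hn, chainTransport, Real.exp_pos]
    have := (abs_le.1 h2).1
    change 0 < n N
    rw [h1]
    exact mul_pos h3 (by linarith)
  · obtain ⟨π, h1, h2⟩ := hmain i hi
    change |n i - n N| ≤ 40 * A ^ 2 * ε * n N
    have h3 := (abs_le.1 h2).1
    have h4 : n i ≤ 2 * n N := by rw [h1]; nlinarith [hn0 i]
    have h5 : |n i - n N| = n i * |π - 1| := by
      rw [h1, abs_sub_comm, ← mul_sub_one, abs_mul, abs_of_nonneg (hn0 i)]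
    rw [h5]
    have h6 : 0 ≤ 20 * A ^ 2 * ε := by positivity
    calc n i * |π - 1| ≤ (2 * n N) * (20 * A ^ 2 * ε) :=
          mul_le_mul h4 h2 (abs_nonneg _) (by linarith [hn0 N])
      _ = _ := by ring
  · rw [← mul_assoc]
    refine mul_le_mul_of_nonneg_right ?_ (sq_nonneg _)
    have h1 := (abs_le.1 (hr i hi).2).1
    have h2 : Real.exp (p (z i)) =
        Real.exp (p (z i) - p (z (i + 1))) * Real.exp (p (z (i + 1))) := by
      rw [← Real.exp_add]; congr 1; ring
    rw [h2]
    refine mul_le_mul_of_nonneg_right ?_ (Real.exp_pos _).le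
    have h3 := Real.abs_exp_sub_one_sub_id_le (x := 1 / 2) (by norm_num [abs_of_pos])
    have h4 := (abs_le.1 h3).2
    have h5 : Real.exp (p (z i) - p (z (i + 1))) ≤ Real.exp (1 / 2) :=
        Real.exp_le_exp.2 (by linarith)
    norm_num at h4
    linarith

theorem norm_le_one_of_energy {v : ℂ → ℝ} {N M : ℕ} {c : ℝ} {z : ℕ → ℂ} (hc : 0 < c)
    (hv : ∀ x, 0 ≤ v x) (hball : ∀ x ∈ closedBall (0:ℂ) 1, c ≤ v x) (hz0 : z 0 = 0) (hMN : M ≤ N)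
    (hM : M * chainEnergy N v z ≤ c * N) : ∀ i ≤ M, ‖z i‖ ≤ 1 := by
  have key : ∀ i, i ≤ M → ∀ j ≤ i, ‖z j‖ ≤ 1 := by
    intro i
    induction i with
    | zero => intro _ j hj; simp [Nat.le_zero.1 hj, hz0]
    | succ i ih =>
      intro hi j hj
      have ih' := ih (by omega)
      rcases Nat.lt_or_ge j (i + 1) with h | h
      · exact ih' j (by omega)
      obtain rfl : j = i + 1 := by omega
      have hN : (0:ℝ) < N := by exact_mod_cast (by omega : 0 < N)
      have h1 : ‖z (i + 1)‖ ≤ ∑ k ∈ Finset.range (i + 1), ‖z (k + 1) - z k‖ := by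
        have := Finset.sum_range_sub z (i + 1)
        rw [hz0, sub_zero] at this
        rw [← this]
        exact norm_sum_le _ _
      have h2 : (∑ k ∈ Finset.range (i + 1), ‖z (k + 1) - z k‖) ^ 2 ≤
          (i + 1 : ℕ) * ∑ k ∈ Finset.range (i + 1), ‖z (k + 1) - z k‖ ^ 2 := by
        simpa using sq_sum_le_card_mul_sum_sq (s := Finset.range (i + 1))
          (f := fun k => ‖z (k + 1) - z k‖)
      have h3 : N * (c * ∑ k ∈ Finset.range (i + 1), ‖z (k + 1) - z k‖ ^ 2) ≤
          chainEnergy N v z := by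
        refine mul_le_mul_of_nonneg_left ?_ hN.le
        rw [Finset.mul_sum]
        calc _ ≤ ∑ k ∈ Finset.range (i + 1), v (z k) * ‖z (k + 1) - z k‖ ^ 2 := by
              refine Finset.sum_le_sum fun k hk => mul_le_mul_of_nonneg_right ?_ (sq_nonneg _)
              exact hball _ (by simpa using ih' k (by have := Finset.mem_range.1 hk; omega))
          _ ≤ _ := Finset.sum_le_sum_of_subset_of_nonneg (by simpa using by omega)
              fun _ _ _ => mul_nonneg (hv _) (sq_nonneg _)
      set S := ∑ k ∈ Finset.range (i + 1), ‖z (k + 1) - z k‖ ^ 2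
      have hS : 0 ≤ S := Finset.sum_nonneg fun _ _ => sq_nonneg _
      have h4 : ((i + 1 : ℕ) : ℝ) ≤ M := by exact_mod_cast hi
      have h5 : (M:ℝ) * (N * (c * S)) ≤ c * N :=
        (mul_le_mul_of_nonneg_left h3 (Nat.cast_nonneg _)).trans hM
      have h6 : (M:ℝ) * S ≤ 1 := by
        have : (c * N) * (M * S) ≤ (c * N) * 1 := by linarith
        exact le_of_mul_le_mul_left this (by positivity)
      have h7 : (∑ k ∈ Finset.range (i + 1), ‖z (k + 1) - z k‖) ^ 2 ≤ 1 ^ 2 := by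
        have := mul_le_mul_of_nonneg_right h4 hS
        linarith
      exact h1.trans (le_of_sq_le_sq h7 zero_le_one)
  exact fun i hi => key i hi i le_rfl

theorem chainEnergy_nonneg {v : ℂ → ℝ} (hv : ∀ x, 0 ≤ v x) (N : ℕ) (z : ℕ → ℂ) :
    0 ≤ chainEnergy N v z :=
  mul_nonneg (Nat.cast_nonneg _) (Finset.sum_nonneg fun _ _ => mul_nonneg (hv _) (sq_nonneg _))

/-- A linear cutoff, reaching `1` after `M` steps. -/
noncomputable def rampWeight (M i : ℕ) : ℝ := min (i / M) 1

theorem rampWeight_mem (M i : ℕ) : 0 ≤ rampWeight M i ∧ rampWeight M i ≤ 1 :=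
  ⟨le_min (by positivity) zero_le_one, min_le_right _ _⟩

theorem rampWeight_of_le {M i : ℕ} (hM : 0 < M) (h : M ≤ i) : rampWeight M i = 1 := by
  refine min_eq_right ?_
  rw [one_le_div (by exact_mod_cast hM)]
  exact_mod_cast h

theorem rampWeight_of_ge {M i : ℕ} (hM : 0 < M) (h : i ≤ M) : rampWeight M i = i / M := by
  refine min_eq_left ?_
  rw [div_le_one (by exact_mod_cast hM)]
  exact_mod_cast h

theorem sum_ramp_le {M N : ℕ} (hM : 0 < M) (hMN : M ≤ N) {g : ℕ → ℝ} {B : ℝ}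
    (hg : ∀ i < N, g i ≤ B) :
    ∑ i ∈ Finset.range N, (rampWeight M (i + 1) - rampWeight M i) ^ 2 * g i ≤ B / M := by
  have hM' : (0:ℝ) < M := by exact_mod_cast hM
  have hsub : Finset.range M ⊆ Finset.range N := by simpa using hMN
  rw [← Finset.sum_subset hsub]
  · calc _ ≤ ∑ i ∈ Finset.range M, (1 / (M:ℝ)) ^ 2 * B := by
          refine Finset.sum_le_sum fun i hi => ?_
          have hi' := Finset.mem_range.1 hi
          rw [rampWeight_of_ge hM hi', rampWeight_of_ge hM hi'.le]
          rw [show (((i + 1 : ℕ) : ℝ) / M - i / M) = 1 / M by push_cast; ring]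
          exact mul_le_mul_of_nonneg_left (hg i (by omega)) (sq_nonneg _)
      _ = B / M := by
          rw [Finset.sum_const, Finset.card_range, nsmul_eq_mul]
          field_simp
  · intro i _ hi
    have hi' : M ≤ i := by simpa using hi
    rw [rampWeight_of_le hM hi', rampWeight_of_le hM (by omega)]
    simp

set_option maxHeartbeats 1000000 in
theorem cutoff_variation {p q : ℂ → ℝ} (hp : ContDiff ℝ 2 p)
    (hq : ∀ z, lap p z = Real.exp (p z) * q z) {N : ℕ} {z : ℕ → ℂ} {c Q₀ Q A ε : ℝ}
    (hc : 0 < c) (hc1 : c ≤ 1)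
    (hball : ∀ x ∈ closedBall (0:ℂ) 1, c ≤ Real.exp (p x) ∧ |q x| ≤ Q₀) (hz0 : z 0 = 0)
    (hN : 2 * (1 + chainEnergy N (fun x => Real.exp (p x)) z) ≤ c * N)
    (hA : 1 ≤ A) (hg : ∀ i < N, ‖cgrad p (z i)‖ ≤ A)
    (hd : ∀ i < N, |p (z (i + 1)) - p (z i) -
      (starRingEnd ℂ (cgrad p (z i)) * (z (i + 1) - z i)).re| ≤ A * ‖z (i + 1) - z i‖ ^ 2)
    (hQ0 : 0 ≤ Q) (hQ : ∀ i < N, |q (z i)| ≤ Q)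
    (hε : 40 * A ^ 2 * ε * (1 + Q) ≤ 1)
    (hz : ∑ i ∈ Finset.range N, ‖z (i + 1) - z i‖ ^ 2 ≤ ε) :
    ∃ (V : ℕ → ℂ) (a₁ a₂ b₁ b₂ : ℝ), V 0 = 0 ∧ V N ≠ 0 ∧
      HasJet (fun s => chainEnergy N (fun x => Real.exp (p x)) (moveChain z V s)) a₁ b₁ ∧
      HasJet (fun s => chainEnergy N (fun x => Real.exp (p x))
        (moveChain z (fun i => Complex.I * V i) s)) a₂ b₂ ∧
      b₁ + b₂ ≤ Real.exp (p (z N)) * ‖V N‖ ^ 2 *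
        (N * ∑ i ∈ Finset.range N, Real.exp (p (z i)) * q (z i) * ‖z (i + 1) - z i‖ ^ 2 +
          (Q₀ + 1 + 32 / c) * (1 + chainEnergy N (fun x => Real.exp (p x)) z)) ∧
      a₁ ^ 2 + a₂ ^ 2 ≤ Real.exp (p (z N)) * ‖V N‖ ^ 2 *
        ((Q₀ + 1 + 32 / c) * (1 + chainEnergy N (fun x => Real.exp (p x)) z) ^ 2) := by
  set E := chainEnergy N (fun x => Real.exp (p x)) z with hE
  have hE0 : 0 ≤ E := chainEnergy_nonneg (fun _ => (Real.exp_pos _).le) _ _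
  have hQ₀ : 0 ≤ Q₀ := (abs_nonneg _).trans (hball 0 (by simp)).2
  have hN0 : (0:ℝ) < N := by
    by_contra! h
    have := mul_nonpos_of_nonneg_of_nonpos hc.le h
    linarith
  set X : ℝ := c * N / (2 * (1 + E)) with hX
  have hX1 : 1 ≤ X := by rw [hX, one_le_div (by positivity)]; exact hN
  set M : ℕ := ⌈X⌉₊ with hM
  have hMX : X ≤ M := Nat.le_ceil _
  have hM2 : (M:ℝ) ≤ 2 * X := by
    have := Nat.ceil_lt_add_one (zero_le_one.trans hX1)
    linarith
  have hM0 : 0 < M := Nat.ceil_pos.2 (by linarith)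
  have hXE : 2 * X * (1 + E) = c * N := by rw [hX]; field_simp
  have hMN : M ≤ N := by
    have : (M:ℝ) ≤ N := by nlinarith
    exact_mod_cast this
  have hz1 : ∀ i ≤ M, ‖z i‖ ≤ 1 := by
    refine norm_le_one_of_energy (v := fun x => Real.exp (p x)) hc
      (fun _ => (Real.exp_pos _).le) (fun x hx => (hball x hx).1) hz0 hMN ?_
    rw [← hE, ← hXE]
    nlinarith
  have hε0 : 0 ≤ ε := (Finset.sum_nonneg fun _ _ => sq_nonneg _).trans hz
  have hAε : 0 ≤ 40 * A ^ 2 * ε := by positivity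
  have hε1 : 40 * A ^ 2 * ε ≤ 1 := by nlinarith
  obtain ⟨hl, hw, hs⟩ := chainTransport_weights hA hg hd hε1 hz
  set P := chainTransport p z with hP
  set f := rampWeight M with hf
  have hfN : f N = 1 := rampWeight_of_le hM0 hMN
  obtain ⟨a₁, a₂, b₁, b₂, J1, J2, hb, ha⟩ := energy_variation hp N z P f (chainTransport_succ p z)
  set l := Real.exp (p (z N)) * ‖P N‖ ^ 2 with hldef
  have hVl : Real.exp (p (z N)) * ‖(f N : ℂ) * P N‖ ^ 2 = l := by rw [hfN]; simp [hldef]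
  have hn2 : ∀ i ≤ N, Real.exp (p (z i)) * ‖P i‖ ^ 2 ≤ 2 * l := by
    intro i hi
    have := (abs_le.1 (hw i hi)).2
    nlinarith
  have hT2 : N * ∑ i ∈ Finset.range N, Real.exp (p (z i)) *
      ((f (i + 1) - f i) ^ 2 * ‖P (i + 1)‖ ^ 2) ≤ l * (8 / c * (1 + E)) := by
    have h1 := sum_ramp_le (g := fun i => Real.exp (p (z i)) * ‖P (i + 1)‖ ^ 2) (B := 4 * l)
      hM0 hMN fun i hi => (hs i hi).trans (by have := hn2 (i + 1) (by omega); linarith)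
    have h2 : ∑ i ∈ Finset.range N, Real.exp (p (z i)) *
      ((f (i + 1) - f i) ^ 2 * ‖P (i + 1)‖ ^ 2) ≤ 4 * l / M := by
      refine le_trans (le_of_eq (Finset.sum_congr rfl fun i _ => ?_)) h1
      ring
    have h3 : 4 * l / M ≤ 4 * l / X := by
      gcongr
    refine (mul_le_mul_of_nonneg_left (h2.trans h3) hN0.le).trans_eq ?_
    rw [hX]
    field_simp
    ring
  have hT2' : 0 ≤ N * ∑ i ∈ Finset.range N, Real.exp (p (z i)) *
      ((f (i + 1) - f i) ^ 2 * ‖P (i + 1)‖ ^ 2) :=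
    mul_nonneg hN0.le (Finset.sum_nonneg fun _ _ => by positivity)
  have hm : ∀ i < N, q (z i) * (f i ^ 2 * (Real.exp (p (z i)) * ‖P i‖ ^ 2) - l) ≤ l * (Q₀ + 1) := by
    intro i hi
    rcases Nat.lt_or_ge i M with h | h
    · obtain ⟨f0, f1⟩ := rampWeight_mem M i
      have g1 := (hball (z i) (by simpa using hz1 i h.le)).2
      have g2 := hn2 i hi.le
      have g3 : 0 ≤ Real.exp (p (z i)) * ‖P i‖ ^ 2 := by positivity
      have g4 : f i ^ 2 * (Real.exp (p (z i)) * ‖P i‖ ^ 2) ≤ 1 * (2 * l) :=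
        mul_le_mul (pow_le_one₀ f0 f1) g2 g3 zero_le_one
      have g5 : |f i ^ 2 * (Real.exp (p (z i)) * ‖P i‖ ^ 2) - l| ≤ l := by
        rw [abs_le]; constructor
        · have : 0 ≤ f i ^ 2 * (Real.exp (p (z i)) * ‖P i‖ ^ 2) := by positivity
          linarith
        · linarith
      have g6 := le_abs_self (q (z i) * (f i ^ 2 * (Real.exp (p (z i)) * ‖P i‖ ^ 2) - l))
      rw [abs_mul] at g6
      have g7 := mul_le_mul g1 g5 (abs_nonneg _) hQ₀
      nlinarith
    · rw [hf, rampWeight_of_le hM0 h, one_pow, one_mul]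
      have g5 := hw i hi.le
      have g6 := le_abs_self (q (z i) * (Real.exp (p (z i)) * ‖P i‖ ^ 2 - l))
      rw [abs_mul] at g6
      have g7 := mul_le_mul (hQ i hi) g5 (abs_nonneg _) hQ0
      have g8 : Q * (40 * A ^ 2 * ε * l) ≤ l := by
        have : 40 * A ^ 2 * ε * Q ≤ 1 := by nlinarith
        nlinarith
      nlinarith
  refine ⟨fun i => f i * P i, a₁, a₂, b₁, b₂, ?_, ?_, J1, J2, ?_, ?_⟩
  · simp [hf, rampWeight]
  · intro h
    beta_reduce at h
    rw [h] at hVl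
    simp at hVl
    linarith
  · rw [hVl, hb]
    have e : N * ∑ i ∈ Finset.range N, Real.exp (p (z i)) *
        (f i ^ 2 * ‖P i‖ ^ 2 * ‖z (i + 1) - z i‖ ^ 2 * lap p (z i)
          + 4 * ((f (i + 1) - f i) ^ 2 * ‖P (i + 1)‖ ^ 2)) =
        l * (N * ∑ i ∈ Finset.range N, Real.exp (p (z i)) * q (z i) * ‖z (i + 1) - z i‖ ^ 2) +
        N * ∑ i ∈ Finset.range N, Real.exp (p (z i)) * ‖z (i + 1) - z i‖ ^ 2 *
          (q (z i) * (f i ^ 2 * (Real.exp (p (z i)) * ‖P i‖ ^ 2) - l)) +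
        4 * (N * ∑ i ∈ Finset.range N, Real.exp (p (z i)) *
          ((f (i + 1) - f i) ^ 2 * ‖P (i + 1)‖ ^ 2)) := by
      simp only [Finset.mul_sum, ← Finset.sum_add_distrib]
      refine Finset.sum_congr rfl fun i _ => ?_
      rw [hq]
      ring
    rw [e]
    have h1 : N * ∑ i ∈ Finset.range N, Real.exp (p (z i)) * ‖z (i + 1) - z i‖ ^ 2 *
          (q (z i) * (f i ^ 2 * (Real.exp (p (z i)) * ‖P i‖ ^ 2) - l)) ≤ E * (l * (Q₀ + 1)) := by
      rw [hE, chainEnergy, mul_assoc, Finset.sum_mul]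
      refine mul_le_mul_of_nonneg_left (Finset.sum_le_sum fun i hi => ?_) hN0.le
      exact mul_le_mul_of_nonneg_left (hm i (Finset.mem_range.1 hi)) (by positivity)
    have h2 : E * (l * (Q₀ + 1)) ≤ l * ((Q₀ + 1) * (1 + E)) := by
      have : 0 ≤ l * (Q₀ + 1) := by positivity
      nlinarith
    have h3 : 4 * (l * (8 / c * (1 + E))) = l * (32 / c * (1 + E)) := by ring
    linarith
  · rw [hVl]
    refine ha.trans ?_
    rw [← hE]
    have h1 : 4 * E * (N * ∑ i ∈ Finset.range N, Real.exp (p (z i)) *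
        ((f (i + 1) - f i) ^ 2 * ‖P (i + 1)‖ ^ 2)) ≤ 4 * (1 + E) * (l * (8 / c * (1 + E))) :=
      mul_le_mul (by linarith) hT2 hT2' (by positivity)
    have h2 : 4 * (1 + E) * (l * (8 / c * (1 + E))) = l * (32 / c * (1 + E) ^ 2) := by ring
    have h3 : 0 ≤ l * ((Q₀ + 1) * (1 + E) ^ 2) := by positivity
    linarith

section
variable {T : ℝ} {u : ℂ → ℝ → ℝ}

/-- The time derivative of the energy of a fixed chain. -/
noncomputable def chainEnergySpeed (u : ℂ → ℝ → ℝ) (N : ℕ) (t : ℝ) (z : ℕ → ℂ) : ℝ :=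
  N * ∑ i ∈ Finset.range N, u (z i) t * logSpeed u (z i, t) * ‖z (i + 1) - z i‖ ^ 2

theorem hasDerivAt_chainEnergy (hpos : ∀ z, ∀ t ∈ Ioo 0 T, 0 < u z t)
    (hsmooth : ContDiffOn ℝ (⊤ : ℕ∞) (fun p : ℂ × ℝ => u p.1 p.2) (univ ×ˢ Ioo 0 T))
    {t : ℝ} (ht : t ∈ Ioo 0 T) (N : ℕ) (z : ℕ → ℂ) :
    HasDerivAt (fun s => chainEnergy N (fun x => u x s) z) (chainEnergySpeed u N t z) t := by
  unfold chainEnergy chainEnergySpeed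
  refine HasDerivAt.const_mul _ (HasDerivAt.fun_sum fun i _ => ?_)
  exact (hasDerivAt_factor hpos hsmooth ht (z i)).mul_const _

theorem exists_factor_lower_bound (hpos : ∀ z, ∀ t ∈ Ioo 0 T, 0 < u z t)
    (hsmooth : ContDiffOn ℝ (⊤ : ℕ∞) (fun p : ℂ × ℝ => u p.1 p.2) (univ ×ˢ Ioo 0 T))
    {t₁ t₂ : ℝ} (h₁ : 0 < t₁) (h₂ : t₂ < T) (r : ℝ) :
    ∃ c : ℝ, 0 < c ∧ c ≤ 1 ∧ ∀ t ∈ Icc t₁ t₂, ∀ x ∈ closedBall (0:ℂ) r, c ≤ u x t := by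
  set K : Set (ℂ × ℝ) := closedBall 0 r ×ˢ Icc t₁ t₂
  have hK : IsCompact K := (isCompact_closedBall _ _).prod isCompact_Icc
  have hKs : K ⊆ univ ×ˢ Ioo 0 T := prod_mono (subset_univ _)
    fun t ht => ⟨h₁.trans_le ht.1, ht.2.trans_lt h₂⟩
  rcases K.eq_empty_or_nonempty with h | h
  · refine ⟨1, one_pos, le_rfl, fun t ht x hx => ?_⟩
    have : (x, t) ∈ K := ⟨hx, ht⟩
    simp [h] at this
  · obtain ⟨x, hx, hmin⟩ := hK.exists_isMinOn h (hsmooth.continuousOn.mono hKs)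
    refine ⟨min (u x.1 x.2) 1, lt_min (hpos _ _ (hKs hx).2) one_pos, min_le_right _ _,
      fun t ht y hy => (min_le_left _ _).trans ?_⟩
    exact hmin (show (y, t) ∈ K from ⟨hy, ht⟩)

theorem exists_speed_bound (hpos : ∀ z, ∀ t ∈ Ioo 0 T, 0 < u z t)
    (hsmooth : ContDiffOn ℝ (⊤ : ℕ∞) (fun p : ℂ × ℝ => u p.1 p.2) (univ ×ˢ Ioo 0 T))
    {t₁ t₂ : ℝ} (h₁ : 0 < t₁) (h₂ : t₂ < T) (r : ℝ) :
    ∃ Q : ℝ, 0 ≤ Q ∧ ∀ t ∈ Icc t₁ t₂, ∀ x ∈ closedBall (0:ℂ) r, |logSpeed u (x, t)| ≤ Q := by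
  have hK : IsCompact (closedBall (0:ℂ) r ×ˢ Icc t₁ t₂) :=
    (isCompact_closedBall _ _).prod isCompact_Icc
  obtain ⟨Q, hQ⟩ := hK.exists_bound_of_continuousOn
    ((contDiffOn_logSpeed hpos hsmooth).continuousOn.mono (prod_mono (subset_univ _)
    fun t ht => ⟨h₁.trans_le ht.1, ht.2.trans_lt h₂⟩))
  exact ⟨|Q|, abs_nonneg _, fun t ht x hx => (hQ (x, t) ⟨hx, ht⟩).trans (le_abs_self _)⟩

theorem exp_logFactor (hpos : ∀ z, ∀ t ∈ Ioo 0 T, 0 < u z t) {t : ℝ} (ht : t ∈ Ioo 0 T) (x : ℂ) :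
    Real.exp (logFactor u (x, t)) = u x t := Real.exp_log (hpos x t ht)

theorem chain_variation (hpos : ∀ z, ∀ t ∈ Ioo 0 T, 0 < u z t)
    (hsmooth : ContDiffOn ℝ (⊤ : ℕ∞) (fun p : ℂ × ℝ => u p.1 p.2) (univ ×ˢ Ioo 0 T))
    (hlfde : ∀ z, ∀ t ∈ Ioo 0 T, deriv (u z) t = lap (fun w => Real.log (u w t)) z)
    (hcomplete : ∀ t ∈ Ioo (0:ℝ) T, ConfComplete (fun z => u z t) univ)
    {t₁ t₂ : ℝ} (h₁ : 0 < t₁) (h₂ : t₂ < T) :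
    ∃ C : ℝ, 0 < C ∧ ∀ E₀ : ℝ, ∃ r : ℝ, ∃ N₀ : ℕ, ∀ N ≥ N₀, ∀ t ∈ Icc t₁ t₂, ∀ z : ℕ → ℂ,
      z 0 = 0 → chainEnergy N (fun w => u w t) z ≤ E₀ →
      (∀ i ≤ N, ‖z i‖ ≤ r) ∧ ∃ (V : ℕ → ℂ) (a₁ a₂ b₁ b₂ : ℝ), V 0 = 0 ∧ V N ≠ 0 ∧
      HasJet (fun s => chainEnergy N (fun x => u x t) (moveChain z V s)) a₁ b₁ ∧
      HasJet (fun s => chainEnergy N (fun x => u x t) (moveChain z (fun i => Complex.I * V i) s))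
        a₂ b₂ ∧
      b₁ + b₂ ≤ u (z N) t * ‖V N‖ ^ 2 *
        (chainEnergySpeed u N t z + C * (1 + chainEnergy N (fun x => u x t) z)) ∧
      a₁ ^ 2 + a₂ ^ 2 ≤ u (z N) t * ‖V N‖ ^ 2 *
        (C * (1 + chainEnergy N (fun x => u x t) z) ^ 2) := by
  have hI : ∀ t ∈ Icc t₁ t₂, t ∈ Ioo 0 T := fun t ht => ⟨h₁.trans_le ht.1, ht.2.trans_lt h₂⟩
  obtain ⟨c, hc, hc1, hcb⟩ := exists_factor_lower_bound hpos hsmooth h₁ h₂ 1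
  obtain ⟨Q₀, hQ₀, hQ₀b⟩ := exists_speed_bound hpos hsmooth h₁ h₂ 1
  refine ⟨Q₀ + 1 + 32 / c, by positivity, fun E₀ => ?_⟩
  obtain ⟨r, N₁, hr⟩ := chain_bounded hsmooth.continuousOn hpos hcomplete E₀ h₁ h₂
  obtain ⟨cr, hcr, -, hcrb⟩ := exists_factor_lower_bound hpos hsmooth h₁ h₂ r
  obtain ⟨Q, hQ, hQb⟩ := exists_speed_bound hpos hsmooth h₁ h₂ r
  obtain ⟨A, hA, hAb⟩ := exists_taylor_bound (contDiffOn_logFactor hpos hsmooth) h₁ h₂ r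
  obtain ⟨N₂, hN₂⟩ := exists_nat_gt (2 * (1 + E₀) / c)
  obtain ⟨N₃, hN₃⟩ := exists_nat_gt (40 * A ^ 2 * (1 + Q) * E₀ / cr)
  refine ⟨r, max N₁ (max N₂ N₃), fun N hN t ht z hz0 hE => ?_⟩
  have hzr := hr N (le_of_max_le_left hN) t ht z hz0 hE
  refine ⟨hzr, ?_⟩
  have htI := hI t ht
  have hE0 := chainEnergy_nonneg (fun x => (hpos x t htI).le) N z
  have e : (fun x => Real.exp (logFactor u (x, t))) = fun x => u x t :=
    funext (exp_logFactor hpos htI)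
  have hN2 : (2 * (1 + E₀) / c) < N :=
    hN₂.trans_le (by exact_mod_cast (le_of_max_le_left (le_of_max_le_right hN)))
  have hN3 : (40 * A ^ 2 * (1 + Q) * E₀ / cr) < N :=
    hN₃.trans_le (by exact_mod_cast (le_of_max_le_right (le_of_max_le_right hN)))
  have hN0 : (0:ℝ) < N := lt_of_le_of_lt (by have := hE0.trans hE; positivity) hN2
  rw [div_lt_iff₀ hc] at hN2
  rw [div_lt_iff₀ hcr] at hN3
  have hz' : ∀ i ≤ N, z i ∈ closedBall (0:ℂ) r := fun i hi => by simpa using hzr i hi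
  have hp : ContDiff ℝ 2 fun x => logFactor u (x, t) :=
    (contDiff_spacetime_slice (contDiffOn_logFactor hpos hsmooth) htI).of_le
      (WithTop.coe_le_coe.2 (le_top : (2 : ℕ∞) ≤ ⊤))
  obtain ⟨V, a₁, a₂, b₁, b₂, hV0, hVN, J1, J2, hb, ha⟩ := cutoff_variation
    (p := fun x => logFactor u (x, t)) (q := fun x => logSpeed u (x, t)) (N := N) (z := z)
    (c := c) (Q₀ := Q₀) (Q := Q) (A := A) (ε := E₀ / (N * cr)) hp
    (fun x => by rw [lap_logFactor hpos hsmooth hlfde htI, exp_logFactor hpos htI]) hc hc1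
    (fun x hx => ⟨by rw [exp_logFactor hpos htI]; exact hcb t ht x hx, hQ₀b t ht x hx⟩) hz0
    (by rw [e]; linarith) hA (fun i hi => (hAb t ht _ (hz' i hi.le)).1)
    (fun i hi => (hAb t ht _ (hz' i hi.le)).2 _ (hz' (i + 1) hi)) hQ
    (fun i hi => hQb t ht _ (hz' i hi.le))
    (by
      rw [show 40 * A ^ 2 * (E₀ / (N * cr)) * (1 + Q) =
          40 * A ^ 2 * (1 + Q) * E₀ / (N * cr) by ring,
        div_le_one (by positivity)]
      exact hN3.le)
    (by
      rw [le_div_iff₀ (by positivity)]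
      refine le_trans (le_of_eq_of_le ?_ (mul_le_mul_of_nonneg_left (Finset.sum_le_sum
        (f := fun i => cr * ‖z (i + 1) - z i‖ ^ 2)
        fun i hi => mul_le_mul_of_nonneg_right (hcrb t ht _ (hz' i (Finset.mem_range.1 hi).le))
          (sq_nonneg _)) hN0.le)) hE
      rw [← Finset.mul_sum]
      ring)
  simp only [exp_logFactor hpos htI] at J1 J2 hb ha
  exact ⟨V, a₁, a₂, b₁, b₂, hV0, hVN, J1, J2, hb, ha⟩

end

/-- A barrier in the energy variable, blowing up where `log (1 + E) = R`. -/
noncomputable def energyBarrier (κ R E : ℝ) : ℝ := κ / (1 - Real.log (1 + E) / R) ^ 2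

theorem hasDerivAt_barrier_base {R E : ℝ} (hE : 0 < 1 + E) :
    HasDerivAt (fun E => 1 - Real.log (1 + E) / R) (-(1 / (1 + E) / R)) E := by
  have h1 : HasDerivAt (fun E : ℝ => 1 + E) 1 E := (hasDerivAt_id E).const_add 1
  exact ((h1.log hE.ne').div_const R).const_sub 1

theorem hasDerivAt_energyBarrier {κ R E : ℝ} (hR : 0 < R) (hE : 0 < 1 + E)
    (hy : 0 < 1 - Real.log (1 + E) / R) : HasDerivAt (energyBarrier κ R)
      (2 * κ / (R * (1 + E) * (1 - Real.log (1 + E) / R) ^ 3)) E := by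
  have h := (hasDerivAt_const E κ).div ((hasDerivAt_barrier_base (R := R) hE).pow 2)
    (pow_ne_zero 2 hy.ne')
  refine h.congr_deriv ?_
  simp only [Pi.pow_apply]
  generalize 1 - Real.log (1 + E) / R = y at hy
  generalize 1 + E = e at hE
  field_simp
  simp
  ring

theorem hasDerivAt_energyBarrier_deriv {κ R E : ℝ} (hR : 0 < R) (hE : 0 < 1 + E)
    (hy : 0 < 1 - Real.log (1 + E) / R) :
    HasDerivAt (fun E => 2 * κ / (R * (1 + E) * (1 - Real.log (1 + E) / R) ^ 3))
      (6 * κ / (R ^ 2 * (1 + E) ^ 2 * (1 - Real.log (1 + E) / R) ^ 4) -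
        2 * κ / (R * (1 + E) ^ 2 * (1 - Real.log (1 + E) / R) ^ 3)) E := by
  have h1 : HasDerivAt (fun E : ℝ => R * (1 + E)) (R * 1) E :=
    ((hasDerivAt_id E).const_add 1).const_mul R
  have h := (hasDerivAt_const E (2 * κ)).div
    (h1.mul ((hasDerivAt_barrier_base (R := R) hE).pow 3))
    (mul_ne_zero (mul_ne_zero hR.ne' hE.ne') (pow_ne_zero 3 hy.ne'))
  refine h.congr_deriv ?_
  simp only [Pi.pow_apply, Pi.mul_apply]
  generalize 1 - Real.log (1 + E) / R = y at hy
  generalize 1 + E = e at hE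
  field_simp
  ring

theorem deriv_nonneg_of_left_max {f : ℝ → ℝ} {f' t : ℝ} (h : HasDerivAt f f' t)
    (hm : ∀ᶠ s in nhdsWithin t (Iio t), f s ≤ f t) : 0 ≤ f' := by
  have h1 := (hasDerivWithinAt_iff_tendsto_slope' (s := Iio t) (by simp)).1 h.hasDerivWithinAt
  refine ge_of_tendsto h1 ?_
  filter_upwards [hm, self_mem_nhdsWithin] with s hs hst
  rw [slope_def_field]
  exact div_nonneg_of_nonpos (by linarith) (by have : s < t := hst; linarith)

theorem HasJet.continuousAt {φ : ℝ → ℝ} {a b : ℝ} (h : HasJet φ a b) : ContinuousAt φ 0 := by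
  obtain ⟨φ', h1, -, -⟩ := h
  exact h1.self_of_nhds.continuousAt

theorem chainEnergy_congr {N : ℕ} {v : ℂ → ℝ} {z z' : ℕ → ℂ} (h : ∀ i ≤ N, z i = z' i) :
    chainEnergy N v z = chainEnergy N v z' := by
  unfold chainEnergy
  congr 1
  refine Finset.sum_congr rfl fun i hi => ?_
  have := Finset.mem_range.1 hi
  rw [h i (by omega), h (i + 1) (by omega)]

section
variable {T : ℝ} {u : ℂ → ℝ → ℝ}

/-- The chain functional to which the maximum principle is applied. -/
noncomputable def barrierGap (u : ℂ → ℝ → ℝ) (N : ℕ) (t₁ κ R : ℝ) (z : ℕ → ℂ) (t : ℝ) : ℝ :=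
  logSpeed u (z N, t) - 1 / (t - t₁) - energyBarrier κ R (chainEnergy N (fun x => u x t) z)

set_option maxHeartbeats 1000000 in
theorem barrierGap_nonpos_of_max (hpos : ∀ z, ∀ t ∈ Ioo 0 T, 0 < u z t)
    (hsmooth : ContDiffOn ℝ (⊤ : ℕ∞) (fun p : ℂ × ℝ => u p.1 p.2) (univ ×ˢ Ioo 0 T))
    (hlfde : ∀ z, ∀ t ∈ Ioo 0 T, deriv (u z) t = lap (fun w => Real.log (u w t)) z)
    {t₁ t C R : ℝ} {N : ℕ} {z V : ℕ → ℂ} {a₁ a₂ b₁ b₂ : ℝ} (h₁ : 0 < t₁) (ht₁ : t₁ < t) (ht : t < T)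
    (hC : 0 < C) (hR : 1 ≤ R) (hV : V N ≠ 0)
    (J1 : HasJet (fun s => chainEnergy N (fun x => u x t) (moveChain z V s)) a₁ b₁)
    (J2 : HasJet (fun s => chainEnergy N (fun x => u x t)
      (moveChain z (fun i => Complex.I * V i) s))
      a₂ b₂)
    (hb : b₁ + b₂ ≤ u (z N) t * ‖V N‖ ^ 2 *
      (chainEnergySpeed u N t z + C * (1 + chainEnergy N (fun x => u x t) z)))
    (ha : a₁ ^ 2 + a₂ ^ 2 ≤ u (z N) t * ‖V N‖ ^ 2 *
      (C * (1 + chainEnergy N (fun x => u x t) z) ^ 2))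
    (hlog : Real.log (1 + chainEnergy N (fun x => u x t) z) < R)
    (hmt : ∀ᶠ s in nhdsWithin t (Iio t), barrierGap u N t₁ (8 * C / R) R z s ≤
      barrierGap u N t₁ (8 * C / R) R z t)
    (hm1 : ∀ᶠ s in nhds 0, barrierGap u N t₁ (8 * C / R) R (moveChain z V s) t ≤
      barrierGap u N t₁ (8 * C / R) R z t)
    (hm2 : ∀ᶠ s in nhds 0,
      barrierGap u N t₁ (8 * C / R) R (moveChain z (fun i => Complex.I * V i) s) t ≤
      barrierGap u N t₁ (8 * C / R) R z t) :
    barrierGap u N t₁ (8 * C / R) R z t ≤ 0 := by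
  have htI : t ∈ Ioo 0 T := ⟨h₁.trans ht₁, ht⟩
  set κ := 8 * C / R with hκ
  set E := chainEnergy N (fun x => u x t) z with hE
  have hR0 : 0 < R := by linarith
  have hκ0 : 0 < κ := by positivity
  have hE0 : 0 ≤ E := chainEnergy_nonneg (fun x => (hpos x t htI).le) N z
  have hE1 : 0 < 1 + E := by linarith
  set y := 1 - Real.log (1 + E) / R with hy
  have hy0 : 0 < y := by rw [hy, sub_pos, div_lt_one hR0]; exact hlog
  have hy1 : y ≤ 1 := by
    have : 0 ≤ Real.log (1 + E) / R := div_nonneg (Real.log_nonneg (by linarith)) hR0.le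
    linarith
  obtain ⟨q', hq', hq'e⟩ := hasDerivAt_logSpeed hpos hsmooth hlfde htI (z N)
  set q := logSpeed u (z N, t) with hq
  set β := 2 * κ / (R * (1 + E) * y ^ 3) with hβ
  set γ := 6 * κ / (R ^ 2 * (1 + E) ^ 2 * y ^ 4) - 2 * κ / (R * (1 + E) ^ 2 * y ^ 3) with hγ
  have hβ0 : 0 < β := by positivity
  have hτ : 0 < t - t₁ := by linarith
  -- time derivative
  have htime : 0 ≤ q' + 1 / (t - t₁) ^ 2 - β * chainEnergySpeed u N t z := by
    have d1 : HasDerivAt (fun s => 1 / (s - t₁)) (-(1 / (t - t₁) ^ 2)) t := by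
      refine ((hasDerivAt_const t (1:ℝ)).div ((hasDerivAt_id t).sub_const t₁) hτ.ne').congr_deriv ?_
      simp [neg_div]
    have d2 := (hasDerivAt_energyBarrier (κ := κ) hR0 hE1 hy0).comp t
      (hasDerivAt_chainEnergy hpos hsmooth htI N z)
    have := deriv_nonneg_of_left_max ((hq'.sub d1).sub d2) hmt
    linarith
  have hsp : ContDiff ℝ 2 fun x => logSpeed u (x, t) :=
    (contDiff_spacetime_slice (contDiffOn_logSpeed hpos hsmooth) htI).of_le
      (WithTop.coe_le_coe.2 (le_top : (2 : ℕ∞) ≤ ⊤))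
  have hspace : ∀ (W : ℕ → ℂ) (a b : ℝ),
      HasJet (fun s => chainEnergy N (fun x => u x t) (moveChain z W s)) a b →
      (∀ᶠ s in nhds 0, barrierGap u N t₁ κ R (moveChain z W s) t ≤ barrierGap u N t₁ κ R z t) →
      iteratedFDeriv ℝ 2 (fun x => logSpeed u (x, t)) (z N) ![W N, W N] ≤ γ * a ^ 2 + β * b := by
    intro W a b J hm
    have h0 : moveChain z W 0 = z := by funext i; simp [moveChain]
    have k1 : ∀ᶠ x in nhds ((fun s => chainEnergy N (fun x => u x t) (moveChain z W s)) 0),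
        HasDerivAt (energyBarrier κ R)
          ((fun E => 2 * κ / (R * (1 + E) * (1 - Real.log (1 + E) / R) ^ 3)) x) x := by
      beta_reduce
      rw [h0, ← hE]
      have c1 : ContinuousAt (fun E : ℝ => 1 - Real.log (1 + E) / R) E :=
        (hasDerivAt_barrier_base hE1).continuousAt
      filter_upwards [c1.eventually (lt_mem_nhds hy0),
          lt_mem_nhds (show -1 < E by linarith)] with x hx hx'
      exact hasDerivAt_energyBarrier hR0 (by linarith) hx
    have k2 : HasDerivAt (fun E => 2 * κ / (R * (1 + E) * (1 - Real.log (1 + E) / R) ^ 3)) γ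
        ((fun s => chainEnergy N (fun x => u x t) (moveChain z W s)) 0) := by
      beta_reduce
      rw [h0, ← hE]
      exact hasDerivAt_energyBarrier_deriv hR0 hE1 hy0
    have K := ((HasJet.line hsp (z N) (W N)).sub (HasJet.const (1 / (t - t₁)))).sub
      (HasJet.comp k1 k2 J)
    have hM := K.nonpos_of_isLocalMax (by
      unfold IsLocalMax IsMaxFilter
      have : ∀ s, ((fun s : ℝ => logSpeed u (z N + s * W N, t)) s - 1 / (t - t₁) -
          energyBarrier κ R (chainEnergy N (fun x => u x t) (moveChain z W s))) =
          barrierGap u N t₁ κ R (moveChain z W s) t := fun s => rfl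
      beta_reduce at this ⊢
      simp only [this, h0, Complex.ofReal_zero, zero_mul, add_zero]
      exact hm)
    beta_reduce at hM
    rw [h0, ← hE] at hM
    linarith
  have s1 := hspace V a₁ b₁ J1 hm1
  have s2 := hspace (fun i => Complex.I * V i) a₂ b₂ J2 hm2
  have s3 := iteratedFDeriv_two_add_rotate hsp (z N) (V N)
  set U := u (z N) t with hU
  have hU0 : 0 < U := hpos _ _ htI
  have hVn : 0 < ‖V N‖ ^ 2 := by have := norm_pos_iff.2 hV; positivity
  set D := chainEnergySpeed u N t z
  set δ := 6 * κ / (R ^ 2 * (1 + E) ^ 2 * y ^ 4) with hδ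
  have hδ0 : 0 < δ := by positivity
  have hγδ : γ ≤ δ := by
    have : 0 < 2 * κ / (R * (1 + E) ^ 2 * y ^ 3) := by positivity
    linarith
  have s4 : ‖V N‖ ^ 2 * lap (fun x => logSpeed u (x, t)) (z N) ≤
      ‖V N‖ ^ 2 * (U * (δ * (C * (1 + E) ^ 2) + β * (D + C * (1 + E)))) := by
    rw [← s3]
    have i1 : γ * (a₁ ^ 2 + a₂ ^ 2) ≤ δ * (U * ‖V N‖ ^ 2 * (C * (1 + E) ^ 2)) :=
      (mul_le_mul_of_nonneg_right hγδ (by positivity)).trans (mul_le_mul_of_nonneg_left ha hδ0.le)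
    have i2 := mul_le_mul_of_nonneg_left hb hβ0.le
    linarith
  have s5 := le_of_mul_le_mul_left s4 hVn
  have s6 : q' ≤ δ * (C * (1 + E) ^ 2) + β * (D + C * (1 + E)) - q ^ 2 := by
    refine le_of_mul_le_mul_left ?_ hU0
    rw [hq'e]
    linarith
  have s7 : q ^ 2 ≤ 1 / (t - t₁) ^ 2 + C * (δ * (1 + E) ^ 2 + β * (1 + E)) := by linarith
  have s8 : C * (δ * (1 + E) ^ 2 + β * (1 + E)) ≤ (κ / y ^ 2) ^ 2 := by
    have e1 : δ * (1 + E) ^ 2 = 6 * κ / (R ^ 2 * y ^ 4) := by rw [hδ]; field_simp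
    have e2 : β * (1 + E) = 2 * κ / (R * y ^ 3) := by rw [hβ]; field_simp
    have e3 : (κ / y ^ 2) ^ 2 = C * (8 * κ / (R * y ^ 4)) := by
      rw [hκ]; field_simp
    rw [e1, e2, e3]
    refine mul_le_mul_of_nonneg_left ?_ hC.le
    have i1 : 6 * κ / (R ^ 2 * y ^ 4) ≤ 6 * κ / (R * y ^ 4) := by
      gcongr; exact le_self_pow₀ hR two_ne_zero
    have i2 : 2 * κ / (R * y ^ 3) ≤ 2 * κ / (R * y ^ 4) := by
      refine div_le_div_of_nonneg_left (by positivity) (by positivity) ?_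
      exact mul_le_mul_of_nonneg_left (pow_le_pow_of_le_one hy0.le hy1 (by norm_num)) hR0.le
    have e4 : 8 * κ / (R * y ^ 4) = 6 * κ / (R * y ^ 4) + 2 * κ / (R * y ^ 4) := by ring
    linarith
  by_contra! hpos'
  have g : barrierGap u N t₁ κ R z t = q - 1 / (t - t₁) - κ / y ^ 2 := rfl
  rw [g] at hpos'
  have p1 : 0 < 1 / (t - t₁) := by positivity
  have p2 : 0 < κ / y ^ 2 := by positivity
  have p3 : 1 / (t - t₁) ^ 2 = (1 / (t - t₁)) ^ 2 := by rw [div_pow, one_pow]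
  rw [p3] at s7
  have p4 : (1 / (t - t₁) + κ / y ^ 2) ^ 2 < q ^ 2 :=
    pow_lt_pow_left₀ (by linarith) (by positivity) two_ne_zero
  have p5 := mul_pos p1 p2
  rw [add_sq] at p4
  linarith

end

section
variable {T : ℝ} {u : ℂ → ℝ → ℝ}

theorem continuousOn_chainEnergy
    (hu : ContinuousOn (fun p : ℂ × ℝ => u p.1 p.2) (univ ×ˢ Ioo 0 T)) (N : ℕ) :
    ContinuousOn (fun p : (ℕ → ℂ) × ℝ => chainEnergy N (fun x => u x p.2) p.1)
      (univ ×ˢ Ioo 0 T) := by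
  unfold chainEnergy
  refine continuousOn_const.mul (continuousOn_finsetSum _ fun i _ => ContinuousOn.mul ?_ ?_)
  · exact hu.comp (f := fun p : (ℕ → ℂ) × ℝ => (p.1 i, p.2)) (by fun_prop)
      fun p hp => ⟨mem_univ _, hp.2⟩
  · fun_prop

set_option maxHeartbeats 1000000 in
theorem barrierGap_nonpos (hpos : ∀ z, ∀ t ∈ Ioo 0 T, 0 < u z t)
    (hsmooth : ContDiffOn ℝ (⊤ : ℕ∞) (fun p : ℂ × ℝ => u p.1 p.2) (univ ×ˢ Ioo 0 T))
    (hlfde : ∀ z, ∀ t ∈ Ioo 0 T, deriv (u z) t = lap (fun w => Real.log (u w t)) z)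
    {t₁ t₂ C R r : ℝ} {N : ℕ} (h₁ : 0 < t₁) (h₁₂ : t₁ < t₂) (h₂ : t₂ < T) (hC : 0 < C) (hR : 1 ≤ R)
    (hvar : ∀ t ∈ Icc t₁ t₂, ∀ z : ℕ → ℂ,
      z 0 = 0 → chainEnergy N (fun w => u w t) z ≤ Real.exp R →
      (∀ i ≤ N, ‖z i‖ ≤ r) ∧ ∃ (V : ℕ → ℂ) (a₁ a₂ b₁ b₂ : ℝ), V 0 = 0 ∧ V N ≠ 0 ∧
      HasJet (fun s => chainEnergy N (fun x => u x t) (moveChain z V s)) a₁ b₁ ∧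
      HasJet (fun s => chainEnergy N (fun x => u x t) (moveChain z (fun i => Complex.I * V i) s))
        a₂ b₂ ∧
      b₁ + b₂ ≤ u (z N) t * ‖V N‖ ^ 2 *
        (chainEnergySpeed u N t z + C * (1 + chainEnergy N (fun x => u x t) z)) ∧
      a₁ ^ 2 + a₂ ^ 2 ≤ u (z N) t * ‖V N‖ ^ 2 *
        (C * (1 + chainEnergy N (fun x => u x t) z) ^ 2))
    {x : ℕ → ℂ} (hx0 : x 0 = 0)
    (hx : Real.log (1 + chainEnergy N (fun w => u w t₂) x) ≤ R / 2) :
    barrierGap u N t₁ (8 * C / R) R x t₂ ≤ 0 := by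
  by_contra! hgap
  have hR0 : 0 < R := by linarith
  set κ := 8 * C / R with hκ
  have hκ0 : 0 < κ := by positivity
  have hI : ∀ t ∈ Icc t₁ t₂, t ∈ Ioo 0 T := fun t ht => ⟨h₁.trans_le ht.1, ht.2.trans_lt h₂⟩
  obtain ⟨Q, hQ0, hQ⟩ := exists_speed_bound hpos hsmooth h₁ h₂ r
  set δ := min (t₂ - t₁) (1 / (Q + 1)) with hδ
  have hδ0 : 0 < δ := lt_min (by linarith) (by positivity)
  set θ := min (1 / 2) (κ / (Q + 1)) with hθ
  have hθ0 : 0 < θ := lt_min (by norm_num) (by positivity)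
  have hθ1 : θ ≤ 1 / 2 := min_le_left _ _
  have hJ : ∀ t ∈ Icc (t₁ + δ) t₂, t ∈ Icc t₁ t₂ := fun t ht => ⟨by linarith [ht.1], ht.2⟩
  set En : (ℕ → ℂ) × ℝ → ℝ := fun p => chainEnergy N (fun x => u x p.2) p.1 with hEn
  have hEn0 : ∀ z, ∀ t ∈ Icc t₁ t₂, 0 ≤ En (z, t) := fun z t ht =>
    chainEnergy_nonneg (fun y => (hpos y t (hI t ht)).le) N z
  have hEc : ContinuousOn En (univ ×ˢ Ioo 0 T) := continuousOn_chainEnergy hsmooth.continuousOn N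
  set B : Set ((ℕ → ℂ) × ℝ) := (Set.pi univ fun i => closedBall (0:ℂ)
    (if 1 ≤ i ∧ i ≤ N then r else 0)) ×ˢ Icc (t₁ + δ) t₂ with hB
  have hBc : IsCompact B := (isCompact_univ_pi fun i => isCompact_closedBall _ _).prod isCompact_Icc
  have hBs : B ⊆ univ ×ˢ Ioo 0 T := prod_mono (subset_univ _) fun t ht => hI t (hJ t ht)
  have hlc : ContinuousOn (fun p => Real.log (1 + En p)) B :=
    (continuousOn_const.add (hEc.mono hBs)).log fun p hp => by
      have := hEn0 p.1 p.2 (hJ _ hp.2)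
      have h : 0 ≤ En p := this
      exact (by linarith : 0 < 1 + En p).ne'
  set D := B ∩ (fun p => Real.log (1 + En p)) ⁻¹' Iic (R * (1 - θ)) with hD
  have hDc : IsCompact D :=
    hBc.of_isClosed_subset (hlc.preimage_isClosed_of_isClosed hBc.isClosed isClosed_Iic)
      inter_subset_left
  have hy : ∀ E, Real.log (1 + E) ≤ R * (1 - θ) → θ ≤ 1 - Real.log (1 + E) / R := by
    intro E hE
    have : Real.log (1 + E) / R ≤ 1 - θ := by rw [div_le_iff₀ hR0]; linarith
    linarith
  set Φ : (ℕ → ℂ) × ℝ → ℝ := fun p => barrierGap u N t₁ κ R p.1 p.2 with hΦ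
  have hΦc : ContinuousOn Φ D := by
    simp only [hΦ, barrierGap, energyBarrier]
    refine ((ContinuousOn.sub ?_ ?_)).sub ?_
    · exact (contDiffOn_logSpeed hpos hsmooth).continuousOn.comp
        (f := fun p : (ℕ → ℂ) × ℝ => (p.1 N, p.2)) (by fun_prop)
        fun p hp => ⟨mem_univ _, (hBs hp.1).2⟩
    · refine continuousOn_const.div (by fun_prop) fun p hp => ?_
      have := hp.1.2.1
      exact (by linarith : 0 < p.2 - t₁).ne'
    · refine continuousOn_const.div
        ((continuousOn_const.sub ((hlc.mono inter_subset_left).div_const R)).pow 2) fun p hp => ?_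
      exact pow_ne_zero 2 (hθ0.trans_le (hy _ hp.2)).ne'
  have hmem : ∀ z : ℕ → ℂ, ∀ t ∈ Icc (t₁ + δ) t₂, z 0 = 0 →
      Real.log (1 + En (z, t)) ≤ R * (1 - θ) → ∃ z', (z', t) ∈ D ∧ Φ (z', t) = Φ (z, t) := by
    intro z t ht hz0 hl
    have hE0 := hEn0 z t (hJ t ht)
    have hE : En (z, t) ≤ Real.exp R := by
      have h1 := (Real.log_le_iff_le_exp (by linarith)).1 hl
      have h2 : Real.exp (R * (1 - θ)) ≤ Real.exp R := Real.exp_le_exp.2 (by nlinarith)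
      linarith
    have hzr := (hvar t (hJ t ht) z hz0 hE).1
    set z' : ℕ → ℂ := fun i => if i ≤ N then z i else 0 with hz'
    have hzz : ∀ i ≤ N, z' i = z i := fun i hi => by simp [hz', hi]
    have hEz : En (z', t) = En (z, t) := chainEnergy_congr hzz
    refine ⟨z', ⟨⟨?_, ht⟩, ?_⟩, ?_⟩
    · intro i _
      rw [mem_closedBall, dist_zero_right]
      change ‖z' i‖ ≤ if 1 ≤ i ∧ i ≤ N then r else 0
      by_cases h : i ≤ N
      · rw [hzz i h]
        by_cases h' : 1 ≤ i
        · simpa [h, h'] using hzr i h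
        · obtain rfl : i = 0 := by omega
          simp [hz0]
      · simp [hz', h]
    · change Real.log (1 + En (z', t)) ≤ _
      rw [hEz]; exact hl
    · simp only [hΦ, barrierGap]
      rw [hzz N le_rfl]
      congr 2
  have ht₂ : t₂ ∈ Icc (t₁ + δ) t₂ := ⟨by linarith [min_le_left (t₂ - t₁) (1 / (Q + 1))], le_rfl⟩
  obtain ⟨x', hx', hxx'⟩ := hmem x t₂ ht₂ hx0 (hx.trans (by nlinarith))
  obtain ⟨⟨z, t⟩, hzD, hmax⟩ := hDc.exists_isMaxOn ⟨_, hx'⟩ hΦc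
  have hΦpos : 0 < Φ (z, t) := by
    refine lt_of_lt_of_le ?_ (hmax hx')
    rw [hxx']; exact hgap
  have htJ : t ∈ Icc (t₁ + δ) t₂ := hzD.1.2
  have hz0 : z 0 = 0 := by
    have := hzD.1.1 0 (mem_univ _)
    simpa using this
  have hMax : ∀ z' : ℕ → ℂ, ∀ t' ∈ Icc (t₁ + δ) t₂, z' 0 = 0 →
      Real.log (1 + En (z', t')) ≤ R * (1 - θ) → Φ (z', t') ≤ Φ (z, t) := by
    intro z' t' ht' hz' hl
    obtain ⟨w, h1, h2⟩ := hmem z' t' ht' hz' hl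
    rw [← h2]
    exact hmax h1
  have hlz : Real.log (1 + En (z, t)) ≤ R * (1 - θ) := hzD.2
  have hE0 := hEn0 z t (hJ t htJ)
  have hE : En (z, t) ≤ Real.exp R := by
    have h1 := (Real.log_le_iff_le_exp (by linarith)).1 hlz
    have h2 : Real.exp (R * (1 - θ)) ≤ Real.exp R := Real.exp_le_exp.2 (by nlinarith)
    linarith
  obtain ⟨hzr, V, a₁, a₂, b₁, b₂, hV0, hVN, J1, J2, hb, ha⟩ := hvar t (hJ t htJ) z hz0 hE
  have hqQ : logSpeed u (z N, t) ≤ Q :=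
    (le_abs_self _).trans (hQ t (hJ t htJ) _ (by simpa using hzr N le_rfl))
  have hgap' : 0 < logSpeed u (z N, t) - 1 / (t - t₁) -
      κ / (1 - Real.log (1 + En (z, t)) / R) ^ 2 :=
    hΦpos
  have hyz := hy _ hlz
  have htt : t₁ + δ < t := by
    by_contra! hle
    have h1 : t - t₁ ≤ 1 / (Q + 1) := by linarith [min_le_right (t₂ - t₁) (1 / (Q + 1))]
    have h2 : 0 < t - t₁ := by linarith [htJ.1]
    have h3 : Q + 1 ≤ 1 / (t - t₁) := by
      rw [le_div_iff₀ h2]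
      rw [le_div_iff₀ (by linarith)] at h1
      linarith
    have h4 : 0 < κ / (1 - Real.log (1 + En (z, t)) / R) ^ 2 :=
      div_pos hκ0 (pow_pos (hθ0.trans_le hyz) 2)
    linarith
  have hlt : Real.log (1 + En (z, t)) < R * (1 - θ) := by
    refine hlz.lt_of_ne fun heq => ?_
    have h1 : 1 - Real.log (1 + En (z, t)) / R = θ := by rw [heq]; field_simp; ring
    rw [h1] at hgap'
    have h2 : Q + 1 ≤ κ / θ ^ 2 := by
      rw [le_div_iff₀ (by positivity)]
      have h3 : θ ≤ κ / (Q + 1) := min_le_right _ _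
      rw [le_div_iff₀ (by linarith)] at h3
      nlinarith
    have h4 : 0 < 1 / (t - t₁) := by have := htJ.1; exact one_div_pos.2 (by linarith)
    linarith
  have hmove : ∀ (W : ℕ → ℂ) (a b : ℝ), W 0 = 0 →
      HasJet (fun s => chainEnergy N (fun x => u x t) (moveChain z W s)) a b →
      ∀ᶠ s in nhds 0, barrierGap u N t₁ κ R (moveChain z W s) t ≤ barrierGap u N t₁ κ R z t := by
    intro W a b hW J
    have h0 : moveChain z W 0 = z := by funext i; simp [moveChain]
    have hc : ContinuousAt (fun s : ℝ => Real.log (1 + En (moveChain z W s, t))) 0 := by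
      refine ContinuousAt.log (continuousAt_const.add J.continuousAt) ?_
      rw [h0]
      exact (by linarith : 0 < 1 + En (z, t)).ne'
    filter_upwards [hc.eventually (gt_mem_nhds (show Real.log (1 + En (moveChain z W 0, t)) <
      R * (1 - θ) by rw [h0]; exact hlt))] with s hs
    exact hMax _ t htJ (by simp [hz0, hW]) hs.le
  have htI := hI t (hJ t htJ)
  refine absurd (barrierGap_nonpos_of_max hpos hsmooth hlfde h₁ (by linarith) htI.2
      hC hR hVN J1 J2 hb
    ha ?_ ?_ (hmove V a₁ b₁ hV0 J1) (hmove _ a₂ b₂ (by simp [hV0]) J2)) (not_le.2 hΦpos)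
  · refine hlt.trans ?_
    nlinarith
  · have hc : ContinuousAt (fun s : ℝ => Real.log (1 + En (z, s))) t := by
      refine ContinuousAt.log (continuousAt_const.add
        (hasDerivAt_chainEnergy hpos hsmooth htI N z).continuousAt) ?_
      exact (by linarith : 0 < 1 + En (z, t)).ne'
    filter_upwards [mem_nhdsWithin_of_mem_nhds (hc.eventually (gt_mem_nhds hlt)),
      mem_nhdsWithin_of_mem_nhds (lt_mem_nhds htt), self_mem_nhdsWithin] with s hs hs1 hs2
    exact hMax z s ⟨hs1.le, (le_of_lt hs2).trans htJ.2⟩ hz0 hs.le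

theorem logSpeed_le_of_lt (hpos : ∀ z, ∀ t ∈ Ioo 0 T, 0 < u z t)
    (hsmooth : ContDiffOn ℝ (⊤ : ℕ∞) (fun p : ℂ × ℝ => u p.1 p.2) (univ ×ˢ Ioo 0 T))
    (hlfde : ∀ z, ∀ t ∈ Ioo 0 T, deriv (u z) t = lap (fun w => Real.log (u w t)) z)
    (hcomplete : ∀ t ∈ Ioo (0:ℝ) T, ConfComplete (fun z => u z t) univ)
    {t₁ t : ℝ} (h₁ : 0 < t₁) (h₁₂ : t₁ < t) (h₂ : t < T) (x : ℂ) :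
    logSpeed u (x, t) ≤ 1 / (t - t₁) := by
  have htI : t ∈ Ioo 0 T := ⟨h₁.trans h₁₂, h₂⟩
  obtain ⟨C, hC, hvar⟩ := chain_variation hpos hsmooth hlfde hcomplete h₁ h₂
  obtain ⟨U, hU⟩ := (isCompact_closedBall (0:ℂ) ‖x‖).exists_bound_of_continuousOn
    (continuous_slice hsmooth.continuousOn htI).continuousOn
  have hU0 : 0 ≤ U := (norm_nonneg _).trans (hU 0 (by simp))
  set B := U * ‖x‖ ^ 2
  have hB : 0 ≤ B := by positivity
  have hlB : 0 ≤ Real.log (1 + B) := Real.log_nonneg (by linarith)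
  have key : ∀ R : ℝ, 1 + 2 * Real.log (1 + B) ≤ R →
      logSpeed u (x, t) - 1 / (t - t₁) ≤ 32 * C / R := by
    intro R hR
    have hR0 : 0 < R := by linarith
    obtain ⟨r, N₀, hN⟩ := hvar (Real.exp R)
    set N := N₀ + 1
    have hN0 : (0:ℝ) < N := by positivity
    set y : ℕ → ℂ := fun i => ((i / N : ℝ) : ℂ) * x with hy
    have hE : chainEnergy N (fun w => u w t) y ≤ B := by
      have hs : ∀ i ∈ Finset.range N, u (y i) t * ‖y (i + 1) - y i‖ ^ 2 ≤ U * (‖x‖ / N) ^ 2 := by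
        intro i hi
        have hi' : (i:ℝ) ≤ N := by exact_mod_cast (Finset.mem_range.1 hi).le
        have e1 : ‖y (i + 1) - y i‖ = ‖x‖ / N := by
          rw [hy]
          beta_reduce
          rw [← sub_mul, ← Complex.ofReal_sub, norm_mul, Complex.norm_real, Real.norm_eq_abs,
            show ((i + 1 : ℕ) : ℝ) / N - i / N = 1 / N by push_cast; ring,
                abs_of_pos (by positivity)]
          ring
        rw [e1]
        refine mul_le_mul_of_nonneg_right ((le_abs_self _).trans (hU _ ?_)) (sq_nonneg _)
        rw [mem_closedBall, dist_zero_right, hy]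
        beta_reduce
        rw [norm_mul, Complex.norm_real, Real.norm_eq_abs, abs_of_nonneg (by positivity)]
        exact mul_le_of_le_one_left (norm_nonneg _) ((div_le_one hN0).2 hi')
      refine (mul_le_mul_of_nonneg_left (Finset.sum_le_sum hs) hN0.le).trans_eq ?_
      rw [Finset.sum_const, Finset.card_range, nsmul_eq_mul]
      field_simp
      rfl
    have hE0 := chainEnergy_nonneg (fun w => (hpos w t htI).le) N y
    have hlog : Real.log (1 + chainEnergy N (fun w => u w t) y) ≤ Real.log (1 + B) :=
      Real.log_le_log (by linarith) (by linarith)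
    have hg := barrierGap_nonpos hpos hsmooth hlfde h₁ h₁₂ h₂ hC (by linarith)
      (hN N (Nat.le_succ _)) (x := y) (by simp [hy]) (by linarith)
    have hyN : y N = x := by simp [hy]
    rw [barrierGap, hyN, energyBarrier] at hg
    set L := Real.log (1 + chainEnergy N (fun w => u w t) y)
    have hL : 1 / 2 ≤ 1 - L / R := by
      have : L / R ≤ 1 / 2 := by rw [div_le_iff₀ hR0]; linarith
      linarith
    have hb : 8 * C / R / (1 - L / R) ^ 2 ≤ 8 * C / R / (1 / 2) ^ 2 := by gcongr
    have e : 8 * C / R / (1 / 2) ^ 2 = 32 * C / R := by ring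
    linarith
  by_contra! hlt
  have hd : 0 < logSpeed u (x, t) - 1 / (t - t₁) := by linarith
  set d := logSpeed u (x, t) - 1 / (t - t₁)
  have h := key (1 + 2 * Real.log (1 + B) + 32 * C / d) (by
    have : 0 < 32 * C / d := by positivity
    linarith)
  have hp : 0 < 32 * C / d := by positivity
  rw [le_div_iff₀ (by positivity)] at h
  have e : d * (32 * C / d) = 32 * C := by field_simp
  nlinarith

theorem logSpeed_le (hpos : ∀ z, ∀ t ∈ Ioo 0 T, 0 < u z t)
    (hsmooth : ContDiffOn ℝ (⊤ : ℕ∞) (fun p : ℂ × ℝ => u p.1 p.2) (univ ×ˢ Ioo 0 T))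
    (hlfde : ∀ z, ∀ t ∈ Ioo 0 T, deriv (u z) t = lap (fun w => Real.log (u w t)) z)
    (hcomplete : ∀ t ∈ Ioo (0:ℝ) T, ConfComplete (fun z => u z t) univ)
    {t : ℝ} (ht : t ∈ Ioo 0 T) (x : ℂ) : logSpeed u (x, t) ≤ 1 / t := by
  have h : Tendsto (fun s : ℝ => 1 / (t - s)) (nhdsWithin 0 (Ioi 0)) (nhds (1 / (t - 0))) := by
    refine ContinuousAt.continuousWithinAt ?_
    exact continuousAt_const.div (by fun_prop) (by simpa using ht.1.ne')
  rw [sub_zero] at h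
  refine ge_of_tendsto h ?_
  filter_upwards [Ioo_mem_nhdsGT ht.1] with s hs
  exact logSpeed_le_of_lt hpos hsmooth hlfde hcomplete hs.1 hs.2 ht.2 x

/-- Monotonicity of `u(z,t)/t` for complete solutions. -/
theorem antitoneOn_factor_div (hpos : ∀ z, ∀ t ∈ Ioo 0 T, 0 < u z t)
    (hsmooth : ContDiffOn ℝ (⊤ : ℕ∞) (fun p : ℂ × ℝ => u p.1 p.2) (univ ×ˢ Ioo 0 T))
    (hlfde : ∀ z, ∀ t ∈ Ioo 0 T, deriv (u z) t = lap (fun w => Real.log (u w t)) z)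
    (hcomplete : ∀ t ∈ Ioo (0:ℝ) T, ConfComplete (fun z => u z t) univ) (z : ℂ) :
    AntitoneOn (fun t => u z t / t) (Ioo 0 T) := by
  have hd : ∀ t ∈ Ioo 0 T, HasDerivAt (fun t => u z t / t)
      ((u z t * logSpeed u (z, t) * t - u z t * 1) / t ^ 2) t := fun t ht =>
    (hasDerivAt_factor hpos hsmooth ht z).div (hasDerivAt_id t) ht.1.ne'
  refine antitoneOn_of_deriv_nonpos (convex_Ioo 0 T)
    (fun t ht => (hd t ht).continuousAt.continuousWithinAt)
    (fun t ht => (hd t (interior_subset ht)).differentiableAt.differentiableWithinAt)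
    fun t ht => ?_
  have ht' := interior_subset ht
  rw [(hd t ht').deriv]
  refine div_nonpos_of_nonpos_of_nonneg ?_ (sq_nonneg _)
  have h := logSpeed_le hpos hsmooth hlfde hcomplete ht' z
  rw [le_div_iff₀ ht'.1] at h
  have := mul_le_mul_of_nonneg_left h (hpos z t ht').le
  linarith

end

/-- A smooth decreasing cutoff of the variable `s = |ζ|²`, supported in `s ≤ d²`. -/
noncomputable def sqCut (d s : ℝ) : ℝ := Real.smoothTransition (2 - 2 * s / d ^ 2)

section
variable {d : ℝ}

theorem contDiff_sqCut (d : ℝ) {n : ℕ∞} : ContDiff ℝ n (sqCut d) :=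
  Real.smoothTransition.contDiff.comp (by fun_prop)

theorem sqCut_nonneg (d s : ℝ) : 0 ≤ sqCut d s := Real.smoothTransition.nonneg _

theorem sqCut_le_one (d s : ℝ) : sqCut d s ≤ 1 := Real.smoothTransition.le_one _

theorem sqCut_of_le (hd : 0 < d) {s : ℝ} (hs : s ≤ d ^ 2 / 2) : sqCut d s = 1 := by
  refine Real.smoothTransition.one_of_one_le ?_
  have : 2 * s / d ^ 2 ≤ 1 := by rw [div_le_one (by positivity)]; linarith
  linarith

theorem sqCut_of_ge (hd : 0 < d) {s : ℝ} (hs : d ^ 2 ≤ s) : sqCut d s = 0 := by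
  refine Real.smoothTransition.zero_of_nonpos ?_
  have : 2 ≤ 2 * s / d ^ 2 := by rw [le_div_iff₀ (by positivity)]; linarith
  linarith

theorem sqCut_pos (hd : 0 < d) {s : ℝ} (hs : s < d ^ 2) : 0 < sqCut d s := by
  refine Real.smoothTransition.pos_of_pos ?_
  have : 2 * s / d ^ 2 < 2 := by rw [div_lt_iff₀ (by positivity)]; linarith
  linarith

theorem antitone_sqCut (d : ℝ) : Antitone (sqCut d) := fun s t h =>
  Real.smoothTransition.monotone (by
    have : 2 * s / d ^ 2 ≤ 2 * t / d ^ 2 := by gcongr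
    linarith)

theorem hasDerivAt_sqCut (d s : ℝ) : HasDerivAt (sqCut d) (deriv (sqCut d) s) s :=
  ((contDiff_sqCut d (n := 1)).differentiable one_ne_zero s).hasDerivAt

theorem contDiff_deriv_sqCut (d : ℝ) {n : ℕ∞} : ContDiff ℝ n (deriv (sqCut d)) := by
  have h := (contDiff_sqCut d (n := ⊤)).iterate_deriv 1
  exact ContDiff.of_le h (by exact_mod_cast le_top)

theorem deriv_sqCut_nonpos (d s : ℝ) : deriv (sqCut d) s ≤ 0 := (antitone_sqCut d).deriv_nonpos

theorem deriv_sqCut_of_lt (hd : 0 < d) {s : ℝ} (hs : s < d ^ 2 / 2) : deriv (sqCut d) s = 0 := by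
  have : sqCut d =ᶠ[nhds s] fun _ => 1 := by
    filter_upwards [gt_mem_nhds hs] with x hx using sqCut_of_le hd hx.le
  rw [this.deriv_eq, deriv_const]

theorem deriv_sqCut_of_ge (hd : 0 < d) {s : ℝ} (hs : d ^ 2 ≤ s) : deriv (sqCut d) s = 0 := by
  have h : IsLocalMin (sqCut d) s :=
    Eventually.of_forall fun x => by rw [sqCut_of_ge hd hs]; exact sqCut_nonneg d x
  exact h.deriv_eq_zero

theorem exists_deriv_sqCut_bound (hd : 0 < d) : ∃ C, 0 < C ∧ ∀ s, |deriv (sqCut d) s| ≤ C := by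
  obtain ⟨C, hC⟩ := (isCompact_Icc (a := 0) (b := d ^ 2)).exists_bound_of_continuousOn
    (contDiff_deriv_sqCut d (n := 0)).continuous.continuousOn
  refine ⟨max C 1, by positivity, fun s => ?_⟩
  by_cases h1 : s < 0
  · rw [deriv_sqCut_of_lt hd (h1.trans (by positivity))]; simp
  · by_cases h2 : d ^ 2 ≤ s
    · rw [deriv_sqCut_of_ge hd h2]; simp
    · push Not at h1 h2
      exact (hC s ⟨h1, h2.le⟩).trans (le_max_left _ _)

/-- The truncated logarithm `-∫_s^{d²} sqCut d σ / σ dσ`. -/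
noncomputable def cutLog (d s : ℝ) : ℝ := -∫ σ in s..d ^ 2, sqCut d σ / σ

theorem intervalIntegrable_cutLog (d : ℝ) {a b : ℝ} (ha : 0 < a) (hb : 0 < b) :
    IntervalIntegrable (fun σ => sqCut d σ / σ) volume a b := by
  refine ContinuousOn.intervalIntegrable ?_
  refine (contDiff_sqCut d (n := 0)).continuous.continuousOn.div continuousOn_id fun x hx => ?_
  have h := uIcc_subset_Icc (⟨min_le_left a b, le_max_left a b⟩ : a ∈ Icc (min a b) (max a b))
    ⟨min_le_right a b, le_max_right a b⟩ hx
  exact ((lt_min ha hb).trans_le h.1).ne'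

theorem hasDerivAt_cutLog (hd : 0 < d) {s : ℝ} (hs : 0 < s) :
    HasDerivAt (cutLog d) (sqCut d s / s) s := by
  have hc : ∀ x : ℝ, 0 < x → ContinuousAt (fun σ => sqCut d σ / σ) x := fun x hx =>
    (contDiff_sqCut d (n := 0)).continuous.continuousAt.div continuousAt_id hx.ne'
  have h := intervalIntegral.integral_hasDerivAt_left
    (intervalIntegrable_cutLog d hs (by positivity : 0 < d ^ 2))
    (ContinuousAt.stronglyMeasurableAtFilter isOpen_Ioi (fun x hx => hc x hx) s hs) (hc s hs)
  exact h.neg.congr_deriv (neg_neg _)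

theorem hasDerivAt_sqCut_div (d : ℝ) {s : ℝ} (hs : 0 < s) :
    HasDerivAt (fun s => sqCut d s / s) (deriv (sqCut d) s / s - sqCut d s / s ^ 2) s :=
  ((hasDerivAt_sqCut d s).div (hasDerivAt_id s) hs.ne').congr_deriv (by
    simp only [id]; field_simp)

theorem contDiffOn_cutLog (hd : 0 < d) : ContDiffOn ℝ (⊤ : ℕ∞) (cutLog d) (Ioi 0) := by
  rw [contDiffOn_infty_iff_deriv_of_isOpen isOpen_Ioi]
  refine ⟨fun s hs => (hasDerivAt_cutLog hd hs).differentiableAt.differentiableWithinAt, ?_⟩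
  refine ContDiffOn.congr (f := fun s => sqCut d s / s) ?_
      fun s hs => (hasDerivAt_cutLog hd hs).deriv
  exact (contDiff_sqCut d (n := ⊤)).contDiffOn.div contDiffOn_id fun x hx => ne_of_gt hx

theorem cutLog_of_ge (hd : 0 < d) {s : ℝ} (hs : d ^ 2 ≤ s) : cutLog d s = 0 := by
  rw [cutLog, intervalIntegral.integral_symm, neg_neg]
  refine (intervalIntegral.integral_congr (g := fun _ => 0) fun x hx => ?_).trans (by simp)
  rw [uIcc_of_le hs] at hx
  simp [sqCut_of_ge hd hx.1]

theorem cutLog_neg (hd : 0 < d) {s : ℝ} (hs : 0 < s) (hsd : s < d ^ 2) : cutLog d s < 0 := by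
  rw [cutLog, neg_neg_iff_pos]
  refine intervalIntegral.intervalIntegral_pos_of_pos_on
    (intervalIntegrable_cutLog d hs (by positivity)) (fun x hx => ?_) hsd
  exact div_pos (sqCut_pos hd hx.2) (hs.trans hx.1)

theorem cutLog_nonpos (hd : 0 < d) {s : ℝ} (hs : 0 < s) : cutLog d s ≤ 0 := by
  rcases lt_or_ge s (d ^ 2) with h | h
  · exact (cutLog_neg hd hs h).le
  · exact (cutLog_of_ge hd h).le

theorem abs_cutLog_le (hd : 0 < d) {s : ℝ} (hs : 0 < s) : |cutLog d s| ≤ 2 * d / √s := by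
  rw [abs_of_nonpos (cutLog_nonpos hd hs)]
  rcases lt_or_ge s (d ^ 2) with h | h
  · rw [cutLog, neg_neg]
    have h1 : ∫ σ in s..d ^ 2, sqCut d σ / σ ≤ ∫ σ in s..d ^ 2, 1 / σ := by
      refine intervalIntegral.integral_mono_on h.le
        (intervalIntegrable_cutLog d hs (by positivity)) ?_ fun x hx => ?_
      · refine intervalIntegral.intervalIntegrable_one_div (fun x hx => ?_) continuousOn_id
        rw [uIcc_of_le h.le] at hx
        exact (hs.trans_le hx.1).ne'
      · have := hs.trans_le hx.1
        gcongr
        exact sqCut_le_one _ _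
    rw [integral_one_div_of_pos hs (by positivity)] at h1
    refine h1.trans ?_
    have h2 : d ^ 2 / s = (d / √s) ^ 2 := by rw [div_pow, Real.sq_sqrt hs.le]
    rw [h2, Real.log_pow]
    have h3 : 0 < d / √s := by positivity
    have := Real.log_le_sub_one_of_pos h3
    push_cast
    rw [mul_div_assoc]
    linarith
  · rw [cutLog_of_ge hd h, neg_zero]
    positivity

end

theorem lap_eq_fderiv {f : ℂ → ℝ} (hf : ContDiff ℝ 2 f) (z : ℂ) :
    lap f z = fderiv ℝ (fun w => fderiv ℝ f w 1) z 1 +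
      fderiv ℝ (fun w => fderiv ℝ f w Complex.I) z Complex.I := by
  have h1 : Differentiable ℝ (fderiv ℝ f) :=
    (hf.fderiv_right (m := 1) (by norm_num)).differentiable one_ne_zero
  rw [lap, iteratedFDeriv_two_apply, iteratedFDeriv_two_apply,
    fderiv_clm_apply (h1 z) (differentiableAt_const _),
      fderiv_clm_apply (h1 z) (differentiableAt_const _)]
  simp

theorem lap_congr {f g : ℂ → ℝ} {z : ℂ} (h : f =ᶠ[nhds z] g) : lap f z = lap g z := by
  rw [lap, lap, (h.iteratedFDeriv ℝ 2).eq_of_nhds]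

theorem lap_comp_add_left (f : ℂ → ℝ) (a z : ℂ) : lap (fun w => f (a + w)) z = lap f (a + z) := by
  simp only [lap, iteratedFDeriv_comp_add_left]

theorem continuous_lap {f : ℂ → ℝ} (hf : ContDiff ℝ 2 f) : Continuous (lap f) := by
  have h : ∀ v : Fin 2 → ℂ, Continuous fun z => iteratedFDeriv ℝ 2 f z v := fun v =>
    (ContinuousMultilinearMap.apply ℝ (fun _ : Fin 2 => ℂ) ℝ v).continuous.comp
      (hf.continuous_iteratedFDeriv le_rfl)
  exact (h _).add (h _)

/-- Green's identity for a compactly supported function. -/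
theorem integral_mul_lap {κ f : ℂ → ℝ} (hκ : ContDiff ℝ 2 κ) (hc : HasCompactSupport κ)
    (hf : ContDiff ℝ 2 f) : ∫ z, κ z * lap f z = ∫ z, lap κ z * f z := by
  have hκ1 : ∀ V, ContDiff ℝ 1 fun w => fderiv ℝ κ w V := fun V =>
    (hκ.fderiv_right (m := 1) (by norm_num)).clm_apply contDiff_const
  have hf1 : ∀ V, ContDiff ℝ 1 fun w => fderiv ℝ f w V := fun V =>
    (hf.fderiv_right (m := 1) (by norm_num)).clm_apply contDiff_const
  have hκ2 : ∀ V, Continuous fun w => fderiv ℝ (fun w => fderiv ℝ κ w V) w V := fun V =>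
    ((hκ1 V).continuous_fderiv one_ne_zero).clm_apply continuous_const
  have hf2 : ∀ V, Continuous fun w => fderiv ℝ (fun w => fderiv ℝ f w V) w V := fun V =>
    ((hf1 V).continuous_fderiv one_ne_zero).clm_apply continuous_const
  have hc1 : ∀ V, HasCompactSupport fun w => fderiv ℝ κ w V := fun V => hc.fderiv_apply ℝ V
  have hc2 : ∀ V, HasCompactSupport fun w => fderiv ℝ (fun w => fderiv ℝ κ w V) w V := fun V =>
    (hc1 V).fderiv_apply ℝ V
  have hI : ∀ {a b : ℂ → ℝ}, Continuous a → HasCompactSupport a → Continuous b →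
      Integrable fun z => a z * b z := fun ha hca hb =>
    (ha.mul hb).integrable_of_hasCompactSupport hca.mul_right
  have key : ∀ V : ℂ, ∫ z, κ z * fderiv ℝ (fun w => fderiv ℝ f w V) z V =
      ∫ z, fderiv ℝ (fun w => fderiv ℝ κ w V) z V * f z := by
    intro V
    rw [integral_mul_fderiv_eq_neg_fderiv_mul_of_integrable
      (hI (hκ1 V).continuous (hc1 V) (hf1 V).continuous) (hI hκ.continuous hc (hf2 V))
      (hI hκ.continuous hc (hf1 V).continuous)
      (fun x _ => hκ.differentiable two_ne_zero x)
      (fun x _ => (hf1 V).differentiable one_ne_zero x),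
      integral_mul_fderiv_eq_neg_fderiv_mul_of_integrable
      (f := fun z => fderiv ℝ κ z V) (g := f)
      (hI (hκ2 V) (hc2 V) hf.continuous) (hI (hκ1 V).continuous (hc1 V) (hf1 V).continuous)
      (hI (hκ1 V).continuous (hc1 V) hf.continuous)
      (fun x _ => (hκ1 V).differentiable one_ne_zero x)
      (fun x _ => hf.differentiable two_ne_zero x), neg_neg]
  simp_rw [lap_eq_fderiv hf, lap_eq_fderiv hκ, mul_add, add_mul]
  rw [integral_add (hI hκ.continuous hc (hf2 1)) (hI hκ.continuous hc (hf2 Complex.I)),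
    integral_add (hI (hκ2 1) (hc2 1) hf.continuous)
      (hI (hκ2 Complex.I) (hc2 Complex.I) hf.continuous), key, key]

theorem hasFDerivAt_radial {G : ℝ → ℝ} {g ε : ℝ} {ζ : ℂ} (h : HasDerivAt G g (‖ζ‖ ^ 2 + ε)) :
    HasFDerivAt (fun w : ℂ => G (‖w‖ ^ 2 + ε)) ((2 * g) • innerSL ℝ ζ) ζ := by
  have h1 := ((hasStrictFDerivAt_norm_sq ζ).hasFDerivAt).add_const ε
  refine (h.comp_hasFDerivAt ζ h1).congr_fderiv ?_
  rw [two_nsmul, ← two_smul ℝ, smul_smul, mul_comm]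

theorem lap_radial {G G₁ : ℝ → ℝ} {g₂ ε : ℝ} {ζ : ℂ}
    (h₁ : ∀ᶠ w : ℂ in nhds ζ, HasDerivAt G (G₁ (‖w‖ ^ 2 + ε)) (‖w‖ ^ 2 + ε))
    (h₂ : HasDerivAt G₁ g₂ (‖ζ‖ ^ 2 + ε)) :
    lap (fun w : ℂ => G (‖w‖ ^ 2 + ε)) ζ = 4 * (‖ζ‖ ^ 2 * g₂ + G₁ (‖ζ‖ ^ 2 + ε)) := by
  have e : fderiv ℝ (fun w : ℂ => G (‖w‖ ^ 2 + ε)) =ᶠ[nhds ζ]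
      fun w => (2 * G₁ (‖w‖ ^ 2 + ε)) • innerSL ℝ w := by
    filter_upwards [h₁] with w hw using (hasFDerivAt_radial hw).fderiv
  have h3 : HasFDerivAt (fun w : ℂ => (2 * G₁ (‖w‖ ^ 2 + ε)) • innerSL ℝ w) _ ζ :=
    ((hasFDerivAt_radial h₂).const_mul 2).smul (innerSL ℝ (E := ℂ)).hasFDerivAt
  rw [lap, iteratedFDeriv_two_apply, iteratedFDeriv_two_apply, e.fderiv_eq, h3.fderiv]
  have h4 : ∀ V : ℂ, innerSL ℝ V V = ‖V‖ ^ 2 := fun V => by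
    rw [innerSL_apply_apply, real_inner_self_eq_norm_sq]
  simp [← Complex.normSq_eq_norm_sq, Complex.normSq_apply, Complex.inner, h4]
  ring

/-- The regularised logarithmic kernel, supported in the disc of radius `d`. -/
noncomputable def logKer (d ε : ℝ) (ζ : ℂ) : ℝ := cutLog d (‖ζ‖ ^ 2 + ε)

/-- The gradient of `logKer`. -/
noncomputable def logKerGrad (d ε : ℝ) (ζ : ℂ) : ℂ →L[ℝ] ℝ :=
  (2 * (sqCut d (‖ζ‖ ^ 2 + ε) / (‖ζ‖ ^ 2 + ε))) • innerSL ℝ ζ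

/-- The smooth part of the Laplacian of `logKer`. -/
noncomputable def resKer (d ε : ℝ) (ζ : ℂ) : ℝ := 4 * deriv (sqCut d) (‖ζ‖ ^ 2 + ε)

/-- The concentrating part of the Laplacian of `logKer`. -/
noncomputable def approxKer (d ε : ℝ) (ζ : ℂ) : ℝ :=
  4 * ε * (sqCut d (‖ζ‖ ^ 2 + ε) / (‖ζ‖ ^ 2 + ε) ^ 2 -
    deriv (sqCut d) (‖ζ‖ ^ 2 + ε) / (‖ζ‖ ^ 2 + ε))

/-- The total mass of the fundamental singularity. -/
noncomputable def poleMass : ℝ := ∫ η : ℂ, 4 / (1 + ‖η‖ ^ 2) ^ 2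

section
variable {d ε : ℝ}

theorem sq_le_of_norm_ge (hd : 0 < d) (hε : 0 ≤ ε) {ζ : ℂ} (h : d ≤ ‖ζ‖) :
    d ^ 2 ≤ ‖ζ‖ ^ 2 + ε := by
  have := pow_le_pow_left₀ hd.le h 2
  linarith

theorem logKer_of_ge (hd : 0 < d) (hε : 0 ≤ ε) {ζ : ℂ} (h : d ≤ ‖ζ‖) : logKer d ε ζ = 0 :=
  cutLog_of_ge hd (sq_le_of_norm_ge hd hε h)

theorem logKerGrad_of_ge (hd : 0 < d) (hε : 0 ≤ ε) {ζ : ℂ} (h : d ≤ ‖ζ‖) :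
    logKerGrad d ε ζ = 0 := by
  rw [logKerGrad, sqCut_of_ge hd (sq_le_of_norm_ge hd hε h)]
  simp

theorem resKer_of_ge (hd : 0 < d) (hε : 0 ≤ ε) {ζ : ℂ} (h : d ≤ ‖ζ‖) : resKer d ε ζ = 0 := by
  rw [resKer, deriv_sqCut_of_ge hd (sq_le_of_norm_ge hd hε h), mul_zero]

theorem approxKer_of_ge (hd : 0 < d) (hε : 0 ≤ ε) {ζ : ℂ} (h : d ≤ ‖ζ‖) : approxKer d ε ζ = 0 := by
  rw [approxKer, deriv_sqCut_of_ge hd (sq_le_of_norm_ge hd hε h),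
    sqCut_of_ge hd (sq_le_of_norm_ge hd hε h)]
  simp

theorem hasCompactSupport_of_norm_ge {E : Type*} [Zero E] {f : ℂ → E}
    (h : ∀ ζ, d ≤ ‖ζ‖ → f ζ = 0) : HasCompactSupport f :=
  HasCompactSupport.intro (isCompact_closedBall 0 d) fun ζ hζ => h ζ (by
    rw [mem_closedBall, dist_zero_right, not_le] at hζ; exact hζ.le)

theorem contDiff_logKer (hd : 0 < d) (hε : 0 < ε) : ContDiff ℝ (⊤ : ℕ∞) (logKer d ε) := by
  rw [← contDiffOn_univ]
  refine (contDiffOn_cutLog hd).comp (f := fun ζ : ℂ => ‖ζ‖ ^ 2 + ε)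
    ((contDiff_norm_sq ℝ).add contDiff_const).contDiffOn fun ζ _ => ?_
  exact mem_Ioi.2 (by positivity)

theorem contDiff_resKer (d ε : ℝ) : ContDiff ℝ (⊤ : ℕ∞) (resKer d ε) :=
  contDiff_const.mul ((contDiff_deriv_sqCut d).comp ((contDiff_norm_sq ℝ).add contDiff_const))

theorem continuous_approxKer (d : ℝ) (hε : 0 < ε) : Continuous (approxKer d ε) := by
  have h1 : Continuous (sqCut d) := (contDiff_sqCut d (n := 0)).continuous
  have h2 : Continuous (deriv (sqCut d)) := (contDiff_deriv_sqCut d (n := 0)).continuous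
  unfold approxKer
  refine continuous_const.mul (((h1.comp (by fun_prop)).div (by fun_prop) fun ζ => ?_).sub
    ((h2.comp (by fun_prop)).div (by fun_prop) fun ζ => ?_)) <;> positivity

theorem hasFDerivAt_logKer (hd : 0 < d) (hε : 0 < ε) (ζ : ℂ) :
    HasFDerivAt (logKer d ε) (logKerGrad d ε ζ) ζ :=
  hasFDerivAt_radial (hasDerivAt_cutLog hd (by positivity))

theorem lap_logKer (hd : 0 < d) (hε : 0 < ε) (ζ : ℂ) :
    lap (logKer d ε) ζ = resKer d ε ζ + approxKer d ε ζ := by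
  have hs : 0 < ‖ζ‖ ^ 2 + ε := by positivity
  rw [show logKer d ε = fun w : ℂ => cutLog d (‖w‖ ^ 2 + ε) from rfl,
    lap_radial (G₁ := fun s => sqCut d s / s)
    (Eventually.of_forall fun w => hasDerivAt_cutLog hd (by positivity))
      (hasDerivAt_sqCut_div d hs),
    resKer, approxKer]
  generalize deriv (sqCut d) (‖ζ‖ ^ 2 + ε) = A
  generalize sqCut d (‖ζ‖ ^ 2 + ε) = B
  have : ‖ζ‖ ^ 2 = (‖ζ‖ ^ 2 + ε) - ε := by ring
  generalize hS : ‖ζ‖ ^ 2 + ε = S at *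
  rw [this]
  field_simp
  ring

theorem approxKer_nonneg (d : ℝ) (hε : 0 < ε) (ζ : ℂ) : 0 ≤ approxKer d ε ζ := by
  have h1 := sqCut_nonneg d (‖ζ‖ ^ 2 + ε)
  have h2 := deriv_sqCut_nonpos d (‖ζ‖ ^ 2 + ε)
  refine mul_nonneg (by positivity) (sub_nonneg.2 (le_trans
    (div_nonpos_of_nonpos_of_nonneg h2 (by positivity)) (by positivity)))

theorem logKer_nonpos (hd : 0 < d) (hε : 0 ≤ ε) {ζ : ℂ} (hζ : ζ ≠ 0) : logKer d ε ζ ≤ 0 :=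
  cutLog_nonpos hd (by positivity)

theorem abs_logKer_le (hd : 0 < d) (hε : 0 ≤ ε) {ζ : ℂ} (hζ : ζ ≠ 0) :
    |logKer d ε ζ| ≤ 2 * d / ‖ζ‖ := by
  refine (abs_cutLog_le hd (by positivity)).trans ?_
  have h : ‖ζ‖ ≤ √(‖ζ‖ ^ 2 + ε) := Real.le_sqrt_of_sq_le (by linarith)
  have : 0 < ‖ζ‖ := norm_pos_iff.2 hζ
  gcongr

theorem norm_logKerGrad_le (d : ℝ) (hε : 0 ≤ ε) (ζ : ℂ) : ‖logKerGrad d ε ζ‖ ≤ 2 / ‖ζ‖ := by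
  rw [logKerGrad, norm_smul, innerSL_apply_norm, Real.norm_eq_abs,
    abs_of_nonneg (mul_nonneg zero_le_two (div_nonneg (sqCut_nonneg _ _) (by positivity)))]
  rcases eq_or_ne ζ 0 with rfl | hζ
  · simp
  have h : 0 < ‖ζ‖ := norm_pos_iff.2 hζ
  have h1 := sqCut_le_one d (‖ζ‖ ^ 2 + ε)
  have h2 : sqCut d (‖ζ‖ ^ 2 + ε) / (‖ζ‖ ^ 2 + ε) ≤ 1 / ‖ζ‖ ^ 2 := by
    have := sqCut_nonneg d (‖ζ‖ ^ 2 + ε)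
    gcongr
    linarith
  calc _ ≤ 2 * (1 / ‖ζ‖ ^ 2) * ‖ζ‖ := by gcongr
    _ = _ := by field_simp

theorem integrable_indicator_div_norm (d C : ℝ) :
    Integrable (fun ζ : ℂ => (closedBall (0:ℂ) d).indicator (fun ζ => C / ‖ζ‖) ζ) := by
  have h := (integrable_fun_norm_addHaar (volume : Measure ℂ)
    (f := fun r : ℝ => (Iic d).indicator (fun r => C / r) r)).2 ?_
  · refine h.congr (Eventually.of_forall fun ζ => ?_)
    simp only [indicator, mem_Iic, mem_closedBall, dist_zero_right]
  · rw [Complex.finrank_real_complex]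
    have h1 : IntegrableOn (fun _ : ℝ => C) (Ioc 0 d) := by simp
    have h2 : IntegrableOn ((Ioc 0 d).indicator fun _ : ℝ => C) (Ioi 0) :=
      (h1.integrable_indicator measurableSet_Ioc).integrableOn
    refine h2.congr_fun (fun r hr => ?_) measurableSet_Ioi
    have hr' : (0:ℝ) < r := hr
    by_cases h : r ≤ d
    · simp [h, hr']
      field_simp
    · simp [h]

theorem ae_ne_zero : ∀ᵐ ζ : ℂ, ζ ≠ 0 := by
  simp [ae_iff]

theorem ae_abs_logKer_le (hd : 0 < d) (hε : 0 ≤ ε) :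
    ∀ᵐ ζ : ℂ, |logKer d ε ζ| ≤ (closedBall (0:ℂ) d).indicator (fun ζ => 2 * d / ‖ζ‖) ζ := by
  filter_upwards [ae_ne_zero] with ζ hζ
  by_cases h : ζ ∈ closedBall (0:ℂ) d
  · rw [indicator_of_mem h]; exact abs_logKer_le hd hε hζ
  · rw [indicator_of_notMem h]
    rw [mem_closedBall, dist_zero_right, not_le] at h
    rw [logKer_of_ge hd hε h.le, abs_zero]

theorem norm_logKerGrad_le_indicator (hd : 0 < d) (hε : 0 ≤ ε) (ζ : ℂ) :
    ‖logKerGrad d ε ζ‖ ≤ (closedBall (0:ℂ) d).indicator (fun ζ => 2 / ‖ζ‖) ζ := by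
  by_cases h : ζ ∈ closedBall (0:ℂ) d
  · rw [indicator_of_mem h]; exact norm_logKerGrad_le d hε ζ
  · rw [indicator_of_notMem h]
    rw [mem_closedBall, dist_zero_right, not_le] at h
    rw [logKerGrad_of_ge hd hε h.le, norm_zero]

theorem tendsto_add_eps (s : ℝ) :
    Tendsto (fun ε : ℝ => s + ε) (nhdsWithin 0 (Ioi 0)) (nhds s) := by
  have : ContinuousAt (fun ε : ℝ => s + ε) 0 := by fun_prop
  have h := this.continuousWithinAt (s := Ioi 0)
  simpa [ContinuousWithinAt] using h

theorem tendsto_logKer (hd : 0 < d) {ζ : ℂ} (hζ : ζ ≠ 0) :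
    Tendsto (fun ε => logKer d ε ζ) (nhdsWithin 0 (Ioi 0)) (nhds (logKer d 0 ζ)) := by
  have h : ContinuousAt (cutLog d) (‖ζ‖ ^ 2 + 0) :=
      (hasDerivAt_cutLog hd (by positivity)).continuousAt
  exact Tendsto.comp h (by simpa using tendsto_add_eps (‖ζ‖ ^ 2))

theorem tendsto_resKer (d : ℝ) (ζ : ℂ) :
    Tendsto (fun ε => resKer d ε ζ) (nhdsWithin 0 (Ioi 0)) (nhds (resKer d 0 ζ)) := by
  have h : ContinuousAt (deriv (sqCut d)) (‖ζ‖ ^ 2 + 0) :=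
    (contDiff_deriv_sqCut d (n := 0)).continuous.continuousAt
  exact (Tendsto.comp h (by simpa using tendsto_add_eps (‖ζ‖ ^ 2))).const_mul 4

theorem tendsto_logKerGrad (d : ℝ) {ζ : ℂ} (hζ : ζ ≠ 0) :
    Tendsto (fun ε => logKerGrad d ε ζ) (nhdsWithin 0 (Ioi 0)) (nhds (logKerGrad d 0 ζ)) := by
  have h : ContinuousAt (fun s => sqCut d s / s) (‖ζ‖ ^ 2 + 0) :=
    (hasDerivAt_sqCut_div d (by positivity)).continuousAt
  exact ((Tendsto.comp h (by simpa using tendsto_add_eps (‖ζ‖ ^ 2))).const_mul 2).smul_const _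

theorem measurable_cutLog (hd : 0 < d) : AEStronglyMeasurable (logKer d 0) := by
  have : ∀ᵐ ζ : ℂ, Tendsto (fun n : ℕ => logKer d (1 / ((n:ℝ) + 1)) ζ)
      atTop (nhds (logKer d 0 ζ)) := by
    filter_upwards [ae_ne_zero] with ζ hζ
    refine (tendsto_logKer hd hζ).comp (tendsto_nhdsWithin_iff.2
      ⟨tendsto_one_div_add_atTop_nhds_zero_nat, Eventually.of_forall fun n => ?_⟩)
    exact mem_Ioi.2 (by positivity)
  exact aestronglyMeasurable_of_tendsto_ae atTop
    (fun n => (contDiff_logKer hd (by positivity)).continuous.aestronglyMeasurable) this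

theorem integrable_logKer (hd : 0 < d) (hε : 0 ≤ ε) : Integrable (logKer d ε) := by
  refine (integrable_indicator_div_norm d (2 * d)).mono' ?_ (ae_abs_logKer_le hd hε)
  rcases hε.eq_or_lt with rfl | h
  · exact measurable_cutLog hd
  · exact (contDiff_logKer hd h).continuous.aestronglyMeasurable

theorem continuous_logKerGrad (d : ℝ) (hε : 0 < ε) : Continuous (logKerGrad d ε) := by
  have h1 : Continuous (sqCut d) := (contDiff_sqCut d (n := 0)).continuous
  unfold logKerGrad
  refine (continuous_const.mul ((h1.comp (by fun_prop)).div (by fun_prop) fun ζ => ?_)).smul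
    (by fun_prop)
  positivity

theorem integrable_logKerGrad (hd : 0 < d) (hε : 0 ≤ ε) : Integrable (logKerGrad d ε) := by
  refine (integrable_indicator_div_norm d 2).mono' ?_
    (Eventually.of_forall (norm_logKerGrad_le_indicator hd hε))
  rcases hε.eq_or_lt with rfl | h
  · refine aestronglyMeasurable_of_tendsto_ae (u := atTop)
      (f := fun n : ℕ => logKerGrad d (1 / ((n:ℝ) + 1)))
      (fun n => (continuous_logKerGrad d (by positivity)).aestronglyMeasurable) ?_
    filter_upwards [ae_ne_zero] with ζ hζ
    refine (tendsto_logKerGrad d hζ).comp (tendsto_nhdsWithin_iff.2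
      ⟨tendsto_one_div_add_atTop_nhds_zero_nat, Eventually.of_forall fun n => ?_⟩)
    exact mem_Ioi.2 (by positivity)
  · exact (continuous_logKerGrad d h).aestronglyMeasurable

theorem tendsto_integral_norm_logKer_sub (hd : 0 < d) :
    Tendsto (fun ε => ∫ ζ, ‖logKer d ε ζ - logKer d 0 ζ‖) (nhdsWithin 0 (Ioi 0)) (nhds 0) := by
  have h := tendsto_integral_filter_of_dominated_convergence (μ := (volume : Measure ℂ))
    (l := nhdsWithin (0:ℝ) (Ioi 0)) (F := fun ε ζ => ‖logKer d ε ζ - logKer d 0 ζ‖)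
      (f := fun _ => 0)
    (fun ζ => (closedBall (0:ℂ) d).indicator (fun ζ => 2 * d / ‖ζ‖) ζ +
      (closedBall (0:ℂ) d).indicator (fun ζ => 2 * d / ‖ζ‖) ζ) ?_ ?_ ?_ ?_
  · simpa using h
  · filter_upwards [self_mem_nhdsWithin] with ε hε
    exact ((integrable_logKer hd (le_of_lt hε)).sub (integrable_logKer hd le_rfl)).1.norm
  · filter_upwards [self_mem_nhdsWithin] with ε hε
    filter_upwards [ae_abs_logKer_le hd (le_of_lt hε), ae_abs_logKer_le hd le_rfl] with ζ h1 h2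
    rw [norm_norm]
    exact (norm_sub_le _ _).trans (add_le_add h1 h2)
  · exact (integrable_indicator_div_norm d _).add (integrable_indicator_div_norm d _)
  · filter_upwards [ae_ne_zero] with ζ hζ
    have := ((tendsto_logKer hd hζ).sub_const (logKer d 0 ζ)).norm
    simpa using this

theorem tendsto_integral_norm_logKerGrad_sub (hd : 0 < d) :
    Tendsto (fun ε => ∫ ζ, ‖logKerGrad d ε ζ - logKerGrad d 0 ζ‖) (nhdsWithin 0 (Ioi 0))
      (nhds 0) := by
  have h := tendsto_integral_filter_of_dominated_convergence (μ := (volume : Measure ℂ))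
    (l := nhdsWithin (0:ℝ) (Ioi 0)) (F := fun ε ζ => ‖logKerGrad d ε ζ - logKerGrad d 0 ζ‖)
    (f := fun _ => 0)
    (fun ζ => (closedBall (0:ℂ) d).indicator (fun ζ => 2 / ‖ζ‖) ζ +
      (closedBall (0:ℂ) d).indicator (fun ζ => 2 / ‖ζ‖) ζ) ?_ ?_ ?_ ?_
  · simpa using h
  · filter_upwards [self_mem_nhdsWithin] with ε hε
    exact ((integrable_logKerGrad hd (le_of_lt hε)).sub (integrable_logKerGrad hd le_rfl)).1.norm
  · filter_upwards [self_mem_nhdsWithin] with ε hε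
    refine Eventually.of_forall fun ζ => ?_
    rw [norm_norm]
    exact (norm_sub_le _ _).trans (add_le_add (norm_logKerGrad_le_indicator hd (le_of_lt hε) ζ)
      (norm_logKerGrad_le_indicator hd le_rfl ζ))
  · exact (integrable_indicator_div_norm d _).add (integrable_indicator_div_norm d _)
  · filter_upwards [ae_ne_zero] with ζ hζ
    have := ((tendsto_logKerGrad d hζ).sub_const (logKerGrad d 0 ζ)).norm
    simpa using this

end

theorem integrable_one_add_norm_sq :
    Integrable (fun η : ℂ => ((1 + ‖η‖ ^ 2) ^ 2)⁻¹) := by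
  have h := integrable_rpow_neg_one_add_norm_sq (E := ℂ) (μ := volume) (r := 4)
    (by rw [Complex.finrank_real_complex]; norm_num)
  refine h.congr (Eventually.of_forall fun η => ?_)
  beta_reduce
  rw [show (-4 / 2 : ℝ) = -((2:ℕ):ℝ) by norm_num, Real.rpow_neg (by positivity), Real.rpow_natCast]

theorem poleMass_pos : 0 < poleMass := by
  have h : Integrable fun η : ℂ => 4 / (1 + ‖η‖ ^ 2) ^ 2 := integrable_one_add_norm_sq.const_mul 4
  refine (integral_pos_iff_support_of_nonneg (fun η => by positivity) h).2 ?_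
  have : Function.support (fun η : ℂ => 4 / (1 + ‖η‖ ^ 2) ^ 2) = univ := by
    refine eq_univ_of_forall fun η => ?_
    rw [Function.mem_support]
    positivity
  rw [this]
  simp

section
variable {d : ℝ}

theorem approxKer_smul (d : ℝ) {r : ℝ} (hr : 0 < r) (η : ℂ) :
    r ^ 2 * approxKer d (r ^ 2) (r • η) = 4 * (sqCut d (r ^ 2 * (1 + ‖η‖ ^ 2)) / (1 + ‖η‖ ^ 2) ^ 2 -
      r ^ 2 * deriv (sqCut d) (r ^ 2 * (1 + ‖η‖ ^ 2)) / (1 + ‖η‖ ^ 2)) := by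
  have e : ‖r • η‖ ^ 2 + r ^ 2 = r ^ 2 * (1 + ‖η‖ ^ 2) := by
    rw [norm_smul, Real.norm_eq_abs, mul_pow, sq_abs]; ring
  rw [approxKer, e]
  field_simp

theorem tendsto_integral_approxKer (hd : 0 < d) {f : ℂ → ℝ} (hf : Continuous f) :
    Tendsto (fun ε => ∫ ζ, approxKer d ε ζ * f ζ) (nhdsWithin 0 (Ioi 0))
      (nhds (poleMass * f 0)) := by
  obtain ⟨M, hM⟩ := (isCompact_closedBall (0:ℂ) d).exists_bound_of_continuousOn hf.continuousOn
  have hM0 : 0 ≤ M := (norm_nonneg _).trans (hM 0 (by simp [hd.le]))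
  obtain ⟨C, hC, hCb⟩ := exists_deriv_sqCut_bound hd
  have key : Tendsto (fun r : ℝ => ∫ η : ℂ, r ^ 2 * approxKer d (r ^ 2) (r • η) * f (r • η))
      (nhdsWithin 0 (Ioi 0)) (nhds (∫ η : ℂ, 4 / (1 + ‖η‖ ^ 2) ^ 2 * f 0)) := by
    refine tendsto_integral_filter_of_dominated_convergence
      (fun η => 4 * (1 + C * d ^ 2) * M * ((1 + ‖η‖ ^ 2) ^ 2)⁻¹) ?_ ?_
      (integrable_one_add_norm_sq.const_mul _) ?_
    · filter_upwards [self_mem_nhdsWithin] with r hr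
      have hr' : (0:ℝ) < r := hr
      exact ((continuous_const.mul ((continuous_approxKer d (by positivity)).comp
        (by fun_prop))).mul (hf.comp (by fun_prop))).aestronglyMeasurable
    · filter_upwards [self_mem_nhdsWithin] with r hr
      have hr' : (0:ℝ) < r := hr
      refine Eventually.of_forall fun η => ?_
      by_cases h : d ≤ ‖r • η‖
      · rw [approxKer_of_ge hd (by positivity) h]
        simp only [mul_zero, zero_mul, norm_zero]
        positivity
      · push Not at h
        rw [norm_mul, approxKer_smul d hr']
        have h1 : ‖f (r • η)‖ ≤ M := hM _ (by rw [mem_closedBall, dist_zero_right]; exact h.le)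
        have h2 : |4 * (sqCut d (r ^ 2 * (1 + ‖η‖ ^ 2)) / (1 + ‖η‖ ^ 2) ^ 2 -
            r ^ 2 * deriv (sqCut d) (r ^ 2 * (1 + ‖η‖ ^ 2)) / (1 + ‖η‖ ^ 2))| ≤
            4 * (1 + C * d ^ 2) * ((1 + ‖η‖ ^ 2) ^ 2)⁻¹ := by
          have h3 : |sqCut d (r ^ 2 * (1 + ‖η‖ ^ 2)) / (1 + ‖η‖ ^ 2) ^ 2| ≤
              1 * ((1 + ‖η‖ ^ 2) ^ 2)⁻¹ := by
            rw [abs_of_nonneg (div_nonneg (sqCut_nonneg _ _) (by positivity)), div_eq_mul_inv]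
            gcongr
            exact sqCut_le_one _ _
          have h4 : |r ^ 2 * deriv (sqCut d) (r ^ 2 * (1 + ‖η‖ ^ 2)) / (1 + ‖η‖ ^ 2)| ≤
              C * d ^ 2 * ((1 + ‖η‖ ^ 2) ^ 2)⁻¹ := by
            by_cases h5 : d ^ 2 ≤ r ^ 2 * (1 + ‖η‖ ^ 2)
            · rw [deriv_sqCut_of_ge hd h5]
              simp only [mul_zero, zero_div, abs_zero]
              positivity
            · push Not at h5
              rw [abs_div, abs_mul, abs_of_nonneg (sq_nonneg r),
                abs_of_nonneg (by positivity : 0 ≤ 1 + ‖η‖ ^ 2), ← div_eq_mul_inv,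
                div_le_div_iff₀ (by positivity) (by positivity)]
              have h6 := hCb (r ^ 2 * (1 + ‖η‖ ^ 2))
              calc _ = |deriv (sqCut d) (r ^ 2 * (1 + ‖η‖ ^ 2))| * (r ^ 2 * (1 + ‖η‖ ^ 2))
                    * (1 + ‖η‖ ^ 2) := by ring
                _ ≤ C * d ^ 2 * (1 + ‖η‖ ^ 2) := by gcongr
          rw [abs_mul, abs_of_pos (by norm_num : (0:ℝ) < 4)]
          have := (abs_sub _ _).trans (add_le_add h3 h4)
          calc _ ≤ 4 * (1 * ((1 + ‖η‖ ^ 2) ^ 2)⁻¹ + C * d ^ 2 * ((1 + ‖η‖ ^ 2) ^ 2)⁻¹) := by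
                gcongr
            _ = _ := by ring
        calc _ ≤ 4 * (1 + C * d ^ 2) * ((1 + ‖η‖ ^ 2) ^ 2)⁻¹ * M := by
              gcongr
              exact h2
          _ = _ := by ring
    · refine Eventually.of_forall fun η => ?_
      have hc : ContinuousAt (fun r : ℝ => r ^ 2 * (1 + ‖η‖ ^ 2)) 0 := by fun_prop
      have h1 : ∀ᶠ r in nhdsWithin (0:ℝ) (Ioi 0), r ^ 2 * (1 + ‖η‖ ^ 2) < d ^ 2 / 2 :=
        mem_nhdsWithin_of_mem_nhds (hc.eventually (gt_mem_nhds (by simp; positivity)))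
      have h2 : Tendsto (fun r : ℝ => 4 / (1 + ‖η‖ ^ 2) ^ 2 * f (r • η)) (nhdsWithin 0 (Ioi 0))
          (nhds (4 / (1 + ‖η‖ ^ 2) ^ 2 * f 0)) := by
        have : ContinuousAt (fun r : ℝ => 4 / (1 + ‖η‖ ^ 2) ^ 2 * f (r • η)) 0 := by fun_prop
        simpa [ContinuousWithinAt] using this.continuousWithinAt (s := Ioi 0)
      refine h2.congr' ?_
      filter_upwards [h1, self_mem_nhdsWithin] with r hr hr0
      rw [approxKer_smul d hr0, sqCut_of_le hd hr.le, deriv_sqCut_of_lt hd hr]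
      ring
  rw [integral_mul_const] at key
  have hs : Tendsto (fun ε : ℝ => √ε) (nhdsWithin 0 (Ioi 0)) (nhdsWithin 0 (Ioi 0)) := by
    refine tendsto_nhdsWithin_iff.2 ⟨?_, ?_⟩
    · simpa [ContinuousWithinAt] using Real.continuous_sqrt.continuousWithinAt (s := Ioi 0) (x := 0)
    · filter_upwards [self_mem_nhdsWithin] with ε hε using Real.sqrt_pos.2 hε
  refine (key.comp hs).congr' ?_
  filter_upwards [self_mem_nhdsWithin] with ε hε
  have hε' : (0:ℝ) < √ε := Real.sqrt_pos.2 hε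
  have h := Measure.integral_comp_smul (volume : Measure ℂ)
    (fun ζ => approxKer d ε ζ * f ζ) (√ε)
  rw [Complex.finrank_real_complex, Real.sq_sqrt (le_of_lt hε), smul_eq_mul,
    abs_of_pos (inv_pos.2 hε)] at h
  simp only [Function.comp, Real.sq_sqrt (le_of_lt hε), mul_assoc]
  rw [integral_const_mul, h, mul_inv_cancel_left₀ (ne_of_gt hε)]

theorem tendsto_integral_logKer (hd : 0 < d) {f : ℂ → ℝ} (hf : Continuous f) :
    Tendsto (fun ε => ∫ ζ, logKer d ε ζ * f ζ) (nhdsWithin 0 (Ioi 0))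
      (nhds (∫ ζ, logKer d 0 ζ * f ζ)) := by
  obtain ⟨M, hM⟩ := (isCompact_closedBall (0:ℂ) d).exists_bound_of_continuousOn hf.continuousOn
  refine tendsto_integral_filter_of_dominated_convergence
    (fun ζ => (closedBall (0:ℂ) d).indicator (fun ζ => 2 * d / ‖ζ‖) ζ * M) ?_ ?_
    ((integrable_indicator_div_norm d _).mul_const _) ?_
  · filter_upwards [self_mem_nhdsWithin] with ε hε
    exact (integrable_logKer hd (le_of_lt hε)).1.mul hf.aestronglyMeasurable
  · filter_upwards [self_mem_nhdsWithin] with ε hε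
    filter_upwards [ae_abs_logKer_le hd (le_of_lt hε)] with ζ h
    rw [norm_mul, Real.norm_eq_abs]
    by_cases hζ : ζ ∈ closedBall (0:ℂ) d
    · exact mul_le_mul h (hM _ hζ) (norm_nonneg _) ((abs_nonneg _).trans h)
    · rw [indicator_of_notMem hζ]
      rw [mem_closedBall, dist_zero_right, not_le] at hζ
      rw [logKer_of_ge hd (le_of_lt hε) hζ.le]
      simp
  · filter_upwards [ae_ne_zero] with ζ hζ using (tendsto_logKer hd hζ).mul_const _

theorem tendsto_integral_resKer (hd : 0 < d) {f : ℂ → ℝ} (hf : Continuous f) :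
    Tendsto (fun ε => ∫ ζ, resKer d ε ζ * f ζ) (nhdsWithin 0 (Ioi 0))
      (nhds (∫ ζ, resKer d 0 ζ * f ζ)) := by
  obtain ⟨M, hM⟩ := (isCompact_closedBall (0:ℂ) d).exists_bound_of_continuousOn hf.continuousOn
  obtain ⟨C, hC, hCb⟩ := exists_deriv_sqCut_bound hd
  refine tendsto_integral_filter_of_dominated_convergence
    ((closedBall (0:ℂ) d).indicator fun _ => 4 * C * M) ?_ ?_ ?_ ?_
  · exact Eventually.of_forall fun ε =>
      ((contDiff_resKer d ε).continuous.mul hf).aestronglyMeasurable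
  · filter_upwards [self_mem_nhdsWithin] with ε hε
    refine Eventually.of_forall fun ζ => ?_
    by_cases hζ : ζ ∈ closedBall (0:ℂ) d
    · rw [norm_mul, indicator_of_mem hζ]
      have h : ‖resKer d ε ζ‖ ≤ 4 * C := by
        rw [resKer, norm_mul, Real.norm_eq_abs, Real.norm_eq_abs, abs_of_pos four_pos]
        gcongr
        exact hCb _
      exact mul_le_mul h (hM _ hζ) (norm_nonneg _) (by positivity)
    · rw [indicator_of_notMem hζ]
      rw [mem_closedBall, dist_zero_right, not_le] at hζ
      rw [resKer_of_ge hd (le_of_lt hε) hζ.le]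
      simp
  · rw [integrable_indicator_iff measurableSet_closedBall]
    exact integrableOn_const (measure_closedBall_lt_top).ne
  · exact Eventually.of_forall fun ζ => (tendsto_resKer d ζ).mul_const _

theorem integral_logKer_mul_lap (hd : 0 < d) {ε : ℝ} (hε : 0 < ε) {f : ℂ → ℝ}
    (hf : ContDiff ℝ 2 f) : ∫ ζ, logKer d ε ζ * lap f ζ =
      (∫ ζ, resKer d ε ζ * f ζ) + ∫ ζ, approxKer d ε ζ * f ζ := by
  have h2 : (2 : WithTop ℕ∞) ≤ ((⊤ : ℕ∞) : WithTop ℕ∞) :=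
    WithTop.coe_le_coe.2 (le_top : (2 : ℕ∞) ≤ ⊤)
  rw [integral_mul_lap ((contDiff_logKer hd hε).of_le h2)
    (hasCompactSupport_of_norm_ge fun ζ h => logKer_of_ge hd hε.le h) hf, ← integral_add]
  · refine integral_congr_ae (Eventually.of_forall fun ζ => ?_)
    beta_reduce
    rw [lap_logKer hd hε, add_mul]
  · exact ((contDiff_resKer d ε).continuous.mul hf.continuous).integrable_of_hasCompactSupport
      (hasCompactSupport_of_norm_ge fun ζ h =>
        by rw [Pi.mul_apply, resKer_of_ge hd hε.le h, zero_mul])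
  · exact ((continuous_approxKer d hε).mul hf.continuous).integrable_of_hasCompactSupport
      (hasCompactSupport_of_norm_ge fun ζ h =>
        by rw [Pi.mul_apply, approxKer_of_ge hd hε.le h, zero_mul])

/-- Green's representation formula for the truncated logarithmic kernel. -/
theorem green_representation (hd : 0 < d) {f : ℂ → ℝ} (hf : ContDiff ℝ 2 f) :
    ∫ ζ, logKer d 0 ζ * lap f ζ = (∫ ζ, resKer d 0 ζ * f ζ) + poleMass * f 0 := by
  refine tendsto_nhds_unique (tendsto_integral_logKer hd (continuous_lap hf))
    (((tendsto_integral_resKer hd hf.continuous).add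
      (tendsto_integral_approxKer hd hf.continuous)).congr' ?_)
  filter_upwards [self_mem_nhdsWithin] with ε hε using (integral_logKer_mul_lap hd hε hf).symm

end

section
variable {E : Type*} [NormedAddCommGroup E] [NormedSpace ℝ E] {L : E →L[ℝ] ℝ →L[ℝ] E}

theorem integrable_conv_bounded {g : ℂ → E} {F : ℂ → ℝ} {M : ℝ} (hg : Integrable g)
    (hF : AEStronglyMeasurable F) (hM : ∀ z, ‖F z‖ ≤ M) (x : ℂ) :
    Integrable fun t => L (g t) (F (x - t)) := by
  have hF' : AEStronglyMeasurable fun t => F (x - t) :=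
    hF.comp_quasiMeasurePreserving (quasiMeasurePreserving_sub_left volume x)
  refine (hg.norm.const_mul (‖L‖ * M)).mono' ?_ (Eventually.of_forall fun t => ?_)
  · exact L.aestronglyMeasurable_comp₂ hg.1 hF'
  · calc ‖L (g t) (F (x - t))‖ ≤ ‖L‖ * ‖g t‖ * ‖F (x - t)‖ := L.le_opNorm₂ _ _
      _ ≤ ‖L‖ * ‖g t‖ * M := by gcongr; exact hM _
      _ = _ := by ring

theorem exists_dist_conv_le (L : E →L[ℝ] ℝ →L[ℝ] E) {F : ℂ → ℝ} {M : ℝ}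
    (hF : AEStronglyMeasurable F) (hM : ∀ z, ‖F z‖ ≤ M) :
    ∃ C : ℝ, ∀ g₁ g₂ : ℂ → E, Integrable g₁ → Integrable g₂ → ∀ x : ℂ,
      dist (convolution g₁ F L volume x) (convolution g₂ F L volume x) ≤
        C * ∫ t, ‖g₂ t - g₁ t‖ := by
  refine ⟨‖L‖ * M, fun g₁ g₂ h₁ h₂ x => ?_⟩
  rw [dist_comm, dist_eq_norm, convolution, convolution,
    ← integral_sub (integrable_conv_bounded h₂ hF hM x) (integrable_conv_bounded h₁ hF hM x),
    ← integral_const_mul]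
  refine norm_integral_le_of_norm_le ((h₂.sub h₁).norm.const_mul _)
      (Eventually.of_forall fun t => ?_)
  rw [← _root_.sub_apply, ← map_sub]
  calc ‖L (g₂ t - g₁ t) (F (x - t))‖ ≤ ‖L‖ * ‖g₂ t - g₁ t‖ * ‖F (x - t)‖ := L.le_opNorm₂ _ _
    _ ≤ ‖L‖ * ‖g₂ t - g₁ t‖ * M := by gcongr; exact hM _
    _ = ‖L‖ * M * ‖g₂ t - g₁ t‖ := by ring

end

section
variable {d : ℝ}

theorem hasFDerivAt_logKer_conv (hd : 0 < d) {F : ℂ → ℝ} {M : ℝ} (hF : AEStronglyMeasurable F)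
    (hM : ∀ z, ‖F z‖ ≤ M) (x : ℂ) :
    HasFDerivAt (convolution (logKer d 0) F (ContinuousLinearMap.mul ℝ ℝ) volume)
      (convolution (logKerGrad d 0) F ((ContinuousLinearMap.mul ℝ ℝ).precompL ℂ) volume x) x := by
  have hFl : LocallyIntegrable F := fun z => by
    refine ⟨closedBall z 1, closedBall_mem_nhds z one_pos, ?_⟩
    exact Measure.integrableOn_of_bounded (M := M) measure_closedBall_lt_top.ne hF
      (Eventually.of_forall hM)
  have hs : ∀ n : ℕ, (0:ℝ) < 1 / ((n:ℝ) + 1) := fun n => by positivity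
  have hlim : Tendsto (fun n : ℕ => 1 / ((n:ℝ) + 1)) atTop (nhdsWithin 0 (Ioi 0)) :=
    tendsto_nhdsWithin_iff.2 ⟨tendsto_one_div_add_atTop_nhds_zero_nat, Eventually.of_forall hs⟩
  refine hasFDerivAt_of_tendstoUniformlyOn (l := atTop) isOpen_univ
    (f := fun n : ℕ => convolution (logKer d (1 / ((n:ℝ) + 1))) F
      (ContinuousLinearMap.mul ℝ ℝ) volume)
    (f' := fun n : ℕ => convolution (logKerGrad d (1 / ((n:ℝ) + 1))) F
      ((ContinuousLinearMap.mul ℝ ℝ).precompL ℂ) volume) ?_ ?_ ?_ (mem_univ x)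
  · rw [Metric.tendstoUniformlyOn_iff]
    intro e he
    obtain ⟨C, hC⟩ := exists_dist_conv_le ((ContinuousLinearMap.mul ℝ ℝ).precompL ℂ) hF hM
    have h := ((tendsto_integral_norm_logKerGrad_sub hd).comp hlim).const_mul C
    rw [mul_zero] at h
    filter_upwards [h.eventually (gt_mem_nhds he)] with n hn y _
    exact (hC _ _ (integrable_logKerGrad hd le_rfl)
      (integrable_logKerGrad hd (hs n).le) y).trans_lt hn
  · intro n y _
    have h := HasCompactSupport.hasFDerivAt_convolution_left (ContinuousLinearMap.mul ℝ ℝ)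
      (μ := volume) (f := logKer d (1 / ((n:ℝ) + 1)))
      (hasCompactSupport_of_norm_ge fun _ h => logKer_of_ge hd (hs n).le h)
      ((contDiff_logKer hd (hs n)).of_le (WithTop.coe_le_coe.2 (le_top : (1 : ℕ∞) ≤ ⊤))) hFl y
    rwa [show fderiv ℝ (logKer d (1 / ((n:ℝ) + 1))) = logKerGrad d (1 / ((n:ℝ) + 1)) from
      funext fun ζ => (hasFDerivAt_logKer hd (hs n) ζ).fderiv] at h
  · intro y _
    rw [tendsto_iff_dist_tendsto_zero]
    obtain ⟨C, hC⟩ := exists_dist_conv_le (ContinuousLinearMap.mul ℝ ℝ) hF hM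
    have h := ((tendsto_integral_norm_logKer_sub hd).comp hlim).const_mul C
    rw [mul_zero] at h
    refine squeeze_zero (fun _ => dist_nonneg) (fun n => ?_) h
    rw [dist_comm]
    exact hC _ _ (integrable_logKer hd le_rfl) (integrable_logKer hd (hs n).le) y

theorem contDiff_logKer_conv (hd : 0 < d) {F : ℂ → ℝ} {m : ℕ} (hF : ContDiff ℝ m F)
    (hc : HasCompactSupport F) :
    ContDiff ℝ (m + 1) (convolution (logKer d 0) F (ContinuousLinearMap.mul ℝ ℝ) volume) := by
  obtain ⟨M, hM⟩ := hc.exists_bound_of_continuous hF.continuous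
  exact contDiff_succ_iff_hasFDerivAt.2 ⟨_, hc.contDiff_convolution_right _
    (integrable_logKerGrad hd le_rfl).locallyIntegrable hF,
    hasFDerivAt_logKer_conv hd hF.continuous.aestronglyMeasurable hM⟩

theorem contDiff_resKer_conv (hd : 0 < d) {F : ℂ → ℝ} (hF : LocallyIntegrable F) :
    ContDiff ℝ (⊤ : ℕ∞) (convolution (resKer d 0) F (ContinuousLinearMap.mul ℝ ℝ) volume) :=
  HasCompactSupport.contDiff_convolution_left _
    (hasCompactSupport_of_norm_ge fun _ h => resKer_of_ge hd le_rfl h) (contDiff_resKer d 0) hF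

theorem logKer_neg_arg (d ε : ℝ) (ζ : ℂ) : logKer d ε (-ζ) = logKer d ε ζ := by
  rw [logKer, logKer, norm_neg]

theorem resKer_neg_arg (d ε : ℝ) (ζ : ℂ) : resKer d ε (-ζ) = resKer d ε ζ := by
  rw [resKer, resKer, norm_neg]

theorem integral_even_mul_shift {κ : ℂ → ℝ} (h : ∀ ζ, κ (-ζ) = κ ζ) (F : ℂ → ℝ) (z : ℂ) :
    ∫ ζ, κ ζ * F (z + ζ) = convolution κ F (ContinuousLinearMap.mul ℝ ℝ) volume z := by
  rw [convolution, ← integral_neg_eq_self]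
  refine integral_congr_ae (Eventually.of_forall fun ζ => ?_)
  simp [h, sub_eq_add_neg]

end

/-- The logarithm of the rescaled conformal factor `u / (2t)`. -/
noncomputable def blowLog (u : ℂ → ℝ → ℝ) (t : ℝ) (z : ℂ) : ℝ :=
  logFactor u (z, t) - Real.log (2 * t)

theorem lap_sub_const (f : ℂ → ℝ) (c : ℝ) (z : ℂ) : lap (fun w => f w - c) z = lap f z := by
  rw [lap, lap, iteratedFDeriv_two_apply, iteratedFDeriv_two_apply, iteratedFDeriv_two_apply,
    iteratedFDeriv_two_apply, show fderiv ℝ (fun w => f w - c) = fderiv ℝ f from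
      funext fun w => fderiv_sub_const c]

theorem integrable_mul_of_eq_zero {κ f : ℂ → ℝ} {R : ℝ} (hκ : Integrable κ)
    (hs : ∀ ζ, R ≤ ‖ζ‖ → κ ζ = 0) (hf : Continuous f) : Integrable fun ζ => κ ζ * f ζ := by
  obtain ⟨B, hB⟩ := (isCompact_closedBall (0:ℂ) R).exists_bound_of_continuousOn hf.continuousOn
  refine (hκ.norm.mul_const B).mono' (hκ.1.mul hf.aestronglyMeasurable)
    (Eventually.of_forall fun ζ => ?_)
  rw [norm_mul]
  rcases le_or_gt R ‖ζ‖ with h | h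
  · simp [hs ζ h]
  · exact mul_le_mul_of_nonneg_left (hB ζ (by simpa using h.le)) (norm_nonneg _)

section
variable {T : ℝ} {u : ℂ → ℝ → ℝ}

theorem contDiff_blowLog (hpos : ∀ z, ∀ t ∈ Ioo 0 T, 0 < u z t)
    (hsmooth : ContDiffOn ℝ (⊤ : ℕ∞) (fun p : ℂ × ℝ => u p.1 p.2) (univ ×ˢ Ioo 0 T))
    {t : ℝ} (ht : t ∈ Ioo 0 T) (z : ℂ) :
    ContDiff ℝ (⊤ : ℕ∞) fun w => blowLog u t (z + w) :=
  (((contDiff_spacetime_slice (contDiffOn_logFactor hpos hsmooth) ht).comp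
    (contDiff_const.add contDiff_id)).sub contDiff_const)

theorem lap_blowLog (hpos : ∀ z, ∀ t ∈ Ioo 0 T, 0 < u z t)
    (hsmooth : ContDiffOn ℝ (⊤ : ℕ∞) (fun p : ℂ × ℝ => u p.1 p.2) (univ ×ˢ Ioo 0 T))
    (hlfde : ∀ z, ∀ t ∈ Ioo 0 T, deriv (u z) t = lap (fun w => Real.log (u w t)) z)
    {t : ℝ} (ht : t ∈ Ioo 0 T) (z ζ : ℂ) :
    lap (fun w => blowLog u t (z + w)) ζ = u (z + ζ) t * logSpeed u (z + ζ, t) := by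
  rw [lap_comp_add_left (blowLog u t), show blowLog u t = fun w => logFactor u (w, t) -
    Real.log (2 * t) from rfl, lap_sub_const, lap_logFactor hpos hsmooth hlfde ht]

theorem exp_blowLog (hpos : ∀ z, ∀ t ∈ Ioo 0 T, 0 < u z t) {t : ℝ} (ht : t ∈ Ioo 0 T) (z : ℂ) :
    Real.exp (blowLog u t z) = u z t / (2 * t) := by
  rw [blowLog, Real.exp_sub, exp_logFactor hpos ht, Real.exp_log (by linarith [ht.1])]

theorem antitoneOn_blowLog (hpos : ∀ z, ∀ t ∈ Ioo 0 T, 0 < u z t)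
    (hsmooth : ContDiffOn ℝ (⊤ : ℕ∞) (fun p : ℂ × ℝ => u p.1 p.2) (univ ×ˢ Ioo 0 T))
    (hlfde : ∀ z, ∀ t ∈ Ioo 0 T, deriv (u z) t = lap (fun w => Real.log (u w t)) z)
    (hcomplete : ∀ t ∈ Ioo (0:ℝ) T, ConfComplete (fun z => u z t) univ) (z : ℂ) :
    AntitoneOn (fun t => blowLog u t z) (Ioo 0 T) := fun s hs t ht hst => by
  have h := antitoneOn_factor_div hpos hsmooth hlfde hcomplete z hs ht hst
  beta_reduce at h ⊢
  rw [← Real.exp_le_exp, exp_blowLog hpos hs, exp_blowLog hpos ht, mul_comm 2 t, mul_comm 2 s,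
    ← div_div, ← div_div]
  linarith

/-- Differentiation in time of the local integrals of the conformal factor. -/
theorem hasDerivAt_integral_factor (hpos : ∀ z, ∀ t ∈ Ioo 0 T, 0 < u z t)
    (hsmooth : ContDiffOn ℝ (⊤ : ℕ∞) (fun p : ℂ × ℝ => u p.1 p.2) (univ ×ˢ Ioo 0 T))
    (hlfde : ∀ z, ∀ t ∈ Ioo 0 T, deriv (u z) t = lap (fun w => Real.log (u w t)) z)
    {κ : ℂ → ℝ} {R : ℝ} (hκ : Integrable κ) (hs : ∀ ζ, R ≤ ‖ζ‖ → κ ζ = 0)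
    {t : ℝ} (ht : t ∈ Ioo 0 T) (z : ℂ) :
    HasDerivAt (fun τ => ∫ ζ, κ ζ * u (z + ζ) τ)
      (∫ ζ, κ ζ * lap (fun w => blowLog u t (z + w)) ζ) t := by
  have hcont : ∀ τ ∈ Ioo 0 T, Continuous fun ζ => u (z + ζ) τ := fun τ hτ =>
    (continuous_slice hsmooth.continuousOn hτ).comp (continuous_const.add continuous_id)
  have hcont' : ∀ τ ∈ Ioo 0 T, Continuous fun ζ => u (z + ζ) τ * logSpeed u (z + ζ, τ) :=
    fun τ hτ => (hcont τ hτ).mul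
      ((contDiff_spacetime_slice (contDiffOn_logSpeed hpos hsmooth) hτ).continuous.comp
        (continuous_const.add continuous_id))
  obtain ⟨t₁, h1, h1t⟩ := exists_between ht.1
  obtain ⟨t₂, h2t, h2⟩ := exists_between ht.2
  have hI : ∀ τ ∈ Icc t₁ t₂, τ ∈ Ioo 0 T := fun τ h => ⟨h1.trans_le h.1, h.2.trans_lt h2⟩
  have hK : IsCompact (closedBall (0:ℂ) R ×ˢ Icc t₁ t₂) :=
    (isCompact_closedBall _ _).prod isCompact_Icc
  obtain ⟨M, hM⟩ := hK.exists_bound_of_continuousOn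
    (f := fun p : ℂ × ℝ => u (z + p.1) p.2 * logSpeed u (z + p.1, p.2)) (by
      have hm : MapsTo (fun p : ℂ × ℝ => (z + p.1, p.2)) (closedBall (0:ℂ) R ×ˢ Icc t₁ t₂)
        (univ ×ˢ Ioo 0 T) := fun p hp => ⟨mem_univ _, hI _ hp.2⟩
      exact (hsmooth.continuousOn.comp (by fun_prop) hm).mul
        ((contDiffOn_logSpeed hpos hsmooth).continuousOn.comp (by fun_prop) hm))
  have h := hasDerivAt_integral_of_dominated_loc_of_deriv_le (μ := volume)
    (F := fun τ ζ => κ ζ * u (z + ζ) τ)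
    (F' := fun τ ζ => κ ζ * (u (z + ζ) τ * logSpeed u (z + ζ, τ)))
    (bound := fun ζ => ‖κ ζ‖ * M) (Icc_mem_nhds h1t h2t)
    (by
      filter_upwards [isOpen_Ioo.mem_nhds ht] with τ hτ
      exact hκ.1.mul (hcont τ hτ).aestronglyMeasurable)
    (integrable_mul_of_eq_zero hκ hs (hcont t ht))
    (hκ.1.mul (hcont' t ht).aestronglyMeasurable)
    (Eventually.of_forall fun ζ τ hτ => by
      rw [norm_mul]
      rcases le_or_gt R ‖ζ‖ with h | h
      · simp [hs ζ h]
      · exact mul_le_mul_of_nonneg_left (hM (ζ, τ) ⟨by simpa using h.le, hτ⟩) (norm_nonneg _))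
    (hκ.norm.mul_const M)
    (Eventually.of_forall fun ζ τ hτ =>
      (hasDerivAt_factor hpos hsmooth (hI τ hτ) (z + ζ)).const_mul (κ ζ))
  simpa only [lap_blowLog hpos hsmooth hlfde ht] using h.2

theorem hasDerivAt_integral_logKer_reg (hpos : ∀ z, ∀ t ∈ Ioo 0 T, 0 < u z t)
    (hsmooth : ContDiffOn ℝ (⊤ : ℕ∞) (fun p : ℂ × ℝ => u p.1 p.2) (univ ×ˢ Ioo 0 T))
    (hlfde : ∀ z, ∀ t ∈ Ioo 0 T, deriv (u z) t = lap (fun w => Real.log (u w t)) z)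
    {d ε : ℝ} (hd : 0 < d) (hε : 0 < ε) {t : ℝ} (ht : t ∈ Ioo 0 T) (z : ℂ) :
    HasDerivAt (fun τ => ∫ ζ, logKer d ε ζ * u (z + ζ) τ)
      ((∫ ζ, resKer d ε ζ * blowLog u t (z + ζ)) +
        ∫ ζ, approxKer d ε ζ * blowLog u t (z + ζ)) t := by
  rw [← integral_logKer_mul_lap hd hε ((contDiff_blowLog hpos hsmooth ht z).of_le
    (WithTop.coe_le_coe.2 (le_top : (2 : ℕ∞) ≤ ⊤)))]
  exact hasDerivAt_integral_factor hpos hsmooth hlfde (integrable_logKer hd hε.le)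
    (fun _ h => logKer_of_ge hd hε.le h) ht z

theorem hasDerivAt_integral_logKer (hpos : ∀ z, ∀ t ∈ Ioo 0 T, 0 < u z t)
    (hsmooth : ContDiffOn ℝ (⊤ : ℕ∞) (fun p : ℂ × ℝ => u p.1 p.2) (univ ×ˢ Ioo 0 T))
    (hlfde : ∀ z, ∀ t ∈ Ioo 0 T, deriv (u z) t = lap (fun w => Real.log (u w t)) z)
    {d : ℝ} (hd : 0 < d) {t : ℝ} (ht : t ∈ Ioo 0 T) (z : ℂ) :
    HasDerivAt (fun τ => ∫ ζ, logKer d 0 ζ * u (z + ζ) τ)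
      ((∫ ζ, resKer d 0 ζ * blowLog u t (z + ζ)) + poleMass * blowLog u t z) t := by
  have h := green_representation hd ((contDiff_blowLog hpos hsmooth ht z).of_le
    (WithTop.coe_le_coe.2 (le_top : (2 : ℕ∞) ≤ ⊤)))
  rw [add_zero] at h
  rw [← h]
  exact hasDerivAt_integral_factor hpos hsmooth hlfde (integrable_logKer hd le_rfl)
    (fun _ h => logKer_of_ge hd le_rfl h) ht z

theorem hasDerivAt_integral_cutoff (hpos : ∀ z, ∀ t ∈ Ioo 0 T, 0 < u z t)
    (hsmooth : ContDiffOn ℝ (⊤ : ℕ∞) (fun p : ℂ × ℝ => u p.1 p.2) (univ ×ˢ Ioo 0 T))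
    (hlfde : ∀ z, ∀ t ∈ Ioo 0 T, deriv (u z) t = lap (fun w => Real.log (u w t)) z)
    {φ : ℂ → ℝ} {R : ℝ} (hφ : ContDiff ℝ 2 φ) (hs : ∀ ζ, R ≤ ‖ζ‖ → φ ζ = 0)
    {t : ℝ} (ht : t ∈ Ioo 0 T) (z : ℂ) :
    HasDerivAt (fun τ => ∫ ζ, φ ζ * u (z + ζ) τ)
      (∫ ζ, lap φ ζ * blowLog u t (z + ζ)) t := by
  have hc : HasCompactSupport φ := hasCompactSupport_of_norm_ge hs
  rw [← integral_mul_lap hφ hc ((contDiff_blowLog hpos hsmooth ht z).of_le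
    (WithTop.coe_le_coe.2 (le_top : (2 : ℕ∞) ≤ ⊤)))]
  exact hasDerivAt_integral_factor hpos hsmooth hlfde
      (hφ.continuous.integrable_of_hasCompactSupport hc)
    hs ht z

end

/-- A cutoff whose Laplacian is controlled by its square root. -/
noncomputable def massCut (R : ℝ) (ζ : ℂ) : ℝ := sqCut R (‖ζ‖ ^ 2) ^ 4

section
variable {R : ℝ}

theorem massCut_of_ge (hR : 0 < R) {ζ : ℂ} (h : R ≤ ‖ζ‖) : massCut R ζ = 0 := by
  rw [massCut, sqCut_of_ge hR (pow_le_pow_left₀ hR.le h 2)]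
  simp

theorem massCut_nonneg (R : ℝ) (ζ : ℂ) : 0 ≤ massCut R ζ := pow_nonneg (sqCut_nonneg _ _) 4

theorem massCut_of_le (hR : 0 < R) {ζ : ℂ} (h : ‖ζ‖ ≤ R / 2) : massCut R ζ = 1 := by
  have := pow_le_pow_left₀ (norm_nonneg ζ) h 2
  rw [massCut, sqCut_of_le hR (by nlinarith), one_pow]

theorem contDiff_massCut (R : ℝ) {n : ℕ∞} : ContDiff ℝ n (massCut R) :=
  ((contDiff_sqCut R).comp (contDiff_norm_sq ℝ)).pow 4

theorem exists_lap_massCut_bound (hR : 0 < R) :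
    ∃ C, 0 < C ∧ ∀ ζ, |lap (massCut R) ζ| ≤ C * sqCut R (‖ζ‖ ^ 2) ^ 2 := by
  have hdd : Differentiable ℝ (deriv (sqCut R)) :=
    (contDiff_deriv_sqCut R (n := 1)).differentiable one_ne_zero
  have hcont : Continuous (deriv (deriv (sqCut R))) :=
    (contDiff_deriv_sqCut R (n := 1)).continuous_deriv le_rfl
  have hlap : ∀ ζ, lap (massCut R) ζ = sqCut R (‖ζ‖ ^ 2) ^ 2 * (4 * (‖ζ‖ ^ 2 *
      (12 * deriv (sqCut R) (‖ζ‖ ^ 2) ^ 2 +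
        4 * sqCut R (‖ζ‖ ^ 2) * deriv (deriv (sqCut R)) (‖ζ‖ ^ 2))
        + 4 * sqCut R (‖ζ‖ ^ 2) * deriv (sqCut R) (‖ζ‖ ^ 2))) := fun ζ => by
    have h := lap_radial (ε := 0) (ζ := ζ) (G := fun s => sqCut R s ^ 4)
      (G₁ := fun s => 4 * sqCut R s ^ 3 * deriv (sqCut R) s)
      (Eventually.of_forall fun w => ((hasDerivAt_sqCut R _).pow 4).congr_deriv (by norm_num))
      ((((hasDerivAt_sqCut R _).pow 3).const_mul 4).mul (hdd _).hasDerivAt)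
    simp only [add_zero] at h
    rw [show massCut R = fun w : ℂ => sqCut R (‖w‖ ^ 2) ^ 4 from rfl, h]
    norm_num
    ring
  have hc1 : Continuous (sqCut R) := (contDiff_sqCut R (n := 0)).continuous
  have hc2 : Continuous (deriv (sqCut R)) := (contDiff_deriv_sqCut R (n := 0)).continuous
  obtain ⟨C, hC⟩ := (isCompact_closedBall (0:ℂ) R).exists_bound_of_continuousOn
    (f := fun ζ : ℂ => 4 * (‖ζ‖ ^ 2 * (12 * deriv (sqCut R) (‖ζ‖ ^ 2) ^ 2 +
      4 * sqCut R (‖ζ‖ ^ 2) * deriv (deriv (sqCut R)) (‖ζ‖ ^ 2))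
        + 4 * sqCut R (‖ζ‖ ^ 2) * deriv (sqCut R) (‖ζ‖ ^ 2))) (by fun_prop)
  refine ⟨max C 1, by positivity, fun ζ => ?_⟩
  rw [hlap, abs_mul, abs_of_nonneg (sq_nonneg (sqCut R (‖ζ‖ ^ 2))), mul_comm]
  rcases le_or_gt R ‖ζ‖ with h | h
  · rw [sqCut_of_ge hR (pow_le_pow_left₀ hR.le h 2)]; simp
  · exact mul_le_mul_of_nonneg_right ((hC ζ (by simpa using h.le)).trans (le_max_left _ _))
      (sq_nonneg _)

end

theorem abs_le_add_two_exp_half {c w : ℝ} (hc : 0 ≤ c) (h : -c ≤ w) :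
    |w| ≤ c + 2 * Real.exp (w / 2) := by
  have h1 := Real.add_one_le_exp (w / 2)
  have h2 := Real.exp_pos (w / 2)
  exact abs_le.2 ⟨by linarith, by linarith⟩

/-- A nonlinear Gronwall inequality with vanishing initial value. -/
theorem le_of_deriv_le_sqrt_div {P P' : ℝ → ℝ} {t₀ C : ℝ}
    (hpos : ∀ t ∈ Ioc 0 t₀, 0 < P t)
    (hP : ∀ t ∈ Ioc 0 t₀, HasDerivAt P (P' t) t)
    (hle : ∀ t ∈ Ioc 0 t₀, P' t ≤ C * √(P t / t))
    (hlim : Tendsto P (nhdsWithin 0 (Ioi 0)) (nhds 0)) {t : ℝ} (ht : t ∈ Ioc 0 t₀) :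
    P t ≤ C ^ 2 * t := by
  have hd : ∀ s ∈ Ioc 0 t₀, HasDerivAt (fun s => √(P s) - C * √s)
      (P' s / (2 * √(P s)) - C * (1 / (2 * √s))) s := fun s hs =>
    ((hP s hs).sqrt (hpos s hs).ne').sub ((Real.hasDerivAt_sqrt hs.1.ne').const_mul C)
  have hanti : AntitoneOn (fun s => √(P s) - C * √s) (Ioc 0 t₀) := by
    refine antitoneOn_of_deriv_nonpos (convex_Ioc 0 t₀)
      (fun s hs => (hd s hs).continuousAt.continuousWithinAt)
      (fun s hs => (hd s (interior_subset hs)).differentiableAt.differentiableWithinAt)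
        fun s hs => ?_
    have hs := interior_subset hs
    rw [(hd s hs).deriv]
    have h1 : 0 < √(P s) := Real.sqrt_pos.2 (hpos s hs)
    have h2 : 0 < √s := Real.sqrt_pos.2 hs.1
    have h3 := hle s hs
    rw [Real.sqrt_div (hpos s hs).le] at h3
    have : P' s / (2 * √(P s)) ≤ C * (√(P s) / √s) / (2 * √(P s)) := by gcongr
    have e : C * (√(P s) / √s) / (2 * √(P s)) = C * (1 / (2 * √s)) := by field_simp
    linarith
  have hl : Tendsto (fun s => √(P s) - C * √s) (nhdsWithin 0 (Ioi 0)) (nhds (√0 - C * √0)) :=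
    (hlim.sqrt).sub ((tendsto_id.mono_left nhdsWithin_le_nhds).sqrt.const_mul C)
  have h0 : √(P t) - C * √t ≤ √0 - C * √0 := ge_of_tendsto hl (by
    filter_upwards [Ioc_mem_nhdsGT ht.1] with s hs
    exact hanti ⟨hs.1, hs.2.trans ht.2⟩ ht hs.2)
  have h1 : √(P t) ≤ C * √t := by simpa using h0
  have h2 := pow_le_pow_left₀ (Real.sqrt_nonneg _) h1 2
  rwa [mul_pow, Real.sq_sqrt (hpos t ht).le, Real.sq_sqrt ht.1.le] at h2

section
variable {T : ℝ} {u : ℂ → ℝ → ℝ}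

theorem exists_blowLog_lower_bound (hpos : ∀ z, ∀ t ∈ Ioo 0 T, 0 < u z t)
    (hsmooth : ContDiffOn ℝ (⊤ : ℕ∞) (fun p : ℂ × ℝ => u p.1 p.2) (univ ×ˢ Ioo 0 T))
    (hlfde : ∀ z, ∀ t ∈ Ioo 0 T, deriv (u z) t = lap (fun w => Real.log (u w t)) z)
    (hcomplete : ∀ t ∈ Ioo (0:ℝ) T, ConfComplete (fun z => u z t) univ) {t₀ : ℝ}
    (ht₀ : t₀ ∈ Ioo 0 T) (z : ℂ) (R : ℝ) :
    ∃ c, 0 ≤ c ∧ ∀ t ∈ Ioc 0 t₀, ∀ ζ : ℂ, ‖ζ‖ ≤ R → -c ≤ blowLog u t (z + ζ) := by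
  obtain ⟨c, hc⟩ := (isCompact_closedBall (0:ℂ) R).exists_bound_of_continuousOn
    (contDiff_blowLog hpos hsmooth ht₀ z).continuous.continuousOn
  refine ⟨max c 0, le_max_right _ _, fun t ht ζ hζ => ?_⟩
  have h1 := antitoneOn_blowLog hpos hsmooth hlfde hcomplete (z + ζ)
    ⟨ht.1, ht.2.trans_lt ht₀.2⟩ ht₀ ht.2
  have h2 := abs_le.1 (hc ζ (by simpa using hζ))
  have h3 := le_max_left c 0
  beta_reduce at h1
  linarith

/-- If the initial mass of a ball vanishes, the mass of the flow grows at most linearly there. -/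
theorem exists_mass_bound (hpos : ∀ z, ∀ t ∈ Ioo 0 T, 0 < u z t)
    (hsmooth : ContDiffOn ℝ (⊤ : ℕ∞) (fun p : ℂ × ℝ => u p.1 p.2) (univ ×ˢ Ioo 0 T))
    (hlfde : ∀ z, ∀ t ∈ Ioo 0 T, deriv (u z) t = lap (fun w => Real.log (u w t)) z)
    (hcomplete : ∀ t ∈ Ioo (0:ℝ) T, ConfComplete (fun z => u z t) univ) {t₀ R : ℝ} (hR : 0 < R)
    (ht₀ : t₀ ∈ Ioo 0 T) {z : ℂ}
    (hlim : Tendsto (fun t => ∫ ζ, massCut R ζ * u (z + ζ) t) (nhdsWithin 0 (Ioi 0)) (nhds 0)) :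
    ∃ C, 0 ≤ C ∧ ∀ t ∈ Ioc 0 t₀, ∫ ζ, massCut R ζ * u (z + ζ) t ≤ C * t := by
  obtain ⟨c, hc, hcl⟩ := exists_blowLog_lower_bound hpos hsmooth hlfde hcomplete ht₀ z R
  obtain ⟨D, hD, hDl⟩ := exists_lap_massCut_bound hR
  set X : ℝ → ℝ := fun t => ∫ ζ, massCut R ζ * u (z + ζ) t with hX
  have hI : ∀ t ∈ Ioc 0 t₀, t ∈ Ioo 0 T := fun t h => ⟨h.1, h.2.trans_lt ht₀.2⟩
  have hXd : ∀ t ∈ Ioc 0 t₀, HasDerivAt X (∫ ζ, lap (massCut R) ζ * blowLog u t (z + ζ)) t :=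
    fun t ht => hasDerivAt_integral_cutoff hpos hsmooth hlfde (contDiff_massCut R)
      (fun _ h => massCut_of_ge hR h) (hI t ht) z
  have hX0 : ∀ t ∈ Ioc 0 t₀, 0 ≤ X t := fun t ht =>
    integral_nonneg fun ζ => mul_nonneg (massCut_nonneg R ζ) (hpos _ t (hI t ht)).le
  set V : ℝ := volume.real (closedBall (0:ℂ) R) with hV
  have hV0 : 0 ≤ V := measureReal_nonneg
  have key : ∀ t ∈ Ioc 0 t₀, ∀ q : ℝ, 0 < q → ∫ ζ, lap (massCut R) ζ * blowLog u t (z + ζ) ≤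
      D * ((c + q) * V + q⁻¹ * (X t / (2 * t))) := by
    intro t ht q hq
    have hcont : Continuous fun ζ => u (z + ζ) t :=
      (continuous_slice hsmooth.continuousOn (hI t ht)).comp (continuous_const.add continuous_id)
    have hinteg : Integrable fun ζ => massCut R ζ * u (z + ζ) t :=
      ((contDiff_massCut R (n := 0)).continuous.mul hcont).integrable_of_hasCompactSupport
        (hasCompactSupport_of_norm_ge fun ζ h => by
          rw [Pi.mul_apply, massCut_of_ge hR h, zero_mul])
    have hind : Integrable ((closedBall (0:ℂ) R).indicator fun _ => c + q) :=
      (integrable_indicator_iff measurableSet_closedBall).2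
        (integrableOn_const measure_closedBall_lt_top.ne)
    have e : D * ((c + q) * V + q⁻¹ * (X t / (2 * t))) =
        ∫ ζ, D * ((closedBall (0:ℂ) R).indicator (fun _ => c + q) ζ +
          q⁻¹ * (massCut R ζ * u (z + ζ) t / (2 * t))) := by
      rw [integral_const_mul, integral_add hind ((hinteg.div_const _).const_mul _),
        integral_const_mul, integral_div, integral_indicator_const _ measurableSet_closedBall,
        smul_eq_mul, mul_comm V]
    rw [e]
    have hz : ∀ ζ, R ≤ ‖ζ‖ → lap (massCut R) ζ = 0 := fun ζ h => by
      have := hDl ζ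
      rw [sqCut_of_ge hR (pow_le_pow_left₀ hR.le h 2)] at this
      exact abs_nonpos_iff.1 (by simpa using this)
    refine integral_mono ((Continuous.mul (continuous_lap (contDiff_massCut R (n := 2)))
      (contDiff_blowLog hpos hsmooth (hI t ht) z).continuous).integrable_of_hasCompactSupport
        (hasCompactSupport_of_norm_ge fun ζ h => by rw [Pi.mul_apply, hz ζ h, zero_mul]))
      ((hind.add ((hinteg.div_const _).const_mul _)).const_mul D) fun ζ => ?_
    beta_reduce
    rcases le_or_gt R ‖ζ‖ with h | h
    · rw [hz ζ h, massCut_of_ge hR h]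
      have : 0 ≤ (closedBall (0:ℂ) R).indicator (fun _ => c + q) ζ :=
        indicator_nonneg (fun _ _ => by linarith) ζ
      simpa using mul_nonneg hD.le this
    · rw [indicator_of_mem (by simpa using h.le), mul_div_assoc, ← exp_blowLog hpos (hI t ht)]
      set w := blowLog u t (z + ζ) with hw
      set r := sqCut R (‖ζ‖ ^ 2) with hr
      have hr0 : 0 ≤ r := sqCut_nonneg _ _
      have hr1 : r ^ 2 ≤ 1 := pow_le_one₀ hr0 (sqCut_le_one _ _)
      have h1 : |w| ≤ c + 2 * Real.exp (w / 2) := abs_le_add_two_exp_half hc (hcl t ht ζ h.le)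
      set e := Real.exp (w / 2) with he
      have he2 : Real.exp w = e ^ 2 := by rw [he, ← Real.exp_nat_mul]; congr 1; push_cast; ring
      have h2 : 2 * (r ^ 2 * e) ≤ q + q⁻¹ * (r ^ 2 * e) ^ 2 := by
        have h3 := mul_nonneg (inv_nonneg.2 hq.le) (sq_nonneg (q - r ^ 2 * e))
        have h4 : q⁻¹ * (q - r ^ 2 * e) ^ 2 = q - 2 * (r ^ 2 * e) + q⁻¹ * (r ^ 2 * e) ^ 2 := by
          field_simp
          ring
        linarith
      calc lap (massCut R) ζ * w ≤ |lap (massCut R) ζ| * |w| := by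
            rw [← abs_mul]; exact le_abs_self _
        _ ≤ D * r ^ 2 * (c + 2 * e) := mul_le_mul (hDl ζ) h1 (abs_nonneg _) (by positivity)
        _ = D * (r ^ 2 * c + 2 * (r ^ 2 * e)) := by ring
        _ ≤ D * (1 * c + (q + q⁻¹ * (r ^ 2 * e) ^ 2)) := by gcongr
        _ = D * (c + q + q⁻¹ * (massCut R ζ * Real.exp w)) := by
          rw [he2, massCut, ← hr]; ring
  have hle : ∀ t ∈ Ioc 0 t₀, (∫ ζ, lap (massCut R) ζ * blowLog u t (z + ζ)) + 1 ≤
      (D * ((c + 1) * V + 1) + 1) * √((X t + t) / t) := by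
    intro t ht
    have ht0 := ht.1
    have hXt := hX0 t ht
    have h1 : 1 ≤ (X t + t) / t := by rw [le_div_iff₀ ht0]; linarith
    set q := √((X t + t) / t) with hq
    have hq1 : 1 ≤ q := Real.one_le_sqrt.2 h1
    have hq2 : q ^ 2 = (X t + t) / t := Real.sq_sqrt (by linarith)
    have h2 := key t ht q (by linarith)
    have h3 : q⁻¹ * (X t / (2 * t)) ≤ q := by
      rw [inv_mul_le_iff₀ (by linarith), ← sq, hq2, div_le_div_iff₀ (by positivity) ht0]
      nlinarith
    have h4 : (c + q) * V ≤ (c + 1) * V * q := by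
      have : c + q ≤ (c + 1) * q := by nlinarith
      nlinarith
    have h5 : D * ((c + q) * V + q⁻¹ * (X t / (2 * t))) ≤ D * ((c + 1) * V * q + q) := by gcongr
    linarith
  refine ⟨(D * ((c + 1) * V + 1) + 1) ^ 2, by positivity, fun t ht => ?_⟩
  have := le_of_deriv_le_sqrt_div (P := fun t => X t + t)
    (fun t ht => by linarith [hX0 t ht, ht.1])
    (fun t ht => (hXd t ht).add (hasDerivAt_id t)) hle (by
      simpa using hlim.add (tendsto_id.mono_left nhdsWithin_le_nhds)) ht
  beta_reduce at this
  linarith [ht.1]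

end

section
variable {T : ℝ} {u : ℂ → ℝ → ℝ}

theorem tendsto_integral_factor_zero {μ : Measure ℂ}
    (hweak : ∀ f : ℂ → ℝ, Continuous f → HasCompactSupport f →
      Tendsto (fun t => ∫ z, f z * u z t) (nhdsWithin 0 (Ioi 0)) (nhds (∫ z, f z ∂μ)))
    {κ : ℂ → ℝ} {R : ℝ} (hκ : Continuous κ) (hs : ∀ ζ, R ≤ ‖ζ‖ → κ ζ = 0) {z : ℂ}
    (hμ : μ (ball z R) = 0) :
    Tendsto (fun t => ∫ ζ, κ ζ * u (z + ζ) t) (nhdsWithin 0 (Ioi 0)) (nhds 0) := by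
  have hf : ∀ w, w ∉ ball z R → κ (w - z) = 0 := fun w hw =>
    hs _ (by rwa [mem_ball, dist_eq_norm, not_lt] at hw)
  have h := hweak (fun w => κ (w - z)) (by fun_prop)
    (HasCompactSupport.intro (isCompact_closedBall z R) fun w hw =>
      hf w fun h => hw (ball_subset_closedBall h))
  have h0 : ∫ w, κ (w - z) ∂μ = 0 := integral_eq_zero_of_ae
    (measure_mono_null (fun w hw => by_contra fun h => hw (hf w h)) hμ)
  rw [h0] at h
  refine h.congr fun t => ?_
  rw [← integral_add_left_eq_self (fun w => κ (w - z) * u w t) z]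
  simp

/-- Locally uniform `L¹` bound of the rescaled flow away from the initial measure. -/
theorem exists_integral_abs_blowLog_bound (hpos : ∀ z, ∀ t ∈ Ioo 0 T, 0 < u z t)
    (hsmooth : ContDiffOn ℝ (⊤ : ℕ∞) (fun p : ℂ × ℝ => u p.1 p.2) (univ ×ˢ Ioo 0 T))
    (hlfde : ∀ z, ∀ t ∈ Ioo 0 T, deriv (u z) t = lap (fun w => Real.log (u w t)) z)
    (hcomplete : ∀ t ∈ Ioo (0:ℝ) T, ConfComplete (fun z => u z t) univ) {μ : Measure ℂ}
    (hweak : ∀ f : ℂ → ℝ, Continuous f → HasCompactSupport f →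
      Tendsto (fun t => ∫ z, f z * u z t) (nhdsWithin 0 (Ioi 0)) (nhds (∫ z, f z ∂μ)))
    {t₀ R : ℝ} (hR : 0 < R) (ht₀ : t₀ ∈ Ioo 0 T) {z : ℂ} (hμ : μ (ball z R) = 0) :
    ∃ C, 0 ≤ C ∧ ∀ t ∈ Ioc 0 t₀, ∫ ζ in closedBall 0 (R / 2), |blowLog u t (z + ζ)| ≤ C := by
  obtain ⟨M, hM, hMl⟩ := exists_mass_bound hpos hsmooth hlfde hcomplete hR ht₀
    (tendsto_integral_factor_zero hweak (contDiff_massCut R (n := 0)).continuous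
      (fun _ h => massCut_of_ge hR h) hμ)
  obtain ⟨c, hc, hcl⟩ := exists_blowLog_lower_bound hpos hsmooth hlfde hcomplete ht₀ z (R / 2)
  have hB : volume (closedBall (0:ℂ) (R / 2)) ≠ ⊤ := measure_closedBall_lt_top.ne
  refine ⟨volume.real (closedBall (0:ℂ) (R / 2)) * (c + 2) + M, by positivity, fun t ht => ?_⟩
  have hI : t ∈ Ioo 0 T := ⟨ht.1, ht.2.trans_lt ht₀.2⟩
  have hcont : Continuous fun ζ => u (z + ζ) t :=
    (continuous_slice hsmooth.continuousOn hI).comp (continuous_const.add continuous_id)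
  have hinteg : Integrable fun ζ => massCut R ζ * u (z + ζ) t :=
    ((contDiff_massCut R (n := 0)).continuous.mul hcont).integrable_of_hasCompactSupport
      (hasCompactSupport_of_norm_ge fun ζ h => by rw [Pi.mul_apply, massCut_of_ge hR h, zero_mul])
  have hinteg' := hinteg.const_mul t⁻¹
  calc ∫ ζ in closedBall 0 (R / 2), |blowLog u t (z + ζ)|
      ≤ ∫ ζ in closedBall 0 (R / 2), (c + 2 + t⁻¹ * (massCut R ζ * u (z + ζ) t)) := by
        refine setIntegral_mono_on
          ((contDiff_blowLog hpos hsmooth hI z).continuous.abs.continuousOn.integrableOn_compact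
            (isCompact_closedBall _ _))
          ((integrableOn_const hB).add hinteg'.integrableOn) measurableSet_closedBall fun ζ hζ => ?_
        have hζ' : ‖ζ‖ ≤ R / 2 := by simpa using hζ
        have h1 := abs_le_add_two_exp_half hc (hcl t ht ζ hζ')
        have e : t⁻¹ * (massCut R ζ * u (z + ζ) t) = 2 * Real.exp (blowLog u t (z + ζ)) := by
          rw [massCut_of_le hR hζ', exp_blowLog hpos hI]
          have := ht.1.ne'
          field_simp
        rw [e]
        set w := blowLog u t (z + ζ)
        have he2 : Real.exp w = Real.exp (w / 2) ^ 2 := by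
          rw [← Real.exp_nat_mul]; congr 1; push_cast; ring
        rw [he2]
        nlinarith [sq_nonneg (Real.exp (w / 2) - 1)]
    _ = volume.real (closedBall (0:ℂ) (R / 2)) * (c + 2) +
          ∫ ζ in closedBall 0 (R / 2), t⁻¹ * (massCut R ζ * u (z + ζ) t) := by
        have hk : Integrable (fun _ : ℂ => c + 2) (volume.restrict (closedBall (0:ℂ) (R / 2))) :=
          integrableOn_const hB
        rw [integral_add hk hinteg'.integrableOn, setIntegral_const, smul_eq_mul]
    _ ≤ volume.real (closedBall (0:ℂ) (R / 2)) * (c + 2) + M := by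
        gcongr
        refine (setIntegral_le_integral hinteg' (Eventually.of_forall fun ζ => ?_)).trans ?_
        · exact mul_nonneg (inv_nonneg.2 ht.1.le)
            (mul_nonneg (massCut_nonneg R ζ) (hpos _ t hI).le)
        · rw [integral_const_mul, inv_mul_le_iff₀ ht.1, mul_comm]
          exact hMl t ht

end

theorem abs_integral_shift_le {κ W : ℂ → ℝ} {C d r : ℝ} (hW : Continuous W)
    (hC : ∀ ζ, |κ ζ| ≤ C) (hs : ∀ ζ, d ≤ ‖ζ‖ → κ ζ = 0) {a : ℂ} (h : ‖a‖ + d ≤ r) :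
    |∫ ζ, κ ζ * W (a + ζ)| ≤ C * ∫ ζ in closedBall 0 r, |W ζ| := by
  have hi : Integrable ((closedBall (0:ℂ) r).indicator fun ζ => |W ζ|) :=
    (integrable_indicator_iff measurableSet_closedBall).2
      (hW.abs.continuousOn.integrableOn_compact (isCompact_closedBall _ _))
  rw [← integral_indicator measurableSet_closedBall, ← integral_const_mul,
    ← integral_add_left_eq_self (fun ζ => C * (closedBall (0:ℂ) r).indicator (fun ζ => |W ζ|) ζ) a,
    ← Real.norm_eq_abs]
  refine norm_integral_le_of_norm_le ((hi.const_mul C).comp_add_left a)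
    (Eventually.of_forall fun ζ => ?_)
  rw [norm_mul, Real.norm_eq_abs, Real.norm_eq_abs]
  rcases le_or_gt d ‖ζ‖ with hd | hd
  · rw [hs ζ hd]
    simpa using mul_nonneg ((abs_nonneg _).trans (hC 0))
      (indicator_nonneg (fun _ _ => abs_nonneg _) _)
  · rw [indicator_of_mem (by
      rw [mem_closedBall, dist_zero_right]
      exact (norm_add_le _ _).trans (by linarith))]
    exact mul_le_mul_of_nonneg_right (hC ζ) (abs_nonneg _)

section
variable {T : ℝ} {u : ℂ → ℝ → ℝ}

/-- Locally uniform upper bound of the rescaled flow away from the initial measure. -/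
theorem exists_blowLog_upper_bound (hpos : ∀ z, ∀ t ∈ Ioo 0 T, 0 < u z t)
    (hsmooth : ContDiffOn ℝ (⊤ : ℕ∞) (fun p : ℂ × ℝ => u p.1 p.2) (univ ×ˢ Ioo 0 T))
    (hlfde : ∀ z, ∀ t ∈ Ioo 0 T, deriv (u z) t = lap (fun w => Real.log (u w t)) z)
    (hcomplete : ∀ t ∈ Ioo (0:ℝ) T, ConfComplete (fun z => u z t) univ) {μ : Measure ℂ}
    (hweak : ∀ f : ℂ → ℝ, Continuous f → HasCompactSupport f →
      Tendsto (fun t => ∫ z, f z * u z t) (nhdsWithin 0 (Ioi 0)) (nhds (∫ z, f z ∂μ)))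
    {t₀ R : ℝ} (hR : 0 < R) (ht₀ : t₀ ∈ Ioo 0 T) {z₀ : ℂ} (hμ : μ (ball z₀ R) = 0) :
    ∃ C, ∀ t ∈ Ioc 0 t₀, ∀ z ∈ closedBall z₀ (R / 4), blowLog u t z ≤ C := by
  obtain ⟨B, hB, hBl⟩ := exists_integral_abs_blowLog_bound hpos hsmooth hlfde hcomplete hweak hR
    ht₀ hμ
  have hd : 0 < R / 4 := by positivity
  obtain ⟨C, hC, hCl⟩ := exists_deriv_sqCut_bound hd
  refine ⟨4 * C * B / poleMass, fun t ht z hz => ?_⟩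
  have hI : ∀ τ ∈ Ioc 0 t, τ ∈ Ioo 0 T := fun τ h => ⟨h.1, (h.2.trans ht.2).trans_lt ht₀.2⟩
  have htI := hI t ⟨ht.1, le_rfl⟩
  have hcont : ∀ τ ∈ Ioc 0 t, Continuous fun ζ => blowLog u τ (z + ζ) := fun τ h =>
    (contDiff_blowLog hpos hsmooth (hI τ h) z).continuous
  have hzb : ball z (R / 4) ⊆ ball z₀ R := ball_subset_ball' (by
    have := mem_closedBall.1 hz
    linarith)
  have hres : ∀ ε > 0, ∀ τ ∈ Ioc 0 t, -(4 * C * B) ≤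
      ∫ ζ, resKer (R / 4) ε ζ * blowLog u τ (z + ζ) := by
    intro ε hε τ hτ
    have h := abs_integral_shift_le (κ := resKer (R / 4) ε) (d := R / 4) (r := R / 2) (a := z - z₀)
      (C := 4 * C) (contDiff_blowLog hpos hsmooth (hI τ hτ) z₀).continuous
      (fun ζ => by
        rw [resKer, abs_mul, abs_of_pos four_pos]
        exact mul_le_mul_of_nonneg_left (hCl _) four_pos.le)
      (fun _ h => resKer_of_ge hd hε.le h) (by
        have := mem_closedBall.1 hz
        rw [dist_eq_norm] at this
        linarith)
    simp only [← add_assoc, add_sub_cancel] at h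
    have h2 := mul_le_mul_of_nonneg_left (hBl τ ⟨hτ.1, hτ.2.trans ht.2⟩) (by positivity : 0 ≤ 4 * C)
    exact (neg_le_neg (h.trans h2)).trans (neg_abs_le _)
  have hS : ∀ ε > 0, ∫ ζ, approxKer (R / 4) ε ζ * blowLog u t (z + ζ) ≤ 4 * C * B := by
    intro ε hε
    set S := ∫ ζ, approxKer (R / 4) ε ζ * blowLog u t (z + ζ) with hS
    have hinteg : ∀ τ ∈ Ioc 0 t, Integrable fun ζ => approxKer (R / 4) ε ζ * blowLog u τ (z + ζ) :=
      fun τ hτ => ((continuous_approxKer _ hε).mul (hcont τ hτ)).integrable_of_hasCompactSupport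
        (hasCompactSupport_of_norm_ge fun ζ h => by
          rw [Pi.mul_apply, approxKer_of_ge hd hε.le h, zero_mul])
    have hmono : ∀ τ ∈ Ioc 0 t, S ≤ ∫ ζ, approxKer (R / 4) ε ζ * blowLog u τ (z + ζ) :=
      fun τ hτ => integral_mono (hinteg t ⟨ht.1, le_rfl⟩) (hinteg τ hτ) fun ζ =>
        mul_le_mul_of_nonneg_left (antitoneOn_blowLog hpos hsmooth hlfde hcomplete (z + ζ)
          (hI τ hτ) htI hτ.2) (approxKer_nonneg _ hε ζ)
    set A : ℝ → ℝ := fun τ => ∫ ζ, logKer (R / 4) ε ζ * u (z + ζ) τ with hA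
    have hAd : ∀ τ ∈ Ioc 0 t, HasDerivAt (fun τ => A τ - (S - 4 * C * B) * τ) _ τ := fun τ hτ =>
      (hasDerivAt_integral_logKer_reg hpos hsmooth hlfde hd hε (hI τ hτ) z).sub
        ((hasDerivAt_id τ).const_mul (S - 4 * C * B))
    have hAm : MonotoneOn (fun τ => A τ - (S - 4 * C * B) * τ) (Ioc 0 t) := by
      refine monotoneOn_of_deriv_nonneg (convex_Ioc 0 t)
        (fun s hs => (hAd s hs).continuousAt.continuousWithinAt)
        (fun s hs => (hAd s (interior_subset hs)).differentiableAt.differentiableWithinAt)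
        fun s hs => ?_
      have hs := interior_subset hs
      rw [(hAd s hs).deriv]
      linarith [hres ε hε s hs, hmono s hs]
    have hlim : Tendsto (fun τ => A τ - (S - 4 * C * B) * τ) (nhdsWithin 0 (Ioi 0))
        (nhds (0 - (S - 4 * C * B) * 0)) :=
      (tendsto_integral_factor_zero hweak (contDiff_logKer hd hε).continuous
        (fun _ h => logKer_of_ge hd hε.le h) (measure_mono_null hzb hμ)).sub
        ((tendsto_id.mono_left nhdsWithin_le_nhds).const_mul _)
    have h0 : 0 - (S - 4 * C * B) * 0 ≤ A t - (S - 4 * C * B) * t := le_of_tendsto hlim (by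
      filter_upwards [Ioc_mem_nhdsGT ht.1] with s hs
      exact hAm hs ⟨ht.1, le_rfl⟩ hs.2)
    have hA0 : A t ≤ 0 := integral_nonpos_of_ae (by
      filter_upwards [ae_ne_zero] with ζ hζ
      exact mul_nonpos_of_nonpos_of_nonneg (logKer_nonpos hd hε.le hζ) (hpos _ t htI).le)
    by_contra! hlt
    nlinarith [mul_pos (sub_pos.2 hlt) ht.1]
  have hl := tendsto_integral_approxKer hd (hcont t ⟨ht.1, le_rfl⟩)
  rw [add_zero] at hl
  rw [le_div_iff₀ poleMass_pos, mul_comm]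
  exact le_of_tendsto hl (by filter_upwards [self_mem_nhdsWithin] with ε hε using hS ε hε)

end

/-- The logarithm of the initial time blow-up. -/
noncomputable def blowLim (u : ℂ → ℝ → ℝ) (z : ℂ) : ℝ :=
  limUnder (nhdsWithin 0 (Ioi 0)) fun t => blowLog u t z

/-- A locally bounded family converging pointwise near `z₀` as the time tends to zero. -/
def ConvNear (u : ℂ → ℝ → ℝ) (t₀ C : ℝ) (z₀ : ℂ) (r : ℝ) : Prop :=
  ∀ z ∈ closedBall z₀ r, (∀ t ∈ Ioc 0 t₀, |blowLog u t z| ≤ C) ∧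
    Tendsto (fun t => blowLog u t z) (nhdsWithin 0 (Ioi 0)) (nhds (blowLim u z))

section
variable {T : ℝ} {u : ℂ → ℝ → ℝ}

theorem exists_local_limit (hpos : ∀ z, ∀ t ∈ Ioo 0 T, 0 < u z t)
    (hsmooth : ContDiffOn ℝ (⊤ : ℕ∞) (fun p : ℂ × ℝ => u p.1 p.2) (univ ×ˢ Ioo 0 T))
    (hlfde : ∀ z, ∀ t ∈ Ioo 0 T, deriv (u z) t = lap (fun w => Real.log (u w t)) z)
    (hcomplete : ∀ t ∈ Ioo (0:ℝ) T, ConfComplete (fun z => u z t) univ) {μ : Measure ℂ}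
    (hweak : ∀ f : ℂ → ℝ, Continuous f → HasCompactSupport f →
      Tendsto (fun t => ∫ z, f z * u z t) (nhdsWithin 0 (Ioi 0)) (nhds (∫ z, f z ∂μ)))
    {t₀ : ℝ} (ht₀ : t₀ ∈ Ioo 0 T) {z₀ : ℂ} (hz₀ : z₀ ∈ (measSupport μ)ᶜ) :
    ∃ r > 0, ∃ C, ConvNear u t₀ C z₀ r := by
  obtain ⟨U, hU, hzU, hμU⟩ : ∃ U, IsOpen U ∧ z₀ ∈ U ∧ μ U = 0 := by
    simpa [measSupport] using hz₀
  obtain ⟨R, hR, hRU⟩ := isOpen_iff.1 hU z₀ hzU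
  obtain ⟨C, hC⟩ := exists_blowLog_upper_bound hpos hsmooth hlfde hcomplete hweak hR ht₀
    (measure_mono_null hRU hμU)
  obtain ⟨c, hc, hcl⟩ := exists_blowLog_lower_bound hpos hsmooth hlfde hcomplete ht₀ z₀ (R / 4)
  refine ⟨R / 4, by positivity, max C c, fun z hz => ⟨fun t ht => abs_le.2 ⟨?_, ?_⟩, ?_⟩⟩
  · have h := hcl t ht (z - z₀) (by rwa [mem_closedBall, dist_eq_norm] at hz)
    rw [add_sub_cancel] at h
    linarith [le_max_right C c]
  · exact (hC t ht z hz).trans (le_max_left _ _)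
  · have hanti := (antitoneOn_blowLog hpos hsmooth hlfde hcomplete z).mono
      (Ioo_subset_Ioo_right ht₀.2.le)
    exact tendsto_nhds_limUnder ⟨_, hanti.tendsto_nhdsWithin_Ioo_right (nonempty_Ioo.2 ht₀.1) ⟨C, by
      rintro _ ⟨t, ht, rfl⟩
      exact hC t ⟨ht.1, ht.2.le⟩ z hz⟩⟩

theorem tendsto_integral_convNear (hpos : ∀ z, ∀ t ∈ Ioo 0 T, 0 < u z t)
    (hsmooth : ContDiffOn ℝ (⊤ : ℕ∞) (fun p : ℂ × ℝ => u p.1 p.2) (univ ×ˢ Ioo 0 T))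
    {t₀ C d : ℝ} (ht₀ : t₀ ∈ Ioo 0 T) {z : ℂ} (hconv : ConvNear u t₀ C z d) {κ : ℂ → ℝ}
    (hκ : Integrable κ) (hs : ∀ ζ, d ≤ ‖ζ‖ → κ ζ = 0) {G : ℝ → ℝ} (hG : Continuous G) :
    Tendsto (fun t => ∫ ζ, κ ζ * G (blowLog u t (z + ζ))) (nhdsWithin 0 (Ioi 0))
      (nhds (∫ ζ, κ ζ * G (blowLim u (z + ζ)))) := by
  obtain ⟨M, hM⟩ := (isCompact_Icc (a := -C) (b := C)).exists_bound_of_continuousOn hG.continuousOn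
  have hmem : ∀ ζ : ℂ, ‖ζ‖ < d → z + ζ ∈ closedBall z d := fun ζ h => by
    simpa [mem_closedBall, dist_eq_norm] using h.le
  have hev : ∀ᶠ t in nhdsWithin (0:ℝ) (Ioi 0), t ∈ Ioc 0 t₀ := Ioc_mem_nhdsGT ht₀.1
  refine tendsto_integral_filter_of_dominated_convergence (fun ζ => ‖κ ζ‖ * M) ?_ ?_
    (hκ.norm.mul_const M) (Eventually.of_forall fun ζ => ?_)
  · filter_upwards [hev] with t ht
    exact hκ.1.mul (hG.comp (contDiff_blowLog hpos hsmooth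
      ⟨ht.1, ht.2.trans_lt ht₀.2⟩ z).continuous).aestronglyMeasurable
  · filter_upwards [hev] with t ht
    refine Eventually.of_forall fun ζ => ?_
    rw [norm_mul]
    rcases le_or_gt d ‖ζ‖ with h | h
    · simp [hs ζ h]
    · exact mul_le_mul_of_nonneg_left (hM _ (abs_le.1 ((hconv _ (hmem ζ h)).1 t ht)))
        (norm_nonneg _)
  · rcases le_or_gt d ‖ζ‖ with h | h
    · simp [hs ζ h]
    · exact ((hG.tendsto _).comp (hconv _ (hmem ζ h)).2).const_mul _

/-- The integral equation satisfied by the initial time blow-up. -/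
theorem blowLim_representation (hpos : ∀ z, ∀ t ∈ Ioo 0 T, 0 < u z t)
    (hsmooth : ContDiffOn ℝ (⊤ : ℕ∞) (fun p : ℂ × ℝ => u p.1 p.2) (univ ×ˢ Ioo 0 T))
    (hlfde : ∀ z, ∀ t ∈ Ioo 0 T, deriv (u z) t = lap (fun w => Real.log (u w t)) z)
    {t₀ C d : ℝ} (ht₀ : t₀ ∈ Ioo 0 T) (hd : 0 < d) {z : ℂ} (hconv : ConvNear u t₀ C z d) :
    ∫ ζ, logKer d 0 ζ * (2 * Real.exp (blowLim u (z + ζ))) =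
      (∫ ζ, resKer d 0 ζ * blowLim u (z + ζ)) + poleMass * blowLim u z := by
  have hev : ∀ᶠ t in nhdsWithin (0:ℝ) (Ioi 0), t ∈ Ioo 0 T := by
    filter_upwards [Ioc_mem_nhdsGT ht₀.1] with t ht using ⟨ht.1, ht.2.trans_lt ht₀.2⟩
  have hres : Integrable (resKer d 0) :=
    (contDiff_resKer d 0).continuous.integrable_of_hasCompactSupport
      (hasCompactSupport_of_norm_ge fun _ h => resKer_of_ge hd le_rfl h)
  have h1 := tendsto_integral_convNear hpos hsmooth ht₀ hconv (integrable_logKer hd le_rfl)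
    (fun _ h => logKer_of_ge hd le_rfl h) (G := fun x => 2 * Real.exp x) (by fun_prop)
  have h2 := (tendsto_integral_convNear hpos hsmooth ht₀ hconv hres
    (fun _ h => resKer_of_ge hd le_rfl h) (G := fun x => x) continuous_id).add
      ((hconv z (mem_closedBall_self hd.le)).2.const_mul poleMass)
  set A : ℝ → ℝ := fun t => ∫ ζ, logKer d 0 ζ * u (z + ζ) t with hA
  have hAeq : ∀ t ∈ Ioo 0 T, A t = t * ∫ ζ, logKer d 0 ζ * (2 * Real.exp (blowLog u t (z + ζ))) :=
    fun t ht => by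
      rw [← integral_const_mul]
      refine integral_congr_ae (Eventually.of_forall fun ζ => ?_)
      have := ht.1.ne'
      beta_reduce
      rw [exp_blowLog hpos ht]
      field_simp
  have hA0 : Tendsto A (nhdsWithin 0 (Ioi 0)) (nhds 0) := by
    have h := (tendsto_id.mono_left (nhdsWithin_le_nhds (a := (0:ℝ)) (s := Ioi 0))).mul h1
    rw [zero_mul] at h
    refine h.congr' ?_
    filter_upwards [hev] with t ht using (hAeq t ht).symm
  have h3 := HasDerivAt.lhopital_zero_nhdsGT (f := A) (g := fun t => t) (g' := fun _ => 1)
    (by filter_upwards [hev] with t ht using hasDerivAt_integral_logKer hpos hsmooth hlfde hd ht z)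
    (Eventually.of_forall fun t => hasDerivAt_id t) (Eventually.of_forall fun _ => one_ne_zero)
    hA0 (tendsto_id.mono_left nhdsWithin_le_nhds) (by simpa using h2)
  refine tendsto_nhds_unique h1 (h3.congr' ?_)
  filter_upwards [hev] with t ht
  rw [hAeq t ht, mul_div_cancel_left₀ _ ht.1.ne']

end

theorem contDiff_bump_mul {n : ℕ∞} {f : ℂ → ℝ} {U : Set ℂ} (hU : IsOpen U) (hf : ContDiffOn ℝ n f U)
    {c : ℂ} (χ : ContDiffBump c) (h : closedBall c χ.rOut ⊆ U) :
    ContDiff ℝ n fun z => χ z * f z := by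
  refine contDiff_iff_contDiffAt.2 fun z => ?_
  by_cases hz : z ∈ U
  · exact χ.contDiff.contDiffAt.mul (hf.contDiffAt (hU.mem_nhds hz))
  · have hz' : z ∉ tsupport χ := fun hs => hz (h (χ.tsupport_eq ▸ hs))
    refine contDiffAt_const (c := (0:ℝ)) |>.congr_of_eventuallyEq ?_
    filter_upwards [notMem_tsupport_iff_eventuallyEq.1 hz'] with w hw
    simp [hw]

/-- The integral form of the equation `Δ W = 2 exp W` on a ball. -/
def LocalRep (W : ℂ → ℝ) (z₀ : ℂ) (r : ℝ) : Prop :=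
  ∀ z d, 0 < d → closedBall z d ⊆ closedBall z₀ r →
    ∫ ζ, logKer d 0 ζ * (2 * Real.exp (W (z + ζ))) =
      (∫ ζ, resKer d 0 ζ * W (z + ζ)) + poleMass * W z

section
variable {W : ℂ → ℝ} {z₀ : ℂ} {r : ℝ}

theorem LocalRep.eq_convolution (h : LocalRep W z₀ r) {δ : ℝ} (hδ : 0 < δ) {z₁ : ℂ} {F E : ℂ → ℝ}
    (hsub : closedBall z₁ (2 * δ) ⊆ closedBall z₀ r)
    (hF : ∀ w ∈ closedBall z₁ (2 * δ), F w = 2 * Real.exp (W w))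
    (hE : ∀ w ∈ closedBall z₁ (2 * δ), E w = W w) {z : ℂ} (hz : z ∈ ball z₁ δ) :
    W z = poleMass⁻¹ * (convolution (logKer δ 0) F (ContinuousLinearMap.mul ℝ ℝ) volume z -
      convolution (resKer δ 0) E (ContinuousLinearMap.mul ℝ ℝ) volume z) := by
  have hzs : closedBall z δ ⊆ closedBall z₁ (2 * δ) :=
    closedBall_subset_closedBall' (by linarith [mem_ball.1 hz])
  have hmem : ∀ ζ : ℂ, ‖ζ‖ < δ → z + ζ ∈ closedBall z₁ (2 * δ) := fun ζ hζ =>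
    hzs (by simpa [mem_closedBall, dist_eq_norm] using hζ.le)
  have h1 := h z δ hδ (hzs.trans hsub)
  have hL : ∫ ζ, logKer δ 0 ζ * F (z + ζ) = ∫ ζ, logKer δ 0 ζ * (2 * Real.exp (W (z + ζ))) := by
    refine integral_congr_ae (Eventually.of_forall fun ζ => ?_)
    rcases lt_or_ge ‖ζ‖ δ with hζ | hζ
    · simp only [hF _ (hmem ζ hζ)]
    · simp [logKer_of_ge hδ le_rfl hζ]
  have hR : ∫ ζ, resKer δ 0 ζ * E (z + ζ) = ∫ ζ, resKer δ 0 ζ * W (z + ζ) := by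
    refine integral_congr_ae (Eventually.of_forall fun ζ => ?_)
    rcases lt_or_ge ‖ζ‖ δ with hζ | hζ
    · simp only [hE _ (hmem ζ hζ)]
    · simp [resKer_of_ge hδ le_rfl hζ]
  rw [← integral_even_mul_shift (logKer_neg_arg δ 0),
      ← integral_even_mul_shift (resKer_neg_arg δ 0),
    hL, hR, h1]
  field_simp [poleMass_pos.ne']
  ring

theorem LocalRep.continuousOn (h : LocalRep W z₀ r) {C : ℝ} (hC : ∀ z ∈ closedBall z₀ r, |W z| ≤ C)
    (hm : AEStronglyMeasurable ((closedBall z₀ r).indicator W)) : ContinuousOn W (ball z₀ r) := by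
  intro z₁ hz₁
  refine ContinuousAt.continuousWithinAt ?_
  set δ := (r - dist z₁ z₀) / 2 with hδd
  have hδ : 0 < δ := by have := mem_ball.1 hz₁; simp only [δ]; linarith
  have hsub : closedBall z₁ (2 * δ) ⊆ closedBall z₀ r :=
    closedBall_subset_closedBall' (by simp only [δ]; linarith)
  have hC0 : 0 ≤ C := (abs_nonneg _).trans (hC z₁ (ball_subset_closedBall hz₁))
  set E := (closedBall z₀ r).indicator W with hEd
  set F := (closedBall z₀ r).indicator fun z => 2 * Real.exp (E z) with hFd
  have hEb : ∀ z, ‖E z‖ ≤ C := fun z => by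
    by_cases hz : z ∈ closedBall z₀ r
    · rw [hEd, indicator_of_mem hz]; exact hC z hz
    · rw [hEd, indicator_of_notMem hz]; simpa
  have hFm : AEStronglyMeasurable F :=
    (((Real.continuous_exp.comp_aestronglyMeasurable hm).const_mul 2)).indicator
      measurableSet_closedBall
  have hFb : ∀ z, ‖F z‖ ≤ 2 * Real.exp C := fun z => by
    refine (norm_indicator_le_norm_self _ _).trans ?_
    rw [Real.norm_of_nonneg (by positivity)]
    gcongr
    exact (le_abs_self _).trans (hEb z)
  have hEl : LocallyIntegrable E := fun z => ⟨closedBall z 1, closedBall_mem_nhds z one_pos,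
    Measure.integrableOn_of_bounded (M := C) measure_closedBall_lt_top.ne hm
      (Eventually.of_forall hEb)⟩
  have hcont := ((hasFDerivAt_logKer_conv hδ hFm hFb z₁).continuousAt.sub
    (contDiff_resKer_conv hδ hEl).continuous.continuousAt).const_mul poleMass⁻¹
  refine hcont.congr ?_
  filter_upwards [ball_mem_nhds z₁ hδ] with z hz
  refine (h.eq_convolution hδ hsub (fun w hw => ?_) (fun w hw => ?_) hz).symm
  · rw [hFd, indicator_of_mem (hsub hw), hEd, indicator_of_mem (hsub hw)]
  · rw [hEd, indicator_of_mem (hsub hw)]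

theorem exists_bump {z₁ : ℂ} (hz₁ : z₁ ∈ ball z₀ r) :
    ∃ δ > 0, ∃ χ : ContDiffBump z₁, χ.rIn = 2 * δ ∧ closedBall z₁ χ.rOut ⊆ ball z₀ r := by
  have h : 0 < r - dist z₁ z₀ := by linarith [mem_ball.1 hz₁]
  refine ⟨(r - dist z₁ z₀) / 4, by linarith,
    ⟨2 * ((r - dist z₁ z₀) / 4), 3 * ((r - dist z₁ z₀) / 4), by linarith, by linarith⟩, rfl, ?_⟩
  exact closedBall_subset_ball' (by dsimp only; linarith)

theorem LocalRep.contDiffOn_nat (h : LocalRep W z₀ r) (hW : ContinuousOn W (ball z₀ r)) (m : ℕ) :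
    ContDiffOn ℝ m W (ball z₀ r) := by
  induction m with
  | zero => exact contDiffOn_zero.2 hW
  | succ m ih =>
    intro z₁ hz₁
    refine ContDiffAt.contDiffWithinAt ?_
    obtain ⟨δ, hδ, χ, hin, hout⟩ := exists_bump hz₁
    have hsub : closedBall z₁ (2 * δ) ⊆ ball z₀ r :=
      (closedBall_subset_closedBall (hin ▸ χ.rIn_lt_rOut.le)).trans hout
    have hF : ContDiff ℝ m fun z => χ z * (2 * Real.exp (W z)) :=
      contDiff_bump_mul (n := m) isOpen_ball (contDiffOn_const.mul ih.exp) χ hout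
    have hE : ContDiff ℝ m fun z => χ z * W z := contDiff_bump_mul (n := m) isOpen_ball ih χ hout
    have hone : ∀ w ∈ closedBall z₁ (2 * δ), χ w = 1 := fun w hw =>
      χ.one_of_mem_closedBall (hin.symm ▸ hw)
    have hcd := contDiff_const (c := poleMass⁻¹) |>.mul
      ((contDiff_logKer_conv hδ hF χ.hasCompactSupport.mul_right).sub
      ((contDiff_resKer_conv hδ hE.continuous.locallyIntegrable).of_le
        (WithTop.coe_le_coe.2 (le_top : ((m + 1 : ℕ) : ℕ∞) ≤ ⊤))))
    refine hcd.contDiffAt.congr_of_eventuallyEq ?_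
    filter_upwards [ball_mem_nhds z₁ hδ] with z hz
    exact h.eq_convolution hδ (hsub.trans ball_subset_closedBall)
      (fun w hw => by simp [hone w hw]) (fun w hw => by simp [hone w hw]) hz

theorem LocalRep.contDiffOn (h : LocalRep W z₀ r) (hW : ContinuousOn W (ball z₀ r)) :
    ContDiffOn ℝ (⊤ : ℕ∞) W (ball z₀ r) :=
  contDiffOn_infty.2 (h.contDiffOn_nat hW)

end

theorem nonpos_of_integral_logKer_mul_eq_zero {f : ℂ → ℝ} (hf : Continuous f) {δ : ℝ} (hδ : 0 < δ)
    (h : ∀ d ∈ Ioo 0 δ, ∫ ζ, logKer d 0 ζ * f ζ = 0) : f 0 ≤ 0 := by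
  by_contra! h0
  obtain ⟨ρ, hρ, hball⟩ := Metric.isOpen_iff.1 (isOpen_lt continuous_const hf) 0 h0
  set d := min ρ δ / 2 with hdd
  have hd : 0 < d := by positivity
  have hdρ : d < ρ := by simp only [d]; linarith [min_le_left ρ δ]
  have hdδ : d < δ := by simp only [d]; linarith [min_le_right ρ δ]
  have hpos : ∀ ζ : ℂ, ‖ζ‖ < d → 0 < f ζ := fun ζ hζ => hball (by simpa using hζ.trans hdρ)
  have hnn : 0 ≤ᵐ[volume] fun ζ => -(logKer d 0 ζ * f ζ) := by
    filter_upwards [ae_ne_zero] with ζ hne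
    simp only [Pi.zero_apply]
    rcases lt_or_ge ‖ζ‖ d with hζ | hζ
    · exact neg_nonneg.2 (mul_nonpos_of_nonpos_of_nonneg (logKer_nonpos hd le_rfl hne)
        (hpos ζ hζ).le)
    · simp [logKer_of_ge hd le_rfl hζ]
  have hinteg := integrable_mul_of_eq_zero (integrable_logKer hd le_rfl)
    (fun _ h => logKer_of_ge hd le_rfl h) hf
  have h0' := (integral_eq_zero_iff_of_nonneg_ae hnn hinteg.neg).1 (by
    rw [integral_neg, h d ⟨hd, hdδ⟩, neg_zero])
  have hnull : volume (ball (0:ℂ) d) = 0 := by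
    refine measure_mono_null ?_ (ae_iff.1 (h0'.and ae_ne_zero))
    intro ζ hζ
    have hζ' : ‖ζ‖ < d := by simpa using hζ
    simp only [mem_ofPred_eq, not_and_or, Pi.zero_apply]
    by_cases hne : ζ = 0
    · exact Or.inr (not_not.2 hne)
    · have := cutLog_neg hd (s := ‖ζ‖ ^ 2 + 0) (by positivity)
          (by rw [add_zero]; gcongr)
      exact Or.inl (neg_ne_zero.2 (mul_neg_of_neg_of_pos this (hpos ζ hζ')).ne)
  exact (measure_ball_pos volume (0:ℂ) hd).ne' hnull

theorem eq_zero_of_integral_logKer_mul_eq_zero {f : ℂ → ℝ} (hf : Continuous f) {δ : ℝ} (hδ : 0 < δ)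
    (h : ∀ d ∈ Ioo 0 δ, ∫ ζ, logKer d 0 ζ * f ζ = 0) : f 0 = 0 := by
  refine le_antisymm (nonpos_of_integral_logKer_mul_eq_zero hf hδ h) (neg_nonpos.1
    (nonpos_of_integral_logKer_mul_eq_zero hf.neg hδ fun d hd => ?_))
  simp [integral_neg, h d hd]

theorem LocalRep.lap_eq {W : ℂ → ℝ} {z₀ : ℂ} {r : ℝ} (h : LocalRep W z₀ r)
    (hW : ContDiffOn ℝ (⊤ : ℕ∞) W (ball z₀ r)) {z : ℂ} (hz : z ∈ ball z₀ r) :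
    lap W z = 2 * Real.exp (W z) := by
  obtain ⟨δ, hδ, χ, hin, hout⟩ := exists_bump hz
  have hsub : closedBall z (2 * δ) ⊆ ball z₀ r :=
    (closedBall_subset_closedBall (hin ▸ χ.rIn_lt_rOut.le)).trans hout
  set f : ℂ → ℝ := fun ζ => χ (z + ζ) * W (z + ζ) with hfd
  have hf : ContDiff ℝ (⊤ : ℕ∞) f := (contDiff_bump_mul isOpen_ball hW χ hout).comp
    (contDiff_const.add contDiff_id)
  have hf2 : ContDiff ℝ 2 f := hf.of_le (WithTop.coe_le_coe.2 (le_top : (2 : ℕ∞) ≤ ⊤))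
  have hfW : ∀ ζ : ℂ, ‖ζ‖ < δ → f ζ = W (z + ζ) := fun ζ hζ => by
    rw [hfd]
    dsimp only
    rw [χ.one_of_mem_closedBall, one_mul]
    rw [hin, mem_closedBall, dist_eq_norm, add_sub_cancel_left]
    linarith
  have hf0 : f 0 = W z := by rw [hfW 0 (by simpa), add_zero]
  have key := eq_zero_of_integral_logKer_mul_eq_zero
    (f := fun ζ => lap f ζ - 2 * Real.exp (f ζ))
    ((continuous_lap hf2).sub (continuous_const.mul hf2.continuous.rexp)) hδ fun d hd => by
      have h1 := green_representation hd.1 hf2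
      have h2 := h z d hd.1 (((closedBall_subset_closedBall (by linarith [hd.2])).trans hsub).trans
        ball_subset_closedBall)
      have hL : ∫ ζ, logKer d 0 ζ * (2 * Real.exp (f ζ)) =
          ∫ ζ, logKer d 0 ζ * (2 * Real.exp (W (z + ζ))) := by
        refine integral_congr_ae (Eventually.of_forall fun ζ => ?_)
        rcases lt_or_ge ‖ζ‖ d with hζ | hζ
        · simp only [hfW ζ (hζ.trans hd.2)]
        · simp [logKer_of_ge hd.1 le_rfl hζ]
      have hR : ∫ ζ, resKer d 0 ζ * f ζ = ∫ ζ, resKer d 0 ζ * W (z + ζ) := by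
        refine integral_congr_ae (Eventually.of_forall fun ζ => ?_)
        rcases lt_or_ge ‖ζ‖ d with hζ | hζ
        · simp only [hfW ζ (hζ.trans hd.2)]
        · simp [resKer_of_ge hd.1 le_rfl hζ]
      have hi : ∀ {g : ℂ → ℝ}, Continuous g → Integrable fun ζ => logKer d 0 ζ * g ζ :=
        integrable_mul_of_eq_zero (integrable_logKer hd.1 le_rfl)
          (fun _ h => logKer_of_ge hd.1 le_rfl h)
      simp only [mul_sub]
      rw [integral_sub (hi (continuous_lap hf2)) (hi (by fun_prop)), h1, hL, h2, hR, hf0, sub_self]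
  have hlap : lap f 0 = lap W z := by
    have h3 := lap_comp_add_left W z 0
    rw [add_zero] at h3
    rw [← h3]
    refine lap_congr ?_
    filter_upwards [ball_mem_nhds (0:ℂ) hδ] with ζ hζ using hfW ζ (by simpa using hζ)
  beta_reduce at key
  rw [hlap, hf0] at key
  linarith

section
variable {T : ℝ} {u : ℂ → ℝ → ℝ}

theorem ConvNear.abs_blowLim_le {t₀ C r : ℝ} (ht₀ : 0 < t₀) {z₀ : ℂ} (h : ConvNear u t₀ C z₀ r)
    {z : ℂ} (hz : z ∈ closedBall z₀ r) : |blowLim u z| ≤ C := by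
  refine le_of_tendsto (h z hz).2.abs ?_
  filter_upwards [Ioc_mem_nhdsGT ht₀] with t ht using (h z hz).1 t ht

theorem ConvNear.aestronglyMeasurable (hpos : ∀ z, ∀ t ∈ Ioo 0 T, 0 < u z t)
    (hsmooth : ContDiffOn ℝ (⊤ : ℕ∞) (fun p : ℂ × ℝ => u p.1 p.2) (univ ×ˢ Ioo 0 T))
    {t₀ C r : ℝ} (ht₀ : t₀ ∈ Ioo 0 T) {z₀ : ℂ} (h : ConvNear u t₀ C z₀ r) :
    AEStronglyMeasurable ((closedBall z₀ r).indicator (blowLim u)) := by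
  refine aestronglyMeasurable_of_tendsto_ae atTop
    (f := fun n : ℕ => (closedBall z₀ r).indicator (blowLog u (t₀ / ((n : ℝ) + 1)))) (fun n => ?_)
    (Eventually.of_forall fun z => ?_)
  · have ht : t₀ / ((n : ℝ) + 1) ∈ Ioo 0 T :=
      ⟨div_pos ht₀.1 (by positivity), (div_le_self ht₀.1.le (by simp)).trans_lt ht₀.2⟩
    have hc := (contDiff_blowLog hpos hsmooth ht 0).continuous
    simp only [zero_add] at hc
    exact hc.aestronglyMeasurable.indicator measurableSet_closedBall
  · by_cases hz : z ∈ closedBall z₀ r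
    · simp only [indicator_of_mem hz]
      refine (h z hz).2.comp (tendsto_nhdsWithin_iff.2 ⟨?_, Eventually.of_forall fun n =>
        div_pos ht₀.1 (by positivity)⟩)
      exact tendsto_const_nhds.div_atTop
        (tendsto_atTop_add_const_right _ _ tendsto_natCast_atTop_atTop)
    · simp only [indicator_of_notMem hz, tendsto_const_nhds]

theorem exists_local_regularity (hpos : ∀ z, ∀ t ∈ Ioo 0 T, 0 < u z t)
    (hsmooth : ContDiffOn ℝ (⊤ : ℕ∞) (fun p : ℂ × ℝ => u p.1 p.2) (univ ×ˢ Ioo 0 T))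
    (hlfde : ∀ z, ∀ t ∈ Ioo 0 T, deriv (u z) t = lap (fun w => Real.log (u w t)) z)
    (hcomplete : ∀ t ∈ Ioo (0:ℝ) T, ConfComplete (fun z => u z t) univ) {μ : Measure ℂ}
    (hweak : ∀ f : ℂ → ℝ, Continuous f → HasCompactSupport f →
      Tendsto (fun t => ∫ z, f z * u z t) (nhdsWithin 0 (Ioi 0)) (nhds (∫ z, f z ∂μ)))
    {t₀ : ℝ} (ht₀ : t₀ ∈ Ioo 0 T) {z₀ : ℂ} (hz₀ : z₀ ∈ (measSupport μ)ᶜ) :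
    Tendsto (fun t => blowLog u t z₀) (nhdsWithin 0 (Ioi 0)) (nhds (blowLim u z₀)) ∧
      ContDiffAt ℝ (⊤ : ℕ∞) (blowLim u) z₀ ∧ lap (blowLim u) z₀ = 2 * Real.exp (blowLim u z₀) := by
  obtain ⟨r, hr, C, h⟩ := exists_local_limit hpos hsmooth hlfde hcomplete hweak ht₀ hz₀
  have hrep : LocalRep (blowLim u) z₀ r := fun z d hd hsub =>
    blowLim_representation hpos hsmooth hlfde ht₀ hd fun w hw => h w (hsub hw)
  have hW := hrep.contDiffOn (hrep.continuousOn (fun z hz => h.abs_blowLim_le ht₀.1 hz)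
    (h.aestronglyMeasurable hpos hsmooth ht₀))
  exact ⟨(h z₀ (mem_closedBall_self hr.le)).2, hW.contDiffAt (ball_mem_nhds z₀ hr),
    hrep.lap_eq hW (mem_ball_self hr)⟩

end

/-- The initial time blow-up is hyperbolic away from the support of the initial
measure: `û := lim_{t↘0} u(·,t)/(2t)` exists, is positive and smooth on `ℂ \ supp μ`, and
satisfies `Δ log û = 2û` there (constant Gaussian curvature `−1`). -/
theorem initial_blowup_hyperbolic
    (T : ℝ) (hT : 0 < T) (u : ℂ → ℝ → ℝ)
    (hpos : ∀ (z : ℂ), ∀ t ∈ Ioo (0:ℝ) T, 0 < u z t)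
    (hsmooth : ContDiffOn ℝ (⊤ : ℕ∞) (fun p : ℂ × ℝ => u p.1 p.2)
      ((univ : Set ℂ) ×ˢ Ioo (0:ℝ) T))
    (hlfde : ∀ (z : ℂ), ∀ t ∈ Ioo (0:ℝ) T,
      deriv (u z) t = lap (fun w => Real.log (u w t)) z)
    (hcomplete : ∀ t ∈ Ioo (0:ℝ) T, ConfComplete (fun z => u z t) univ)
    (μ : Measure ℂ) (hμ0 : μ ≠ 0) (hna : ∀ z : ℂ, μ {z} = 0)
    (hrad : ∀ K : Set ℂ, IsCompact K → μ K < ⊤)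
    (hweak : ∀ f : ℂ → ℝ, Continuous f → HasCompactSupport f →
      Tendsto (fun t => ∫ z, f z * u z t) (nhdsWithin 0 (Ioi 0)) (nhds (∫ z, f z ∂μ))) :
    ∃ uhat : ℂ → ℝ,
      (∀ z ∈ (measSupport μ)ᶜ,
        Tendsto (fun t => u z t / (2 * t)) (nhdsWithin 0 (Ioi 0)) (nhds (uhat z))) ∧
      (∀ z ∈ (measSupport μ)ᶜ, 0 < uhat z) ∧
      ContDiffOn ℝ (⊤ : ℕ∞) uhat (measSupport μ)ᶜ ∧
      (∀ z ∈ (measSupport μ)ᶜ, lap (fun w => Real.log (uhat w)) z = 2 * uhat z) := by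
  have key : ∀ z ∈ (measSupport μ)ᶜ, _ := fun z hz => exists_local_regularity hpos hsmooth hlfde
    hcomplete hweak (t₀ := T / 2) ⟨by linarith, by linarith⟩ hz
  refine ⟨fun z => Real.exp (blowLim u z), fun z hz => ?_, fun z _ => Real.exp_pos _,
    fun z hz => (key z hz).2.1.exp.contDiffWithinAt, fun z hz => ?_⟩
  · refine ((Real.continuous_exp.tendsto _).comp (key z hz).1).congr' ?_
    filter_upwards [Ioo_mem_nhdsGT hT] with t ht using exp_blowLog hpos ht z
  · simpa only [Real.log_exp] using (key z hz).2.2
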